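/- arXiv:math/0301247 — 4 statements merged into one kernel-verified Lean document; each statement's English description precedes it below -/
import Mathlib

section
/- Every element β of the group C_n of conjugating automorphisms of F_n can be written in the form β = β_1 β_2 ⋯ β_{n-1} π_β, where π_β is a permutation automorphism (an automorphism sending x_i ↦ x_{π(i)} for some permutation π ∈ S_n) and each β_j belongs to the subgroup D_j. -/
/-- The basis-conjugating automorphism ε_{ij} of the free group:
`x_i ↦ x_j⁻¹ x_i x_j`, `x_l ↦ x_l` for `l ≠ i`. -/
def eps {n : ℕ} (i j : Fin n) : MulAut (FreeGroup (Fin n)) :=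
  MonoidHom.toMulEquiv
    (FreeGroup.lift fun l =>
      if l = i then (FreeGroup.of j)⁻¹ * FreeGroup.of i * FreeGroup.of j else FreeGroup.of l)
    (FreeGroup.lift fun l =>
      if l = i then FreeGroup.of j * FreeGroup.of i * (FreeGroup.of j)⁻¹ else FreeGroup.of l)
    (by ext l; by_cases h : l = i <;> by_cases h2 : j = i <;> simp [h, h2, mul_assoc])
    (by ext l; by_cases h : l = i <;> by_cases h2 : j = i <;> simp [h, h2, mul_assoc])

/-- The subgroup `D_j` (0-based), generated by `ε_{j,t}` and `ε_{t,j}` for `t < j`. -/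
def Dsub {n : ℕ} (j : Fin n) : Subgroup (MulAut (FreeGroup (Fin n))) :=
  Subgroup.closure {e | ∃ t : Fin n, t < j ∧ (e = eps j t ∨ e = eps t j)}

/-- An automorphism of the free group is conjugating if it sends each generator `x_i`
to `f_i⁻¹ x_{π(i)} f_i` for some `f_i` and a permutation `π`. -/
def IsConjugating {n : ℕ} (φ : MulAut (FreeGroup (Fin n))) : Prop :=
  ∃ π : Equiv.Perm (Fin n), ∀ i : Fin n, ∃ f : FreeGroup (Fin n),
    φ (FreeGroup.of i) = f⁻¹ * FreeGroup.of (π i) * f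

namespace FreeGroup

variable {α : Type*}

theorem mk_cons (p : α × Bool) (L : List (α × Bool)) : mk (p :: L) = mk [p] * mk L := by
  rw [mul_mk]; rfl

theorem map_mk_singleton_of_conj {φ : MulAut (FreeGroup α)} {i : α} {f : FreeGroup α}
    (h : φ (of i) = f⁻¹ * of i * f) (e : Bool) : φ (mk [(i, e)]) = f⁻¹ * mk [(i, e)] * f := by
  cases e
  · have : (mk [(i, false)] : FreeGroup α) = (of i)⁻¹ := rfl
    rw [this, _root_.map_inv, h]
    group
  · exact h

variable [DecidableEq α]

/-- Two reduced words multiply without cancellation as soon as the first letter of the inverse of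
the left factor differs from the first letter of the right factor. -/
theorem toWord_mul_of_head_ne {g h : FreeGroup α}
    (hd : ∀ p ∈ g⁻¹.toWord.head?, p ∉ h.toWord.head?) :
    (g * h).toWord = g.toWord ++ h.toWord := by
  rw [toWord_mul]
  refine IsReduced.reduce_eq (List.isChain_append.mpr ⟨isReduced_toWord, isReduced_toWord, ?_⟩)
  rintro ⟨a, b⟩ hx ⟨c, d⟩ hy hac
  have h1 : (a, !b) ∈ g⁻¹.toWord.head? := by
    rw [toWord_inv]
    simpa [invRev] using hx
  by_contra hbd
  refine hd _ h1 ?_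
  have hdb : d = !b := by cases b <;> cases d <;> simp_all
  simp only at hac
  rwa [hac, ← hdb]

theorem head?_toWord_mk_singleton_mul {a : α} {e : Bool} {g : FreeGroup α}
    (hg : (a, !e) ∉ g.toWord.head?) : (mk [(a, e)] * g).toWord.head? = some (a, e) := by
  rw [toWord_mul_of_head_ne]
  · simp
  · rw [inv_mk]
    simpa [invRev] using hg

/-- If no `f i` and no `f i * (f j)⁻¹` starts with `x_i` or its inverse, then the leading letter of a
reduced word survives, preceded by `(f i)⁻¹`, in its image under `x_i ↦ (f i)⁻¹ x_i (f i)`. -/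
theorem head?_toWord_mul_map_mk_cons {φ : MulAut (FreeGroup α)} {f : α → FreeGroup α}
    (hφ : ∀ i, φ (of i) = (f i)⁻¹ * of i * f i)
    (hf : ∀ i, ∀ p ∈ (f i).toWord.head?, p.1 ≠ i)
    (hff : ∀ i j, ∀ p ∈ (f i * (f j)⁻¹).toWord.head?, p.1 ≠ i)
    (L : List (α × Bool)) :
    ∀ i e, IsReduced ((i, e) :: L) →
      (f i * φ (mk ((i, e) :: L))).toWord.head? = some (i, e) := by
  induction L with
  | nil =>
    intro i e _
    have : f i * φ (mk [(i, e)]) = mk [(i, e)] * f i := by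
      rw [map_mk_singleton_of_conj (hφ i)]
      group
    rw [this]
    exact head?_toWord_mk_singleton_mul fun h => hf i _ h rfl
  | cons q L ih =>
    obtain ⟨j, d⟩ := q
    intro i e hred
    rw [isReduced_cons_cons] at hred
    set y := f j * φ (mk ((j, d) :: L)) with hy
    have hyhead : y.toWord.head? = some (j, d) := ih j d hred.2
    have : f i * φ (mk ((i, e) :: (j, d) :: L)) = mk [(i, e)] * (f i * (f j)⁻¹ * y) := by
      rw [mk_cons, _root_.map_mul, map_mk_singleton_of_conj (hφ i), hy]
      group
    rw [this]
    refine head?_toWord_mk_singleton_mul ?_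
    rw [toWord_mul_of_head_ne, List.head?_append]
    · intro hmem
      cases hu : (f i * (f j)⁻¹).toWord.head? with
      | some p =>
        rw [hu] at hmem
        exact hff i j p hu (by rw [Option.mem_def.mp hmem |> Option.some_injective _])
      | none =>
        rw [hu, hyhead] at hmem
        obtain ⟨rfl, rfl⟩ : j = i ∧ d = !e := by simpa using hmem
        simpa using hred.1 rfl
    · intro p hp hpy
      rw [hyhead] at hpy
      rw [mul_inv_rev, inv_inv] at hp
      obtain rfl : (j, d) = p := by simpa using hpy
      exact hff j i _ hp rfl

theorem eq_one_of_conj_of_head_ne {φ : MulAut (FreeGroup α)} {f : α → FreeGroup α}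
    (hφ : ∀ i, φ (of i) = (f i)⁻¹ * of i * f i)
    (hf : ∀ i, ∀ p ∈ (f i).toWord.head?, p.1 ≠ i)
    (hff : ∀ i j, ∀ p ∈ (f i * (f j)⁻¹).toWord.head?, p.1 ≠ i)
    (k : α) : f k = 1 := by
  have hg : φ (φ⁻¹ (of k)) = of k := MulAut.apply_inv_self _ _ _
  generalize φ⁻¹ (of k) = g at hg
  cases hw : g.toWord with
  | nil =>
    rw [toWord_eq_nil_iff] at hw
    rw [hw, _root_.map_one] at hg
    exact absurd hg (one_ne_of k)
  | cons p L =>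
    obtain ⟨i, e⟩ := p
    have hhead := head?_toWord_mul_map_mk_cons hφ hf hff L i e (hw ▸ isReduced_toWord)
    rw [← hw, mk_toWord, hg] at hhead
    have hword : (of k).toWord = (f i)⁻¹.toWord ++ (f i * of k).toWord := by
      conv_lhs => rw [← inv_mul_cancel_left (f i) (of k)]
      refine toWord_mul_of_head_ne fun p hp hq => ?_
      rw [inv_inv] at hp
      rw [hhead] at hq
      obtain rfl : (i, e) = p := by simpa using hq
      exact hf i _ hp rfl
    obtain ⟨T, hT⟩ := List.head?_eq_some_iff.mp hhead
    have hfi : f i = 1 := by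
      have hlen := congrArg List.length hword
      rw [hT, toWord_of] at hlen
      simp only [List.length_append, List.length_cons, List.length_nil] at hlen
      rw [← inv_eq_one, ← toWord_eq_nil_iff, ← List.length_eq_zero_iff]
      omega
    rw [hfi, one_mul, toWord_of] at hhead
    obtain ⟨rfl, -⟩ : k = i ∧ true = e := by simpa using hhead
    exact hfi

end FreeGroup

section NormalForm

open FreeGroup

variable {n : ℕ}

theorem eps_apply_of (i j l : Fin n) : eps i j (of l) =
    if l = i then (of j)⁻¹ * of i * of j else of l := by
  simp [eps]

theorem eps_inv_apply_of (i j l : Fin n) : (eps i j)⁻¹ (of l) =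
    if l = i then of j * of i * (of j)⁻¹ else of l := by
  rw [MulAut.inv_def]
  simp [eps]

theorem mulAut_ext {φ ψ : MulAut (FreeGroup (Fin n))} (h : ∀ l, φ (of l) = ψ (of l)) : φ = ψ := by
  apply MulEquiv.toMonoidHom_injective
  ext l
  exact h l

theorem eps_commute {i j k l : Fin n} (hik : i ≠ k) (hjk : j ≠ k) (hli : l ≠ i) :
    Commute (eps i j) (eps k l) := by
  refine mulAut_ext fun m => ?_
  simp only [MulAut.mul_apply, eps_apply_of]
  by_cases hmi : m = i <;> by_cases hmk : m = k <;>
    simp_all [eps_apply_of, hik.symm]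

theorem eps_mul_eps_commute {i j k : Fin n} (hij : i ≠ j) (hik : i ≠ k) :
    Commute (eps i j * eps k j) (eps i k) := by
  refine mulAut_ext fun m => ?_
  simp only [MulAut.mul_apply, eps_apply_of]
  by_cases hmi : m = i <;> by_cases hmk : m = k <;>
    simp_all [eps_apply_of, hik.symm, hij.symm, mul_assoc]

/-- The group generated by all `ε_{ij}` with `i, j < m`. -/
def epsBelow (n m : ℕ) : Subgroup (MulAut (FreeGroup (Fin n))) :=
  Subgroup.closure {e | ∃ i j : Fin n, i ≠ j ∧ (i : ℕ) < m ∧ (j : ℕ) < m ∧ e = eps i j}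

theorem eps_mem_Dsub_left {t m : Fin n} (h : t < m) : eps m t ∈ Dsub m :=
  Subgroup.subset_closure ⟨t, h, Or.inl rfl⟩

theorem eps_mem_Dsub_right {t m : Fin n} (h : t < m) : eps t m ∈ Dsub m :=
  Subgroup.subset_closure ⟨t, h, Or.inr rfl⟩

section Conj

variable {G : Type*} [Group G] {a b x : G} {H : Subgroup G}

theorem conj_mem_of_commute (h : Commute a x) (hx : x ∈ H) :
    a * x * a⁻¹ ∈ H ∧ a⁻¹ * x * a ∈ H := by
  rw [h.eq, mul_inv_cancel_right, mul_assoc, ← h.eq, inv_mul_cancel_left]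
  exact ⟨hx, hx⟩

theorem conj_mem_of_mul_commute (hab : Commute a b) (h : Commute (a * b) x) (hb : b ∈ H)
    (hx : x ∈ H) : a * x * a⁻¹ ∈ H ∧ a⁻¹ * x * a ∈ H := by
  have hy : Commute (a * b) (b⁻¹ * x * b) :=
    (Commute.mul_right (Commute.mul_right
      ((hab.mul_left (Commute.refl b)).inv_right) h) (hab.mul_left (Commute.refl b)))
  have key : ∀ y, a * y * a⁻¹ = (a * b) * (b⁻¹ * y * b) * (a * b)⁻¹ := fun y => by group
  have key' : ∀ y, a⁻¹ * y * a = b * ((a * b)⁻¹ * y * (a * b)) * b⁻¹ := fun y => by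
    group
  constructor
  · rw [key, hy.eq, mul_inv_cancel_right]
    exact H.mul_mem (H.mul_mem (H.inv_mem hb) hx) hb
  · rw [key', mul_assoc (a * b)⁻¹, ← h.eq, inv_mul_cancel_left]
    exact H.mul_mem (H.mul_mem hb hx) (H.inv_mem hb)

theorem mem_normalizer_closure_of_conj_mem {s : Set G}
    (h : ∀ x ∈ s, a * x * a⁻¹ ∈ Subgroup.closure s ∧ a⁻¹ * x * a ∈ Subgroup.closure s) :
    a ∈ Subgroup.normalizer (Subgroup.closure s : Set G) := by
  have hle : ∀ c : G, (∀ x ∈ s, c * x * c⁻¹ ∈ Subgroup.closure s) →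
      ∀ x ∈ Subgroup.closure s, c * x * c⁻¹ ∈ Subgroup.closure s := fun c hc x hx => by
    have : Subgroup.closure s ≤ (Subgroup.closure s).comap (MulAut.conj c).toMonoidHom :=
      (Subgroup.closure_le _).mpr fun y hy => by simpa using hc y hy
    simpa using this hx
  rw [Subgroup.mem_normalizer_iff]
  refine fun x => ⟨hle a (fun y hy => (h y hy).1) x, fun hx => ?_⟩
  have := hle a⁻¹ (fun y hy => by simpa using (h y hy).2) _ hx
  simpa [mul_assoc] using this

end Conj

theorem eps_mem_normalizer_Dsub {i j m : Fin n} (hij : i ≠ j) (hi : i < m) (hj : j < m) :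
    eps i j ∈ Subgroup.normalizer (Dsub m : Set (MulAut (FreeGroup (Fin n)))) := by
  have him : eps i j * eps i m * (eps i j)⁻¹ ∈ Dsub m ∧
      (eps i j)⁻¹ * eps i m * eps i j ∈ Dsub m :=
    conj_mem_of_mul_commute (eps_commute hi.ne hj.ne hij.symm)
      (eps_mul_eps_commute hij hi.ne) (eps_mem_Dsub_left hj) (eps_mem_Dsub_right hi)
  refine mem_normalizer_closure_of_conj_mem ?_
  rintro x ⟨t, ht, rfl | rfl⟩
  · by_cases hti : t = i
    · subst hti
      exact conj_mem_of_mul_commute (b := eps m j) (eps_commute hi.ne hj.ne hij.symm)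
        ((eps_commute hi.ne hj.ne hij.symm).eq ▸ eps_mul_eps_commute hj.ne' hi.ne')
        (eps_mem_Dsub_left hj) (eps_mem_Dsub_left hi)
    · exact conj_mem_of_commute (eps_commute hi.ne hj.ne hti) (eps_mem_Dsub_left ht)
  · by_cases hti : t = i
    · subst hti
      exact him
    by_cases htj : t = j
    · subst htj
      have hc := conj_mem_of_commute (H := Dsub m) (eps_mul_eps_commute hi.ne hij).symm
        (mul_mem (eps_mem_Dsub_right hi) (eps_mem_Dsub_right hj))
      constructor
      · have := mul_mem (inv_mem him.1) hc.1
        convert this using 1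
        · rfl
        · group
      · have := mul_mem (inv_mem him.2) hc.2
        convert this using 1
        · rfl
        · group
    · exact conj_mem_of_commute (eps_commute (Ne.symm hti) (Ne.symm htj) hi.ne')
        (eps_mem_Dsub_right ht)

theorem epsBelow_le_normalizer (m : Fin n) :
    epsBelow n m ≤ Subgroup.normalizer (Dsub m : Set (MulAut (FreeGroup (Fin n)))) := by
  refine (Subgroup.closure_le _).mpr ?_
  rintro _ ⟨i, j, hij, hi, hj, rfl⟩
  exact eps_mem_normalizer_Dsub hij hi hj

theorem epsBelow_succ_le (m : Fin n) : epsBelow n (m + 1) ≤ epsBelow n m ⊔ Dsub m := by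
  refine (Subgroup.closure_le _).mpr ?_
  rintro _ ⟨i, j, hij, hi, hj, rfl⟩
  rcases (Nat.lt_succ_iff_lt_or_eq.mp hi) with hi | hi
  · rcases (Nat.lt_succ_iff_lt_or_eq.mp hj) with hj | hj
    · exact Subgroup.mem_sup_left (Subgroup.subset_closure ⟨i, j, hij, hi, hj, rfl⟩)
    · obtain rfl : j = m := Fin.ext hj
      exact Subgroup.mem_sup_right (eps_mem_Dsub_right hi)
  · obtain rfl : i = m := Fin.ext hi
    exact Subgroup.mem_sup_right (eps_mem_Dsub_left
      (lt_of_le_of_ne (Nat.lt_succ_iff.mp hj) hij.symm))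

theorem exists_prod_of_mem_epsBelow (m : ℕ) (hm : m ≤ n) :
    ∀ g ∈ epsBelow n m, ∃ β : Fin m → MulAut (FreeGroup (Fin n)),
      (∀ j, β j ∈ Dsub (Fin.castLE hm j)) ∧ g = (List.ofFn β).prod := by
  induction m with
  | zero =>
    intro g hg
    have : epsBelow n 0 = ⊥ := by simp [epsBelow]
    rw [this, Subgroup.mem_bot] at hg
    exact ⟨Fin.elim0, fun j => j.elim0, by simp [hg]⟩
  | succ m ih =>
    intro g hg
    have hg' : g ∈ ((epsBelow n m ⊔ Dsub ⟨m, hm⟩ : Subgroup _) : Set _) :=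
      epsBelow_succ_le ⟨m, hm⟩ hg
    rw [Subgroup.coe_mul_of_left_le_normalizer_right _ _ (epsBelow_le_normalizer ⟨m, hm⟩)] at hg'
    obtain ⟨a, ha, b, hb, rfl⟩ := hg'
    obtain ⟨β, hβ, rfl⟩ := ih (Nat.le_of_succ_le hm) a ha
    refine ⟨Fin.snoc (α := fun _ => MulAut (FreeGroup (Fin n))) β b, fun j => ?_, ?_⟩
    · refine Fin.lastCases ?_ (fun j => ?_) j
      · rw [Fin.snoc_last]
        exact hb
      · rw [Fin.snoc_castSucc]
        exact hβ j
    · rw [List.ofFn_succ', List.concat_eq_append, List.prod_append]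
      simp

/-- Every basis-conjugating automorphism is a product of the `ε_{ij}` and their inverses, by
induction on the total length of the conjugators. -/
theorem mem_epsBelow_of_conj (N : ℕ) : ∀ (φ : MulAut (FreeGroup (Fin n)))
    (f : Fin n → FreeGroup (Fin n)), (∀ i, φ (of i) = (f i)⁻¹ * of i * f i) →
    ∑ i, (f i).norm = N → φ ∈ epsBelow n n := by
  induction N using Nat.strong_induction_on with
  | _ N ih =>
  intro φ f hφ hN
  have hsum : ∀ (j : Fin n) (g : FreeGroup (Fin n)), g.norm < (f j).norm →
      ∑ i, (Function.update f j g i).norm < N := fun j g hg => by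
    rw [← hN]
    refine Finset.sum_lt_sum (fun i _ => ?_) ⟨j, Finset.mem_univ j, by simpa using hg⟩
    by_cases hij : i = j
    · subst hij
      simpa using hg.le
    · simp [hij]
  by_cases hf : ∀ i, ∀ p ∈ (f i).toWord.head?, p.1 ≠ i
  · by_cases hff : ∀ i j, ∀ p ∈ (f i * (f j)⁻¹).toWord.head?, p.1 ≠ i
    · have : φ = 1 := mulAut_ext fun i => by
        rw [hφ, eq_one_of_conj_of_head_ne hφ hf hff i]
        simp
      rw [this]
      exact one_mem _
    · push Not at hff
      obtain ⟨_, j, ⟨i, e⟩, hp, rfl⟩ := hff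
      have hij : j ≠ i := by
        rintro rfl
        simp at hp
      obtain ⟨T, hT⟩ := List.head?_eq_some_iff.mp hp
      have hquot : f i * (f j)⁻¹ = mk [(i, e)] * mk T := by
        rw [← mk_cons, ← hT, mk_toWord]
      have hfj : f j = (mk T)⁻¹ * (mk [(i, e)])⁻¹ * f i := by
        rw [← mul_inv_rev, ← hquot]
        group
      have hnorm : (f j).norm = (f i).norm + (T.length + 1) := by
        have hword : ((f i)⁻¹ * (f i * (f j)⁻¹)).toWord =
            (f i)⁻¹.toWord ++ (f i * (f j)⁻¹).toWord := by
          refine toWord_mul_of_head_ne fun p hpi hpj => ?_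
          rw [inv_inv] at hpi
          rw [hp] at hpj
          obtain rfl : (i, e) = p := by simpa using hpj
          exact hf i _ hpi rfl
        rw [inv_mul_cancel_left, hT] at hword
        have hlen := congrArg List.length hword
        rw [List.length_append, List.length_cons] at hlen
        rw [← norm_inv_eq, ← norm_inv_eq (x := f i)]
        exact hlen
      set g := f j * ((f i)⁻¹ * mk [(i, e)] * f i) with hg
      have hgT : g = (mk T)⁻¹ * f i := by
        rw [hg, hfj]
        group
      have hglt : g.norm < (f j).norm := by
        have h1 := norm_mul_le (mk T)⁻¹ (f i)
        have h2 : (mk T)⁻¹.norm ≤ T.length := by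
          rw [norm_inv_eq]
          exact norm_mk_le
        rw [hgT, hnorm]
        omega
      obtain ⟨ε, hε, hεj, hεl⟩ : ∃ ε ∈ epsBelow n n,
          ε (of j) = (mk [(i, e)])⁻¹ * of j * mk [(i, e)] ∧ ∀ l ≠ j, ε (of l) = of l := by
        have hmem : eps j i ∈ epsBelow n n :=
          Subgroup.subset_closure ⟨j, i, hij, j.isLt, i.isLt, rfl⟩
        cases e
        · refine ⟨(eps j i)⁻¹, inv_mem hmem, ?_, fun l hl => ?_⟩
          · rw [eps_inv_apply_of, if_pos rfl]
            rfl
          · rw [eps_inv_apply_of, if_neg hl]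
        · refine ⟨eps j i, hmem, ?_, fun l hl => ?_⟩
          · rw [eps_apply_of, if_pos rfl]
            rfl
          · rw [eps_apply_of, if_neg hl]
      refine (Subgroup.mul_mem_cancel_right _ hε).mp
        (ih _ (hsum j g hglt) (φ * ε) (Function.update f j g) (fun l => ?_) rfl)
      rw [MulAut.mul_apply]
      by_cases hl : l = j
      · subst hl
        rw [hεj, _root_.map_mul, _root_.map_mul, _root_.map_inv,
          map_mk_singleton_of_conj (hφ i), hφ l, Function.update_self, hg]
        group
      · rw [hεl l hl, hφ l, Function.update_of_ne hl]
  · push Not at hf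
    obtain ⟨_, ⟨i, e⟩, hp, rfl⟩ := hf
    obtain ⟨T, hT⟩ := List.head?_eq_some_iff.mp hp
    have hfi : f i = mk [(i, e)] * mk T := by
      rw [← mk_cons, ← hT, mk_toWord]
    have hlt : (mk T).norm < (f i).norm := by
      have hle : (mk T).norm ≤ T.length := norm_mk_le
      have heq : (f i).norm = T.length + 1 := congrArg List.length hT
      omega
    refine ih _ (hsum i _ hlt) φ (Function.update f i (mk T)) (fun l => ?_) rfl
    by_cases hl : l = i
    · subst hl
      have hcomm : (mk [(l, e)])⁻¹ * of l * mk [(l, e)] = of l := by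
        cases e
        · change (of l)⁻¹⁻¹ * of l * (of l)⁻¹ = of l
          group
        · change (of l)⁻¹ * of l * of l = of l
          group
      rw [hφ l, Function.update_self, hfi]
      conv_rhs => rw [← hcomm]
      group
    · rw [hφ l, Function.update_of_ne hl]

end NormalForm

/-- Corollary 3.1 (normal form): every conjugating automorphism `β ∈ C_n` can be
written as `β = β_1 β_2 ⋯ β_{n-1} π_β` where each `β_j ∈ D_j` and `π_β` is the
permutation automorphism `x_i ↦ x_{π(i)}` of some permutation `π`.
(0-based: the factor belonging to `Dsub 0 = ⊥` is necessarily trivial.) -/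
theorem conjugating_normal_form (n : ℕ) (φ : MulAut (FreeGroup (Fin n)))
    (hφ : IsConjugating φ) :
    ∃ (β : Fin n → MulAut (FreeGroup (Fin n))) (π : Equiv.Perm (Fin n)),
      (∀ j : Fin n, β j ∈ Dsub j) ∧
      φ = (List.ofFn β).prod * (FreeGroup.freeGroupCongr π : MulAut (FreeGroup (Fin n))) := by
  obtain ⟨π, hπ⟩ := hφ
  choose f hf using hπ
  let P : MulAut (FreeGroup (Fin n)) := FreeGroup.freeGroupCongr π
  have hP : ∀ i, P⁻¹ (FreeGroup.of i) = FreeGroup.of (π.symm i) := fun i => by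
    rw [MulAut.inv_def]
    simp [P]
  have hmem : φ * P⁻¹ ∈ epsBelow n n :=
    mem_epsBelow_of_conj _ _ (fun i => f (π.symm i))
      (fun i => by rw [MulAut.mul_apply, hP, hf, Equiv.apply_symm_apply]) rfl
  obtain ⟨β, hβ, hprod⟩ := exists_prod_of_mem_epsBelow n le_rfl _ hmem
  exact ⟨β, π, hβ, by rw [← hprod]; simp [P]⟩
end

section
/- For every n ≥ 2, the group Cb_n of basis-conjugating automorphisms of F_n has no proper verbal subgroups of finite width: for every finite proper set of words V (i.e. V(F_2) is a proper nontrivial subgroup of the free group F_2), the width wid(Cb_n, V) of the verbal subgroup V(Cb_n) with respect to V is infinite. -/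
/-- The group `Cb n` of basis-conjugating automorphisms. -/
def Cb (n : ℕ) : Subgroup (MulAut (FreeGroup (Fin n))) :=
  Subgroup.closure {e | ∃ i j : Fin n, i ≠ j ∧ e = eps i j}

/-- A value of the word `w` (an element of the free group on countably many variables)
in the group `G`: the image of `w` under the substitution `g` of group elements
for the variables. -/
def wordValue {G : Type*} [Group G] (w : FreeGroup ℕ) (g : ℕ → G) : G :=
  FreeGroup.lift g w

/-- The verbal subgroup `V(G)` determined by a set `V` of words: the subgroup
generated by all values of words from `V` (equivalently of `V^{±1}`). -/
def verbalSubgroup (G : Type*) [Group G] (V : Set (FreeGroup ℕ)) : Subgroup G :=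
  Subgroup.closure {x | ∃ w ∈ V, ∃ g : ℕ → G, wordValue w g = x}

/-- `widthLE G V m` : every element of the verbal subgroup `V(G)` is a product of at
most `m` values of words from `V^{±1}`.  The width of `V(G)` w.r.t. `V` is the least
such `m`; it is infinite iff no such `m` exists. -/
def widthLE (G : Type*) [Group G] (V : Set (FreeGroup ℕ)) (m : ℕ) : Prop :=
  ∀ x ∈ verbalSubgroup G V, ∃ L : List G, L.length ≤ m ∧ L.prod = x ∧
    ∀ y ∈ L, ∃ w ∈ V, ∃ g : ℕ → G, y = wordValue w g ∨ y = (wordValue w g)⁻¹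

/-! ### Verbal subgroups and homomorphisms -/

section Verbal

variable {G H : Type*} [Group G] [Group H] {V : Set (FreeGroup ℕ)}

theorem map_wordValue (f : G →* H) (w : FreeGroup ℕ) (g : ℕ → G) :
    f (wordValue w g) = wordValue w (f ∘ g) := by
  have h : f.comp (FreeGroup.lift g) = FreeGroup.lift (f ∘ g) := by ext; simp
  exact DFunLike.congr_fun h w

theorem wordValue_mem_verbalSubgroup {w : FreeGroup ℕ} (hw : w ∈ V) (g : ℕ → G) :
    wordValue w g ∈ verbalSubgroup G V :=
  Subgroup.subset_closure ⟨w, hw, g, rfl⟩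

theorem map_mem_verbalSubgroup (f : G →* H) {x : G} (hx : x ∈ verbalSubgroup G V) :
    f x ∈ verbalSubgroup H V := by
  have h : verbalSubgroup G V ≤ (verbalSubgroup H V).comap f := by
    refine (Subgroup.closure_le _).2 ?_
    rintro _ ⟨w, hw, g, rfl⟩
    simpa only [SetLike.mem_coe, Subgroup.mem_comap, map_wordValue]
      using wordValue_mem_verbalSubgroup hw (f ∘ g)
  exact h hx

theorem verbalSubgroup_le_map (f : G →* H) (hf : Function.Surjective f) :
    verbalSubgroup H V ≤ (verbalSubgroup G V).map f := by
  refine (Subgroup.closure_le _).2 ?_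
  rintro _ ⟨w, hw, g, rfl⟩
  choose g' hg' using fun i => hf (g i)
  refine ⟨wordValue w g', wordValue_mem_verbalSubgroup hw g', ?_⟩
  rw [map_wordValue]
  congr 1
  exact funext hg'

theorem widthLE_of_surjective {m : ℕ} (f : G →* H) (hf : Function.Surjective f)
    (h : widthLE G V m) : widthLE H V m := by
  intro x hx
  obtain ⟨y, hy, rfl⟩ := verbalSubgroup_le_map f hf hx
  obtain ⟨L, hL, rfl, hval⟩ := h y hy
  refine ⟨L.map f, by simpa using hL, (map_list_prod f L).symm, ?_⟩
  intro z hz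
  obtain ⟨y, hyL, rfl⟩ := List.mem_map.1 hz
  obtain ⟨w, hw, g, hg⟩ := hval y hyL
  refine ⟨w, hw, f ∘ g, ?_⟩
  rcases hg with rfl | rfl
  · exact Or.inl (map_wordValue f w g)
  · exact Or.inr (by rw [map_inv, map_wordValue])

theorem conj_mem_verbalSubgroup {x : G} (hx : x ∈ verbalSubgroup G V) (g : G) :
    g * x * g⁻¹ ∈ verbalSubgroup G V :=
  map_mem_verbalSubgroup (MulAut.conj g).toMonoidHom hx

/-- The verbal subgroup of the infinite cyclic group determines a number `d`, the greatest common
divisor of the exponent sums of the words in `V`. -/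
theorem exists_exponent (V : Set (FreeGroup ℕ)) : ∃ d : ℕ,
    (∀ w ∈ V, ∀ a : ℕ → ZMod d, wordValue w (fun i => Multiplicative.ofAdd (a i)) = 1) ∧
    ∀ (G : Type) [Group G] (x : G), x ^ d ∈ verbalSubgroup G V := by
  obtain ⟨z, hz⟩ := (Subgroup.isCyclic_iff_exists_zpowers_eq_top
    (verbalSubgroup (Multiplicative ℤ) V)).1 inferInstance
  refine ⟨z.toAdd.natAbs, fun w hw a => ?_, fun G _ x => ?_⟩
  · choose a' ha' using fun i => ZMod.intCast_surjective (a i)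
    have h := map_wordValue
      (AddMonoidHom.toMultiplicative (Int.castAddHom (ZMod z.toAdd.natAbs))) w
      (fun i => Multiplicative.ofAdd (a' i))
    have hmem := wordValue_mem_verbalSubgroup hw (fun i => Multiplicative.ofAdd (a' i))
    rw [← hz, Subgroup.mem_zpowers_iff] at hmem
    obtain ⟨k, hk⟩ := hmem
    have hfun : (fun i => Multiplicative.ofAdd (a i)) =
        AddMonoidHom.toMultiplicative (Int.castAddHom (ZMod z.toAdd.natAbs)) ∘
          fun i => Multiplicative.ofAdd (a' i) := by
      funext i
      simp [ha']
    have hz0 : ((z.toAdd : ℤ) : ZMod z.toAdd.natAbs) = 0 := by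
      rw [ZMod.intCast_zmod_eq_zero_iff_dvd]
      exact Int.natAbs_dvd.2 dvd_rfl
    rw [hfun, ← h, ← hk, map_zpow]
    simp [hz0]
  · have hmem : z ∈ verbalSubgroup (Multiplicative ℤ) V := hz ▸ Subgroup.mem_zpowers z
    have h := map_mem_verbalSubgroup (zpowersHom G x) hmem
    rw [zpowersHom_apply] at h
    rcases Int.natAbs_eq z.toAdd with h' | h' <;> rw [h'] at h
    · rwa [zpow_natCast] at h
    · rwa [zpow_neg, zpow_natCast, inv_mem_iff] at h

end Verbal

/-! ### Functions additive up to bounded support -/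

section Approx

variable {G R ι : Type*} [Group G] [Ring R]

theorem card_support_add_le (f g : ι →₀ R) :
    (f + g).support.card ≤ f.support.card + g.support.card := by
  classical
  exact (Finset.card_le_card Finsupp.support_add).trans (Finset.card_union_le _ _)

theorem card_support_sub_le (f g : ι →₀ R) :
    (f - g).support.card ≤ f.support.card + g.support.card := by
  rw [sub_eq_add_neg]
  simpa using card_support_add_le f (-g)

theorem card_support_single_le (i : ι) (r : R) : (Finsupp.single i r).support.card ≤ 1 :=
  (Finset.card_le_card Finsupp.support_single_subset).trans (by simp)

/-- `F` is odd, and additive up to an error whose support has at most `c` elements. -/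
structure AlmostHom (F : G → ι →₀ R) (c : ℕ) : Prop where
  inv : ∀ g, F g⁻¹ = -F g
  mul : ∀ g h, (F (g * h) - F g - F h).support.card ≤ c

namespace AlmostHom

variable {F : G → ι →₀ R} {c : ℕ}

theorem one (hF : AlmostHom F c) : (F 1).support.card ≤ c := by
  have h := hF.mul 1 1
  simpa using h

theorem mul_le (hF : AlmostHom F c) (g h : G) :
    (F (g * h)).support.card ≤ (F g).support.card + (F h).support.card + c := by
  have h1 := card_support_add_le (F (g * h) - F g - F h) (F g + F h)
  have h2 := card_support_add_le (F g) (F h)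
  have h3 := hF.mul g h
  rw [show F (g * h) - F g - F h + (F g + F h) = F (g * h) by abel] at h1
  lia

theorem wordValue_approx (hF : AlmostHom F c) (w : FreeGroup ℕ) : ∃ C, ∀ g : ℕ → G,
    (F (wordValue w g) -
      (wordValue w fun i => Multiplicative.ofAdd (F (g i))).toAdd).support.card ≤ C := by
  induction w using FreeGroup.induction_on with
  | C1 => exact ⟨c, fun g => by simpa [wordValue] using hF.one⟩
  | of i => exact ⟨0, fun g => by simp [wordValue]⟩
  | inv_of i h => exact ⟨0, fun g => by simp [wordValue, hF.inv]⟩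
  | mul u v hu hv =>
    obtain ⟨A, hA⟩ := hu
    obtain ⟨B, hB⟩ := hv
    refine ⟨c + (A + B), fun g => ?_⟩
    have hA := hA g
    have hB := hB g
    simp only [wordValue, map_mul, toAdd_mul] at hA hB ⊢
    set a := FreeGroup.lift g u
    set b := FreeGroup.lift g v
    set a' := (FreeGroup.lift (fun i => Multiplicative.ofAdd (F (g i))) u).toAdd
    set b' := (FreeGroup.lift (fun i => Multiplicative.ofAdd (F (g i))) v).toAdd
    rw [show F (a * b) - (a' + b') = (F (a * b) - F a - F b) + ((F a - a') + (F b - b')) by abel]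
    refine (card_support_add_le _ _).trans (add_le_add (hF.mul a b) ?_)
    exact (card_support_add_le _ _).trans (add_le_add hA hB)

end AlmostHom

theorem AlmostHom.wordValue_bounded {d c : ℕ} {F : G → ι →₀ ZMod d} (hF : AlmostHom F c)
    {w : FreeGroup ℕ}
    (hw : ∀ a : ℕ → ZMod d, wordValue w (fun i => Multiplicative.ofAdd (a i)) = 1) :
    ∃ C, ∀ g : ℕ → G, (F (wordValue w g)).support.card ≤ C := by
  obtain ⟨C, hC⟩ := hF.wordValue_approx w
  refine ⟨C, fun g => ?_⟩
  have h0 : wordValue w (fun i => Multiplicative.ofAdd (F (g i))) = 1 := by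
    refine Multiplicative.toAdd.injective (Finsupp.ext fun k => ?_)
    have h := map_wordValue (AddMonoidHom.toMultiplicative (Finsupp.applyAddHom k)) w
      (fun i => Multiplicative.ofAdd (F (g i)))
    exact congrArg Multiplicative.toAdd (h.trans (hw fun i => F (g i) k))
  simpa [h0] using hC g

/-- If the verbal subgroup has finite width then an almost homomorphism modulo the exponent is
bounded on it. -/
theorem AlmostHom.bounded_of_widthLE {d c m : ℕ} {F : G → ι →₀ ZMod d} (hF : AlmostHom F c)
    {V : Set (FreeGroup ℕ)} (hfin : V.Finite)
    (hV : ∀ w ∈ V, ∀ a : ℕ → ZMod d, wordValue w (fun i => Multiplicative.ofAdd (a i)) = 1)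
    (hm : widthLE G V m) : ∃ C, ∀ x ∈ verbalSubgroup G V, (F x).support.card ≤ C := by
  have hC : ∃ C, ∀ w ∈ V, ∀ g : ℕ → G, (F (wordValue w g)).support.card ≤ C := by
    choose! C hC using fun w hw => hF.wordValue_bounded (hV w hw)
    obtain ⟨B, hB⟩ := (hfin.image C).bddAbove
    exact ⟨B, fun w hw g => (hC w hw g).trans (hB ⟨w, hw, rfl⟩)⟩
  obtain ⟨C, hC⟩ := hC
  have key : ∀ L : List G,
      (∀ y ∈ L, ∃ w ∈ V, ∃ g : ℕ → G, y = wordValue w g ∨ y = (wordValue w g)⁻¹) →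
      (F L.prod).support.card ≤ c + L.length * (C + c) := by
    intro L
    induction L with
    | nil => intro _; simpa using hF.one
    | cons y L ih =>
      intro hL
      have h1 := ih fun z hz => hL z (List.mem_cons_of_mem _ hz)
      have h2 := hF.mul_le y L.prod
      have h3 : (F y).support.card ≤ C := by
        obtain ⟨w, hw, g, rfl | rfl⟩ := hL y List.mem_cons_self
        · exact hC w hw g
        · simpa [hF.inv] using hC w hw g
      rw [List.prod_cons, List.length_cons]
      nlinarith
  refine ⟨c + m * (C + c), fun x hx => ?_⟩
  obtain ⟨L, hL, rfl, hval⟩ := hm x hx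
  exact (key L hval).trans (by gcongr)

end Approx

/-! ### Counting syllables in reduced words of rank two -/

section Syllables

open FreeGroup

/-- The exponent of the syllable in the letter `0` at the start of a word. -/
def leadExponent : List (Fin 2 × Bool) → ℤ
  | [] => 0
  | (i, b) :: L => if i = 0 then leadExponent L + (if b then 1 else -1) else 0

/-- For each `k ≠ 0`, the number of syllables of exponent `k` in the letter `0`. -/
noncomputable def syllableCount (R : Type*) [Ring R] : List (Fin 2 × Bool) → ℤ →₀ R
  | [] => 0
  | (i, b) :: L =>
    if i = 0 then
      syllableCount R L - Finsupp.single (leadExponent L) 1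
        + Finsupp.single (leadExponent L + (if b then 1 else -1)) 1
    else syllableCount R L

variable {R : Type*} [Ring R]

theorem syllableCount_append (L M : List (Fin 2 × Bool)) : ∃ t : ℤ,
    (leadExponent (L ++ M) = leadExponent L ∨
      leadExponent (L ++ M) = leadExponent L + leadExponent M ∧ t = leadExponent L) ∧
    syllableCount R (L ++ M) = syllableCount R L + syllableCount R M +
      (Finsupp.single (t + leadExponent M) 1 - Finsupp.single t 1
        - Finsupp.single (leadExponent M) 1 + Finsupp.single 0 1) := by
  induction L with
  | nil => exact ⟨0, by simp [leadExponent], by simp [syllableCount]⟩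
  | cons p L ih =>
    obtain ⟨i, b⟩ := p
    obtain ⟨t, h, hc⟩ := ih
    by_cases hi : i = 0
    · subst hi
      rcases h with h | ⟨h, rfl⟩
      · refine ⟨t, Or.inl (by simp [leadExponent, h]), ?_⟩
        simp only [List.cons_append, syllableCount, h, hc, if_true]
        abel
      · refine ⟨leadExponent L + (if b then 1 else -1),
          Or.inr ⟨by simp [leadExponent, h]; ring, by simp [leadExponent]⟩, ?_⟩
        simp only [List.cons_append, syllableCount, h, hc, if_true]
        rw [add_right_comm (leadExponent L) (leadExponent M)]
        abel
    · exact ⟨t, Or.inl (by simp [leadExponent, hi]), by simp [syllableCount, hi, hc]⟩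

theorem card_support_syllableCount_append (L M : List (Fin 2 × Bool)) :
    (syllableCount R (L ++ M) - syllableCount R L - syllableCount R M).support.card ≤ 4 := by
  obtain ⟨t, -, h⟩ := syllableCount_append (R := R) L M
  rw [h, sub_sub, add_sub_cancel_left]
  have h1 := card_support_single_le (t + leadExponent M) (1 : R)
  have h2 := card_support_single_le t (1 : R)
  have h3 := card_support_single_le (leadExponent M) (1 : R)
  have h4 := card_support_single_le (0 : ℤ) (1 : R)
  grw [card_support_add_le, card_support_sub_le, card_support_sub_le, h1, h2, h3, h4]

theorem leadExponent_append_cons (L M : List (Fin 2 × Bool)) (b : Bool) :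
    leadExponent (L ++ (1, b) :: M) = leadExponent L := by
  induction L with
  | nil => simp [leadExponent]
  | cons p L ih => simp [leadExponent, ih]

theorem syllableCount_append_cons (L M : List (Fin 2 × Bool)) (b : Bool) :
    syllableCount R (L ++ (1, b) :: M) = syllableCount R L + syllableCount R M := by
  induction L with
  | nil => simp [syllableCount]
  | cons p L ih =>
    by_cases hp : p.1 = 0
    · simp only [List.cons_append, syllableCount, hp, ih, leadExponent_append_cons, if_true]
      abel
    · simp [syllableCount, hp, ih]

theorem leadExponent_replicate (n : ℕ) (b : Bool) :
    leadExponent (List.replicate n (0, b)) = n * (if b then 1 else -1) := by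
  induction n with
  | zero => simp [leadExponent]
  | succ n ih =>
    simp only [List.replicate_succ, leadExponent, ih, if_true]
    push_cast
    ring

theorem syllableCount_replicate (n : ℕ) (b : Bool) :
    syllableCount R (List.replicate n (0, b)) =
      Finsupp.single (n * (if b then 1 else -1) : ℤ) 1 - Finsupp.single 0 1 := by
  induction n with
  | zero => simp [syllableCount]
  | succ n ih =>
    simp only [List.replicate_succ, syllableCount, ih, leadExponent_replicate, if_true]
    rw [show ((n + 1 : ℕ) : ℤ) * (if b then 1 else -1)
      = n * (if b then 1 else -1) + (if b then 1 else -1) by push_cast; ring]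
    abel

/-- The number of syllables of exponent `k` minus the number of syllables of exponent `-k`. -/
noncomputable def syllableDiff (R : Type*) [Ring R] (L : List (Fin 2 × Bool)) : ℤ →₀ R :=
  syllableCount R L - syllableCount R (invRev L)

theorem syllableDiff_invRev (L : List (Fin 2 × Bool)) :
    syllableDiff R (invRev L) = -syllableDiff R L := by
  simp [syllableDiff]

theorem card_support_syllableDiff_append (L M : List (Fin 2 × Bool)) :
    (syllableDiff R (L ++ M) - syllableDiff R L - syllableDiff R M).support.card ≤ 8 := by
  have h1 := card_support_syllableCount_append (R := R) L M
  have h2 := card_support_syllableCount_append (R := R) (invRev M) (invRev L)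
  have h3 := card_support_sub_le
    (syllableCount R (L ++ M) - syllableCount R L - syllableCount R M)
    (syllableCount R (invRev M ++ invRev L) - syllableCount R (invRev M)
      - syllableCount R (invRev L))
  simp only [syllableDiff, invRev_append]
  refine le_trans (le_of_eq ?_) (h3.trans (by lia))
  congr 2
  abel

theorem syllableDiff_append_cons (L M : List (Fin 2 × Bool)) (b : Bool) :
    syllableDiff R (L ++ (1, b) :: M) = syllableDiff R L + syllableDiff R M := by
  have h : invRev (L ++ (1, b) :: M) = invRev M ++ (1, !b) :: invRev L := by
    simp [invRev]
  rw [syllableDiff, h, syllableCount_append_cons, syllableCount_append_cons, syllableDiff,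
    syllableDiff]
  abel

theorem syllableDiff_replicate (n : ℕ) :
    syllableDiff R (List.replicate n (0, true)) =
      Finsupp.single (n : ℤ) 1 - Finsupp.single (-n : ℤ) 1 := by
  have h : invRev (List.replicate n ((0 : Fin 2), true)) = List.replicate n (0, false) := by
    simp [invRev]
  rw [syllableDiff, h, syllableCount_replicate, syllableCount_replicate]
  simp

/-- The cancellation in a product of two reduced words. -/
theorem exists_cancellation {α : Type*} (L M : List (α × Bool)) (hL : IsReduced L)
    (hM : IsReduced M) : ∃ A C B, L = A ++ C ∧ M = invRev C ++ B ∧ IsReduced (A ++ B) := by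
  induction L using List.reverseRecOn generalizing M with
  | nil => exact ⟨[], [], M, by simp, by simp, by simpa using hM⟩
  | append_singleton L p ih =>
    cases M with
    | nil => exact ⟨L ++ [p], [], [], by simp, by simp, by simpa using hL⟩
    | cons q M =>
      by_cases hpq : p.1 = q.1 → p.2 = q.2
      · refine ⟨L ++ [p], [], q :: M, by simp, by simp, ?_⟩
        exact List.isChain_append.2 ⟨hL, hM, by simpa using hpq⟩
      · obtain ⟨A, C, B, rfl, rfl, h⟩ := ih M (hL.infix ⟨[], [p], by simp⟩)
          (hM.infix ⟨[q], [], by simp⟩)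
        refine ⟨A, C ++ [p], B, by simp, ?_, h⟩
        obtain ⟨i, b⟩ := p
        obtain ⟨j, b'⟩ := q
        obtain ⟨rfl, hb⟩ : i = j ∧ b ≠ b' := by simpa using hpq
        have : b' = !b := by cases b <;> cases b' <;> simp_all
        simp [invRev, this]

theorem almostHom_syllableDiff :
    AlmostHom (fun g : FreeGroup (Fin 2) => syllableDiff R g.toWord) 24 where
  inv g := by simp only [toWord_inv, syllableDiff_invRev]
  mul g h := by
    obtain ⟨A, C, B, hg, hh, hr⟩ := exists_cancellation _ _ (isReduced_toWord (x := g))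
      (isReduced_toWord (x := h))
    have hgh : (g * h).toWord = A ++ B := by
      rw [← hr.reduce_eq, ← toWord_mk, ← mk_toWord (x := g), ← mk_toWord (x := h), hg, hh,
        ← mul_mk, ← mul_mk, ← mul_mk, ← inv_mk, mul_assoc, mul_inv_cancel_left]
    have h1 := card_support_syllableDiff_append (R := R) A B
    have h2 := card_support_syllableDiff_append (R := R) A C
    have h3 := card_support_syllableDiff_append (R := R) (invRev C) B
    simp only [hgh]
    rw [hg, hh, show syllableDiff R (A ++ B) - syllableDiff R (A ++ C)
        - syllableDiff R (invRev C ++ B)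
      = (syllableDiff R (A ++ B) - syllableDiff R A - syllableDiff R B)
        - (syllableDiff R (A ++ C) - syllableDiff R A - syllableDiff R C)
        - (syllableDiff R (invRev C ++ B) - syllableDiff R (invRev C) - syllableDiff R B) by
      rw [syllableDiff_invRev]; abel]
    grw [card_support_sub_le, card_support_sub_le, h1, h2, h3]

end Syllables

/-! ### Normal subgroups of the free group of rank two -/

section Normal

open FreeGroup

theorem eq_one_of_forall_commute {g : FreeGroup (Fin 2)} (hg : ∀ h, g * h = h * g) : g = 1 := by
  by_contra hne
  have hw : g.toWord ≠ [] := fun h => hne (toWord_eq_nil_iff.1 h)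
  have hred := isReduced_toWord (x := g)
  have hletter : ∀ p q : Fin 2 × Bool, ∃ z : Fin 2 × Bool,
      (z.1 = p.1 → z.2 = p.2) ∧ (q.1 = z.1 → q.2 = z.2) ∧ z ≠ p := by decide
  obtain ⟨z, hzp, hqz, hne'⟩ := hletter (g.toWord.head hw) (g.toWord.getLast hw)
  have h1 : IsReduced ([z] ++ g.toWord) := List.isChain_append.2
    ⟨IsReduced.singleton, hred, by simpa [List.head?_eq_some_head hw] using hzp⟩
  have h2 : IsReduced (g.toWord ++ [z]) := List.isChain_append.2
    ⟨hred, IsReduced.singleton, by simpa [List.getLast?_eq_some_getLast hw] using hqz⟩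
  have h3 : [z] ++ g.toWord = g.toWord ++ [z] := by
    rw [← h1.reduce_eq, ← h2.reduce_eq, ← toWord_mk, ← toWord_mk, ← mul_mk, ← mul_mk, mk_toWord,
      hg]
  have h4 := congrArg List.head? h3
  rw [List.head?_append_of_ne_nil _ hw, List.head?_eq_some_head hw] at h4
  exact hne' (by simpa using h4)

/-- A nontrivial normal subgroup contains a reduced word which starts and ends with the
letter `1`. -/
theorem exists_reduced_bracket {N : Subgroup (FreeGroup (Fin 2))} (hN : N.Normal) (hne : N ≠ ⊥) :
    ∃ (B : List (Fin 2 × Bool)) (b : Bool),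
      IsReduced ((1, b) :: (B ++ [(1, !b)])) ∧ mk ((1, b) :: (B ++ [(1, !b)])) ∈ N := by
  obtain ⟨u, hu, hu1⟩ := N.bot_or_exists_ne_one.resolve_left hne
  have hw : u.toWord ≠ [] := fun h => hu1 (toWord_eq_nil_iff.1 h)
  have hletter : ∀ p q : Fin 2 × Bool, ∃ z : Fin 2 × Bool,
      (z.1 = p.1 → z.2 = p.2) ∧ (q.1 = z.1 → q.2 = !z.2) := by decide
  obtain ⟨⟨i, b⟩, hzp, hqz⟩ := hletter (u.toWord.head hw) (u.toWord.getLast hw)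
  have h1 : IsReduced ([(1, b), (i, b)] ++ u.toWord) := List.isChain_append.2
    ⟨by simp, isReduced_toWord, by simpa [List.head?_eq_some_head hw] using hzp⟩
  have h2 : IsReduced (u.toWord ++ [(i, !b), (1, !b)]) := List.isChain_append.2
    ⟨isReduced_toWord, by simp, by simpa [List.getLast?_eq_some_getLast hw] using hqz⟩
  have h3 := h1.append_overlap h2 hw
  refine ⟨(i, b) :: (u.toWord ++ [(i, !b)]), b, by simpa using h3, ?_⟩
  have h4 := hN.conj_mem u hu (mk [(1, b), (i, b)])
  rw [inv_mk, ← mk_toWord (x := u), mul_mk, mul_mk] at h4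
  simpa [invRev] using h4

/-- The word `x₀ᵐ v ⋯ x₀² v x₀ v`, where `v` is the word `B` between the letters `(1, b)` and
`(1, !b)`. -/
def staircase (B : List (Fin 2 × Bool)) (b : Bool) : ℕ → List (Fin 2 × Bool)
  | 0 => []
  | m + 1 => List.replicate (m + 1) (0, true) ++ (1, b) :: (B ++ (1, !b) :: staircase B b m)

theorem isReduced_staircase {B : List (Fin 2 × Bool)} {b : Bool}
    (h : IsReduced ((1, b) :: (B ++ [(1, !b)]))) (m : ℕ) : IsReduced (staircase B b m) := by
  induction m with
  | zero => exact IsReduced.nil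
  | succ m ih =>
    have h1 : IsReduced (List.replicate (m + 1) (0, true) ++ (1, b) :: (B ++ [(1, !b)])) :=
      List.isChain_append.2 ⟨List.isChain_replicate_of_rel _ (by simp), h,
        by simp [List.getLast?_replicate]⟩
    have h2 : IsReduced (((1, b) :: (B ++ [(1, !b)])) ++ staircase B b m) := by
      refine List.isChain_append.2 ⟨h, ih, ?_⟩
      cases m with
      | zero => simp [staircase]
      | succ m => simp [staircase, List.replicate_succ, List.getLast?_cons]
    simpa [staircase] using h1.append_overlap h2 (by simp)

theorem mk_replicate (n : ℕ) :
    (mk (List.replicate n (0, true)) : FreeGroup (Fin 2)) = of 0 ^ n := by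
  rw [← toWord_of_pow, mk_toWord]

theorem exists_staircase_mul_mem {N : Subgroup (FreeGroup (Fin 2))} (hN : N.Normal)
    {B : List (Fin 2 × Bool)} {b : Bool} (h : mk ((1, b) :: (B ++ [(1, !b)])) ∈ N) (m : ℕ) :
    ∃ a : ℕ, ∃ p ∈ N, mk (staircase B b m) = p * of 0 ^ a := by
  induction m with
  | zero => exact ⟨0, 1, N.one_mem, by simp [staircase, one_eq_mk]⟩
  | succ m ih =>
    obtain ⟨a, p, hp, hpa⟩ := ih
    refine ⟨m + 1 + a, _, hN.conj_mem _ (N.mul_mem h hp) (of 0 ^ (m + 1)), ?_⟩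
    rw [pow_add _ (m + 1) a, ← mul_assoc, inv_mul_cancel_right, mul_assoc, mul_assoc, ← hpa,
      ← mk_replicate, mul_mk, mul_mk]
    simp [staircase]

theorem syllableDiff_staircase {R : Type*} [Ring R] (B : List (Fin 2 × Bool)) (b : Bool) (m : ℕ)
    {k : ℕ} (hk : k ∈ Finset.Icc 1 m) (hB : syllableDiff R B k = 0) :
    syllableDiff R (staircase B b m) k = 1 := by
  have key : ∀ m : ℕ, 1 ≤ k → syllableDiff R (staircase B b m) k = if k ≤ m then 1 else 0 := by
    intro m hk
    induction m with
    | zero => simp [staircase, syllableDiff, syllableCount, show k ≠ 0 by lia]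
    | succ m ih =>
      simp only [staircase, syllableDiff_append_cons, syllableDiff_replicate, Finsupp.add_apply,
        Finsupp.sub_apply, hB, ih, Finsupp.single_apply]
      have h1 : ¬ -((m + 1 : ℕ) : ℤ) = k := by lia
      rw [if_neg h1]
      by_cases h2 : k = m + 1
      · simp [h2]
      · have h3 : ¬ ((m + 1 : ℕ) : ℤ) = k := by lia
        have h4 : k ≤ m + 1 ↔ k ≤ m := by lia
        rw [if_neg h3]
        simp [h4]
  rw [Finset.mem_Icc] at hk
  rw [key m hk.1, if_pos hk.2]

theorem syllableDiff_unbounded {R : Type*} [Ring R] [Nontrivial R]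
    {N : Subgroup (FreeGroup (Fin 2))} (hN : N.Normal) (hne : N ≠ ⊥) (C : ℕ) :
    ∃ x ∈ N, C < (syllableDiff R x.toWord).support.card := by
  obtain ⟨B, b, hred, hmem⟩ := exists_reduced_bracket hN hne
  by_contra! hC
  set S := (syllableDiff R B).support
  set m := C + 26 + S.card + 1
  obtain ⟨a, p, hp, hpa⟩ := exists_staircase_mul_mem hN hmem m
  have h1 := (almostHom_syllableDiff (R := R)).mul_le p (of 0 ^ a)
  have h2 := card_support_sub_le (Finsupp.single (a : ℤ) (1 : R)) (Finsupp.single (-a : ℤ) 1)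
  have h3 := card_support_single_le (a : ℤ) (1 : R)
  have h4 := card_support_single_le (-a : ℤ) (1 : R)
  simp only [← hpa, toWord_mk, (isReduced_staircase hred m).reduce_eq, toWord_of_pow,
    syllableDiff_replicate] at h1
  have h5 := hC p hp
  have h6 : (Finset.Icc 1 m).map Nat.castEmbedding \ S ⊆
      (syllableDiff R (staircase B b m)).support := by
    intro z hz
    obtain ⟨hz, hzS⟩ := Finset.mem_sdiff.1 hz
    obtain ⟨k, hk, rfl⟩ := Finset.mem_map.1 hz
    have := syllableDiff_staircase (R := R) B b m hk (Finsupp.notMem_support_iff.1 hzS)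
    exact Finsupp.mem_support_iff.2 (by simp [this])
  have h7 := Finset.card_le_card h6
  have h8 := Finset.le_card_sdiff S ((Finset.Icc 1 m).map (Nat.castEmbedding (R := ℤ)))
  simp only [Finset.card_map, Nat.card_Icc] at h8
  lia

/-- The free group of rank two has no proper verbal subgroups of finite width. -/
theorem freeGroup_not_widthLE {V : Set (FreeGroup ℕ)} (hfin : V.Finite)
    (htop : verbalSubgroup (FreeGroup (Fin 2)) V ≠ ⊤)
    (hbot : verbalSubgroup (FreeGroup (Fin 2)) V ≠ ⊥) (m : ℕ) :
    ¬ widthLE (FreeGroup (Fin 2)) V m := by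
  intro hm
  obtain ⟨d, hd, hpow⟩ := exists_exponent V
  have hd1 : d ≠ 1 := by
    rintro rfl
    exact htop ((Subgroup.eq_top_iff' _).2 fun x => by simpa using hpow _ x)
  have : Nontrivial (ZMod d) := ZMod.nontrivial_iff.2 hd1
  obtain ⟨C, hC⟩ := (almostHom_syllableDiff (R := ZMod d)).bounded_of_widthLE hfin hd hm
  obtain ⟨x, hx, hlt⟩ := syllableDiff_unbounded (R := ZMod d)
    ⟨fun x hx g => conj_mem_verbalSubgroup hx g⟩ hbot C
  exact absurd (hC x hx) (not_le.2 hlt)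

end Normal

/-! ### The projection of `Cb n` onto the free group of rank two -/

section Projection

open FreeGroup

/-- The projection of the free group of rank `n` which keeps the first two generators. -/
def firstTwo (n : ℕ) : FreeGroup (Fin n) →* FreeGroup (Fin 2) :=
  FreeGroup.lift fun l => if l.val = 0 then of 0 else if l.val = 1 then of 1 else 1

theorem firstTwo_surjective {n : ℕ} (hn : 2 ≤ n) : Function.Surjective (firstTwo n) := by
  rw [← MonoidHom.range_eq_top, eq_top_iff, ← FreeGroup.closure_range_of, Subgroup.closure_le]
  rintro _ ⟨i, rfl⟩
  refine ⟨of ⟨i, by lia⟩, ?_⟩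
  fin_cases i <;> simp [firstTwo]

/-- `φ` induces conjugation by `g` on the first two generators. -/
def InducesConj {n : ℕ} (φ : MulAut (FreeGroup (Fin n))) (g : FreeGroup (Fin 2)) : Prop :=
  ∀ w, firstTwo n (φ w) = g * firstTwo n w * g⁻¹

namespace InducesConj

variable {n : ℕ} {φ ψ : MulAut (FreeGroup (Fin n))} {g h : FreeGroup (Fin 2)}

theorem mul (hφ : InducesConj φ g) (hψ : InducesConj ψ h) : InducesConj (φ * ψ) (g * h) := by
  intro w
  rw [MulAut.mul_apply, hφ, hψ]
  group

theorem inv (hφ : InducesConj φ g) : InducesConj φ⁻¹ g⁻¹ := by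
  intro w
  have h := hφ (φ⁻¹ w)
  rw [MulAut.apply_inv_self] at h
  rw [h]
  group

theorem of_generators
    (H : ∀ l, firstTwo n (φ (of l)) = g * firstTwo n (of l) * g⁻¹) : InducesConj φ g := by
  have h : (firstTwo n).comp φ.toMonoidHom = (MulAut.conj g).toMonoidHom.comp (firstTwo n) := by
    ext l
    simpa using H l
  exact fun w => DFunLike.congr_fun h w

theorem unique (hn : 2 ≤ n) (hg : InducesConj φ g) (hh : InducesConj φ h) : g = h := by
  refine inv_mul_eq_one.1 (eq_one_of_forall_commute (g := g⁻¹ * h) fun k => ?_)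
  obtain ⟨w, rfl⟩ := firstTwo_surjective hn k
  have e := (hg w).symm.trans (hh w)
  have e' := congrArg (fun t => g⁻¹ * t * h) e
  simpa [mul_assoc] using e'.symm

end InducesConj

theorem inducesConj_eps {n : ℕ} {i j : Fin n} (hij : i ≠ j) :
    InducesConj (eps i j) (if i.val < 2 then (firstTwo n (of j))⁻¹ else 1) := by
  refine InducesConj.of_generators fun l => ?_
  have hval : i.val ≠ j.val := Fin.val_ne_of_ne hij
  have heps : eps i j (of l) = if l = i then (of j)⁻¹ * of i * of j else of l := by
    simp [eps]
  rw [heps]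
  by_cases hl : l = i
  · subst hl
    by_cases h : l.val < 2
    · simp [h]
    · have h1 : firstTwo n (of l) = 1 := by
        simp [firstTwo, show l.val ≠ 0 by lia, show l.val ≠ 1 by lia]
      simp [h, h1]
  · rw [if_neg hl]
    split_ifs with h
    · have hval' : l.val ≠ i.val := Fin.val_ne_of_ne hl
      by_cases hj : j.val < 2
      · by_cases hl2 : l.val < 2
        · have : l = j := Fin.ext (by lia)
          simp [this]
        · have h1 : firstTwo n (of l) = 1 := by
            simp [firstTwo, show l.val ≠ 0 by lia, show l.val ≠ 1 by lia]
          simp [h1]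
      · have h1 : firstTwo n (of j) = 1 := by
          simp [firstTwo, show j.val ≠ 0 by lia, show j.val ≠ 1 by lia]
        simp [h1]
    · simp

theorem exists_inducesConj {n : ℕ} {φ : MulAut (FreeGroup (Fin n))} (hφ : φ ∈ Cb n) :
    ∃ g, InducesConj φ g := by
  induction hφ using Subgroup.closure_induction with
  | mem _ h =>
    obtain ⟨i, j, hij, rfl⟩ := h
    exact ⟨_, inducesConj_eps hij⟩
  | one => exact ⟨1, fun w => by simp⟩
  | mul _ _ _ _ h₁ h₂ =>
    obtain ⟨⟨g, hg⟩, h, hh⟩ := And.intro h₁ h₂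
    exact ⟨g * h, hg.mul hh⟩
  | inv _ _ h =>
    obtain ⟨g, hg⟩ := h
    exact ⟨g⁻¹, hg.inv⟩

theorem exists_surjective_hom {n : ℕ} (hn : 2 ≤ n) :
    ∃ f : Cb n →* FreeGroup (Fin 2), Function.Surjective f := by
  choose f hf using fun φ : Cb n => exists_inducesConj φ.2
  refine ⟨MonoidHom.mk' f fun φ ψ => (hf (φ * ψ)).unique hn ((hf φ).mul (hf ψ)), ?_⟩
  rw [← MonoidHom.range_eq_top, eq_top_iff, ← FreeGroup.closure_range_of, Subgroup.closure_le]
  rintro _ ⟨k, rfl⟩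
  obtain ⟨i, j, hij, hi, hj⟩ : ∃ i j : Fin n, i ≠ j ∧ i.val < 2 ∧ firstTwo n (of j) = of k := by
    refine ⟨⟨1 - k, by lia⟩, ⟨k, by lia⟩, ?_, by simp only; lia, ?_⟩
    · rw [Ne, Fin.mk.injEq]
      lia
    · fin_cases k <;> simp [firstTwo]
  let φ : Cb n := ⟨eps i j, Subgroup.subset_closure ⟨i, j, hij, rfl⟩⟩
  have h := (hf φ).unique hn (inducesConj_eps hij)
  rw [if_pos hi, hj] at h
  rw [SetLike.mem_coe, ← inv_mem_iff]
  exact ⟨φ, h⟩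

end Projection

/-- Proposition 4.4: for every `n ≥ 2` the group `Cb_n` of basis-conjugating
automorphisms has no proper verbal subgroups of finite width: for every finite set of
words `V` which is proper (i.e. `V(F_2)` is a proper nontrivial subgroup of the free
group `F_2`), the width of `V(Cb_n)` with respect to `V` is infinite. -/
theorem Cb_no_finite_width (n : ℕ) (hn : 2 ≤ n) (V : Set (FreeGroup ℕ))
    (hfin : V.Finite)
    (hproper_top : verbalSubgroup (FreeGroup (Fin 2)) V ≠ ⊤)
    (hproper_bot : verbalSubgroup (FreeGroup (Fin 2)) V ≠ ⊥) :
    ¬ ∃ m : ℕ, widthLE (Cb n) V m := by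
  rintro ⟨m, hm⟩
  obtain ⟨f, hf⟩ := exists_surjective_hom hn
  exact freeGroup_not_widthLE hfin hproper_top hproper_bot m (widthLE_of_surjective f hf hm)
end

section
/- For n ≥ 3, the map ρ : C_n → GL(V_n), defined on the braid generators σ_i by the Lawrence–Krammer matrices and on the permutation generators α_i by the permutation action v_{k,l} ↦ v_{α_i(k),α_i(l)} on the basis {v_{i,j} : 1 ≤ i < j ≤ n}, extends to a group homomorphism (i.e. preserves all defining relations of C_n) if and only if t = 1. In particular, the relation σ_iα_{i+1}α_i = α_{i+1}α_iσ_{i+1} is preserved on the basis vector v_{i,i+2} if and only if t = 1. -/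
/- The Lawrence–Krammer module has basis `v_{kl}`, `1 ≤ k < l ≤ n`; matrices are written
with rows indexed by the input basis vector and columns by the output coefficient, so
that a word of generators acting one after another (as in the paper, which uses the
right action) corresponds to the product of the matrices in the same order. -/

/-- Index set of the basis `v_{kl}`, `k < l`, of the Lawrence–Krammer module. -/
abbrev LKIdx (n : ℕ) := {p : Fin n × Fin n // p.1 < p.2}

/-- The Lawrence–Krammer matrix of the braid generator σ_i (0-based `i`):
`σ_i(v_{k,i}) = (1-q)v_{k,i} + q v_{k,i+1} + q(q-1)v_{i,i+1}` (`k < i`),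
`σ_i(v_{k,i+1}) = v_{k,i}` (`k < i`), `σ_i(v_{i,i+1}) = tq² v_{i,i+1}`,
`σ_i(v_{i,l}) = tq(q-1)v_{i,i+1} + (1-q)v_{i,l} + q v_{i+1,l}` (`i+1 < l`),
`σ_i(v_{i+1,l}) = v_{i,l}`, and `σ_i(v_{k,l}) = v_{k,l}` when `{k,l} ∩ {i,i+1} = ∅`. -/
def LKmat {R : Type*} [CommRing R] (n : ℕ) (t q : R) (i : ℕ) :
    Matrix (LKIdx n) (LKIdx n) R :=
  Matrix.of fun p p' =>
    let k := (p.1.1 : ℕ); let l := (p.1.2 : ℕ)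
    let a := (p'.1.1 : ℕ); let b := (p'.1.2 : ℕ)
    if k = i ∧ l = i + 1 then (if a = i ∧ b = i + 1 then t * q ^ 2 else 0)
    else if l = i then
      (if a = k ∧ b = i then 1 - q
       else if a = k ∧ b = i + 1 then q
       else if a = i ∧ b = i + 1 then q * (q - 1) else 0)
    else if l = i + 1 then (if a = k ∧ b = i then 1 else 0)
    else if k = i then
      (if a = i ∧ b = i + 1 then t * q * (q - 1)
       else if a = i ∧ b = l then 1 - q
       else if a = i + 1 ∧ b = l then q else 0)
    else if k = i + 1 then (if a = i ∧ b = l then 1 else 0)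
    else (if a = k ∧ b = l then 1 else 0)

/-- The transposition of `i` and `i+1` on indices. -/
def swN (i x : ℕ) : ℕ := if x = i then i + 1 else if x = i + 1 then i else x

/-- The permutation matrix of α_i on the Lawrence–Krammer basis:
`v_{k,l} ↦ v_{α_i(k), α_i(l)}` (indices re-sorted). -/
def permLKmat {R : Type*} [CommRing R] (n : ℕ) (i : ℕ) :
    Matrix (LKIdx n) (LKIdx n) R :=
  Matrix.of fun p p' =>
    if (p'.1.1 : ℕ) = min (swN i p.1.1) (swN i p.1.2) ∧
       (p'.1.2 : ℕ) = max (swN i p.1.1) (swN i p.1.2) then 1 else 0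

/-- The basis vector `v_{i,i+2}`. -/
def vIdx (n i : ℕ) (h : i + 2 < n) : LKIdx n :=
  ⟨(⟨i, by omega⟩, ⟨i + 2, h⟩), by exact Fin.mk_lt_mk.mpr (by omega)⟩

section FunctionModel

variable {R : Type*}

/-- The restriction of a function of two natural numbers to the index set of the basis. -/
def resLK (n : ℕ) (f : ℕ → ℕ → R) : LKIdx n → R := fun p => f p.1.1 p.1.2

theorem resLK_congr {n : ℕ} {f g : ℕ → ℕ → R} (h : ∀ k l, k < l → f k l = g k l) :
    resLK n f = resLK n g :=
  funext fun p => h _ _ p.2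

/-- The action of `permLKmat` on column vectors, on functions of two natural numbers. -/
def permLKop (i : ℕ) (f : ℕ → ℕ → R) : ℕ → ℕ → R := fun k l =>
  f (min (swN i k) (swN i l)) (max (swN i k) (swN i l))

theorem permLKop_apply (i : ℕ) (f : ℕ → ℕ → R) (k l : ℕ) :
    permLKop i f k l = f (min (swN i k) (swN i l)) (max (swN i k) (swN i l)) := rfl

theorem permLKop_min_max (i : ℕ) (f : ℕ → ℕ → R) (a b : ℕ) :
    permLKop i f (min a b) (max a b) = permLKop i f a b := by
  rcases le_total a b with h | h <;> simp [permLKop, h, min_comm, max_comm]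

theorem permLKop_permLKop (i j : ℕ) (f : ℕ → ℕ → R) (k l : ℕ) :
    permLKop i (permLKop j f) k l = permLKop j f (swN i k) (swN i l) :=
  permLKop_min_max j f _ _

theorem swN_left (i : ℕ) : swN i i = i + 1 := by simp [swN]

theorem swN_right (i : ℕ) : swN i (i + 1) = i := by simp [swN]

theorem swN_of_ne {i x : ℕ} (h : x ≠ i) (h' : x ≠ i + 1) : swN i x = x := by simp [swN, h, h']

theorem swN_swN (i x : ℕ) : swN i (swN i x) = x := by grind [swN]

theorem swN_braid (i x : ℕ) :
    swN i (swN (i + 1) (swN i x)) = swN (i + 1) (swN i (swN (i + 1) x)) := by grind [swN]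

theorem swN_comm {i j : ℕ} (hij : i + 2 ≤ j ∨ j + 2 ≤ i) (x : ℕ) :
    swN i (swN j x) = swN j (swN i x) := by grind [swN]

theorem permLKop_sq (i : ℕ) (f : ℕ → ℕ → R) {k l : ℕ} (h : k < l) :
    permLKop i (permLKop i f) k l = f k l := by
  rw [permLKop_permLKop, permLKop_apply, swN_swN, swN_swN, min_eq_left h.le, max_eq_right h.le]

theorem permLKop_braid (i : ℕ) (f : ℕ → ℕ → R) (k l : ℕ) :
    permLKop i (permLKop (i + 1) (permLKop i f)) k l
      = permLKop (i + 1) (permLKop i (permLKop (i + 1) f)) k l := by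
  simp only [permLKop_permLKop]
  simp only [permLKop_apply, swN_braid]

theorem permLKop_comm {i j : ℕ} (hij : i + 2 ≤ j ∨ j + 2 ≤ i) (f : ℕ → ℕ → R) (k l : ℕ) :
    permLKop i (permLKop j f) k l = permLKop j (permLKop i f) k l := by
  simp only [permLKop_permLKop]
  simp only [permLKop_apply, swN_comm hij]

variable [CommRing R]

/-- The action of `LKmat` on column vectors, on functions of two natural numbers. -/
def LKop (t q : R) (i : ℕ) (f : ℕ → ℕ → R) : ℕ → ℕ → R := fun k l =>
  if k = i ∧ l = i + 1 then t * q ^ 2 * f i (i + 1)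
  else if l = i then (1 - q) * f k i + q * f k (i + 1) + q * (q - 1) * f i (i + 1)
  else if l = i + 1 then f k i
  else if k = i then t * q * (q - 1) * f i (i + 1) + (1 - q) * f i l + q * f (i + 1) l
  else if k = i + 1 then f i l
  else f k l

theorem resLK_surjective (n : ℕ) (v : LKIdx n → R) : ∃ f, resLK n f = v := by
  refine ⟨fun k l => if h : ∃ hk : k < n, ∃ hl : l < n, k < l then
    v ⟨(⟨k, h.1⟩, ⟨l, h.2.1⟩), h.2.2⟩ else 0, ?_⟩
  funext p
  obtain ⟨⟨⟨k, hk⟩, ⟨l, hl⟩⟩, h⟩ := p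
  have h' : k < l := h
  simp [resLK, hk, hl, h']

theorem sum_ite_mul_resLK {n x y : ℕ} (hxy : x < y) (hy : y < n) (c : R) (f : ℕ → ℕ → R) :
    ∑ p : LKIdx n, (if (p.1.1 : ℕ) = x ∧ (p.1.2 : ℕ) = y then c else 0) * f p.1.1 p.1.2
      = c * f x y := by
  rw [Finset.sum_eq_single (⟨(⟨x, hxy.trans hy⟩, ⟨y, hy⟩), hxy⟩ : LKIdx n)]
  · simp
  · rintro ⟨⟨⟨a, ha⟩, ⟨b, hb⟩⟩, hab⟩ - hne
    rw [if_neg, zero_mul]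
    rintro ⟨rfl, rfl⟩
    exact hne rfl
  · simp

theorem LKmat_mulVec_resLK {n i : ℕ} (hi : i + 1 < n) (t q : R) (f : ℕ → ℕ → R) :
    (LKmat n t q i).mulVec (resLK n f) = resLK n (LKop t q i f) := by
  funext p
  obtain ⟨⟨⟨k, hk⟩, ⟨l, hl⟩⟩, h⟩ := p
  replace h : k < l := h
  simp only [Matrix.mulVec, dotProduct, LKmat, Matrix.of_apply, resLK, LKop]
  split_ifs
  · exact sum_ite_mul_resLK i.lt_succ_self hi _ f
  · rw [← sum_ite_mul_resLK (n := n) (x := k) (y := i) (by omega) (by omega) (1 - q) f,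
      ← sum_ite_mul_resLK (n := n) (x := k) (y := i + 1) (by omega) (by omega) q f,
      ← sum_ite_mul_resLK (n := n) (x := i) (y := i + 1) (by omega) (by omega) (q * (q - 1)) f,
      ← Finset.sum_add_distrib, ← Finset.sum_add_distrib]
    refine Finset.sum_congr rfl fun p _ => ?_
    split_ifs <;> first | omega | ring
  · rw [sum_ite_mul_resLK, one_mul] <;> omega
  · rw [← sum_ite_mul_resLK (n := n) (x := i) (y := i + 1) (by omega) (by omega)
        (t * q * (q - 1)) f,
      ← sum_ite_mul_resLK (n := n) (x := i) (y := l) (by omega) (by omega) (1 - q) f,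
      ← sum_ite_mul_resLK (n := n) (x := i + 1) (y := l) (by omega) (by omega) q f,
      ← Finset.sum_add_distrib, ← Finset.sum_add_distrib]
    refine Finset.sum_congr rfl fun p _ => ?_
    split_ifs <;> first | omega | ring
  · rw [sum_ite_mul_resLK, one_mul] <;> omega
  · rw [sum_ite_mul_resLK h hl, one_mul]

theorem permLKmat_mulVec_resLK {n i : ℕ} (hi : i + 1 < n) (f : ℕ → ℕ → R) :
    (permLKmat n i).mulVec (resLK n f) = resLK n (permLKop i f) := by
  funext p
  obtain ⟨⟨⟨k, hk⟩, ⟨l, hl⟩⟩, h⟩ := p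
  replace h : k < l := h
  simp only [Matrix.mulVec, dotProduct, permLKmat, Matrix.of_apply, resLK, permLKop]
  rw [sum_ite_mul_resLK, one_mul] <;> unfold swN <;> split_ifs <;> omega

theorem matrix_ext_resLK {n : ℕ} {A B : Matrix (LKIdx n) (LKIdx n) R}
    (h : ∀ f, A.mulVec (resLK n f) = B.mulVec (resLK n f)) : A = B := by
  refine Matrix.ext_of_mulVec_single fun p => ?_
  obtain ⟨f, hf⟩ := resLK_surjective n (Pi.single p (1 : R))
  rw [← hf, h]

theorem LKop_adjacent (t q : R) (i : ℕ) (f : ℕ → ℕ → R) :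
    LKop t q i f i (i + 1) = t * q ^ 2 * f i (i + 1) := by simp [LKop]

theorem LKop_snd_eq (t q : R) (i k : ℕ) (f : ℕ → ℕ → R) :
    LKop t q i f k i
      = (1 - q) * f k i + q * f k (i + 1) + q * (q - 1) * f i (i + 1) := by
  simp [LKop]

theorem LKop_snd_eq_succ (t q : R) {i k : ℕ} (h : k < i) (f : ℕ → ℕ → R) :
    LKop t q i f k (i + 1) = f k i := by
  simp [LKop, h.ne]

theorem LKop_fst_eq (t q : R) {i l : ℕ} (h : i + 1 < l) (f : ℕ → ℕ → R) :
    LKop t q i f i l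
      = t * q * (q - 1) * f i (i + 1) + (1 - q) * f i l + q * f (i + 1) l := by
  simp [LKop, h.ne', (Nat.lt_of_succ_lt h).ne']

theorem LKop_fst_eq_succ (t q : R) {i l : ℕ} (h : i + 1 < l) (f : ℕ → ℕ → R) :
    LKop t q i f (i + 1) l = f i l := by
  simp [LKop, h.ne', (Nat.lt_of_succ_lt h).ne']

theorem LKop_of_ne (t q : R) {i k l : ℕ} (hk : k ≠ i) (hk' : k ≠ i + 1) (hl : l ≠ i)
    (hl' : l ≠ i + 1) (f : ℕ → ℕ → R) : LKop t q i f k l = f k l := by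
  simp [LKop, hk, hk', hl, hl']

theorem LKop_braid (t q : R) (i : ℕ) (f : ℕ → ℕ → R) {k l : ℕ} (h : k < l) :
    LKop t q i (LKop t q (i + 1) (LKop t q i f)) k l
      = LKop t q (i + 1) (LKop t q i (LKop t q (i + 1) f)) k l := by
  have hk : k = i ∨ k = i + 1 ∨ k = i + 1 + 1 ∨
      (k ≠ i ∧ k ≠ i + 1 ∧ k ≠ i + 1 + 1) := by omega
  have hl : l = i ∨ l = i + 1 ∨ l = i + 1 + 1 ∨
      (l ≠ i ∧ l ≠ i + 1 ∧ l ≠ i + 1 + 1) := by omega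
  rcases hk with rfl | rfl | rfl | hk <;> rcases hl with rfl | rfl | rfl | hl <;>
    first
    | omega
    | simp (disch := omega) only [LKop_adjacent, LKop_snd_eq, LKop_snd_eq_succ, LKop_fst_eq,
        LKop_fst_eq_succ, LKop_of_ne]
      try ring

theorem LKop_comm (t q : R) {i j : ℕ} (hij : i + 2 ≤ j) (f : ℕ → ℕ → R) {k l : ℕ} (h : k < l) :
    LKop t q i (LKop t q j f) k l = LKop t q j (LKop t q i f) k l := by
  have hk : k = i ∨ k = i + 1 ∨ k = j ∨ k = j + 1 ∨
      (k ≠ i ∧ k ≠ i + 1 ∧ k ≠ j ∧ k ≠ j + 1) := by omega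
  have hl : l = i ∨ l = i + 1 ∨ l = j ∨ l = j + 1 ∨
      (l ≠ i ∧ l ≠ i + 1 ∧ l ≠ j ∧ l ≠ j + 1) := by omega
  rcases hk with rfl | rfl | rfl | rfl | hk <;> rcases hl with rfl | rfl | rfl | rfl | hl <;>
    first
    | omega
    | simp (disch := omega) only [LKop_adjacent, LKop_snd_eq, LKop_snd_eq_succ, LKop_fst_eq,
        LKop_fst_eq_succ, LKop_of_ne]
      try ring

theorem permLKop_LKop_comm (t q : R) {i j : ℕ} (hij : i + 2 ≤ j ∨ j + 2 ≤ i)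
    (f : ℕ → ℕ → R) {k l : ℕ} (h : k < l) :
    permLKop i (LKop t q j f) k l = LKop t q j (permLKop i f) k l := by
  have hk : k = i ∨ k = i + 1 ∨ k = j ∨ k = j + 1 ∨
      (k ≠ i ∧ k ≠ i + 1 ∧ k ≠ j ∧ k ≠ j + 1) := by omega
  have hl : l = i ∨ l = i + 1 ∨ l = j ∨ l = j + 1 ∨
      (l ≠ i ∧ l ≠ i + 1 ∧ l ≠ j ∧ l ≠ j + 1) := by omega
  rcases hk with rfl | rfl | rfl | rfl | hk <;> rcases hl with rfl | rfl | rfl | rfl | hl <;>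
    first
    | omega
    | simp (disch := omega) only [LKop_adjacent, LKop_snd_eq, LKop_snd_eq_succ, LKop_fst_eq,
        LKop_fst_eq_succ, LKop_of_ne, permLKop_apply, swN_left, swN_right, swN_of_ne,
        min_eq_left, min_eq_right, max_eq_left, max_eq_right]

theorem LKop_one_permLKop_permLKop (q : R) (i : ℕ) (f : ℕ → ℕ → R) {k l : ℕ} (h : k < l) :
    LKop 1 q i (permLKop (i + 1) (permLKop i f)) k l
      = permLKop (i + 1) (permLKop i (LKop 1 q (i + 1) f)) k l := by
  have hk : k = i ∨ k = i + 1 ∨ k = i + 1 + 1 ∨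
      (k ≠ i ∧ k ≠ i + 1 ∧ k ≠ i + 1 + 1) := by omega
  have hl : l = i ∨ l = i + 1 ∨ l = i + 1 + 1 ∨
      (l ≠ i ∧ l ≠ i + 1 ∧ l ≠ i + 1 + 1) := by omega
  rcases hk with rfl | rfl | rfl | hk <;> rcases hl with rfl | rfl | rfl | hl <;>
    first
    | omega
    | simp (disch := omega) only [LKop_adjacent, LKop_snd_eq, LKop_snd_eq_succ, LKop_fst_eq,
        LKop_fst_eq_succ, LKop_of_ne, permLKop_apply, swN_left, swN_right, swN_of_ne,
        min_eq_left, min_eq_right, max_eq_left, max_eq_right]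
      try ring

theorem LKop_LKop_permLKop (t q : R) (i : ℕ) (f : ℕ → ℕ → R) {k l : ℕ} (h : k < l) :
    LKop t q (i + 1) (LKop t q i (permLKop (i + 1) f)) k l
      = permLKop i (LKop t q (i + 1) (LKop t q i f)) k l := by
  have hk : k = i ∨ k = i + 1 ∨ k = i + 1 + 1 ∨
      (k ≠ i ∧ k ≠ i + 1 ∧ k ≠ i + 1 + 1) := by omega
  have hl : l = i ∨ l = i + 1 ∨ l = i + 1 + 1 ∨
      (l ≠ i ∧ l ≠ i + 1 ∧ l ≠ i + 1 + 1) := by omega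
  rcases hk with rfl | rfl | rfl | hk <;> rcases hl with rfl | rfl | rfl | hl <;>
    first
    | omega
    | simp (disch := omega) only [LKop_adjacent, LKop_snd_eq, LKop_snd_eq_succ, LKop_fst_eq,
        LKop_fst_eq_succ, LKop_of_ne, permLKop_apply, swN_left, swN_right, swN_of_ne,
        min_eq_left, min_eq_right, max_eq_left, max_eq_right]
      try ring

theorem LKop_permLKop_permLKop_apply (t q : R) (i : ℕ) (f : ℕ → ℕ → R) :
    LKop t q i (permLKop (i + 1) (permLKop i f)) i (i + 1 + 1)
      = t * q * (q - 1) * f (i + 1) (i + 1 + 1) + (1 - q) * f i (i + 1)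
        + q * f i (i + 1 + 1) := by
  simp (disch := omega) only [LKop_fst_eq, permLKop_apply, swN_left, swN_right, swN_of_ne,
    min_eq_left, min_eq_right, max_eq_left, max_eq_right]

theorem permLKop_permLKop_LKop_apply (t q : R) (i : ℕ) (f : ℕ → ℕ → R) :
    permLKop (i + 1) (permLKop i (LKop t q (i + 1) f)) i (i + 1 + 1)
      = (1 - q) * f i (i + 1) + q * f i (i + 1 + 1)
        + q * (q - 1) * f (i + 1) (i + 1 + 1) := by
  simp (disch := omega) only [LKop_snd_eq, permLKop_apply, swN_left, swN_right, swN_of_ne,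
    min_eq_left, min_eq_right, max_eq_left, max_eq_right]

end FunctionModel

/-- Proposition 5.2: for `n ≥ 3` the map `ρ : C_n → GL(V_n)` given on the braid
generators σ_i by the Lawrence–Krammer matrices and on the permutation generators α_i
by the permutation action on the basis preserves all the defining relations of `C_n`
(and hence extends to a group homomorphism) if and only if `t = 1`.  In particular the
relation `σ_i α_{i+1} α_i = α_{i+1} α_i σ_{i+1}` is preserved on the basis vector
`v_{i,i+2}` if and only if `t = 1`. -/
theorem LK_extends_to_Cn_iff (R : Type*) [CommRing R] [IsDomain R] (t q : R)
    (hq0 : q ≠ 0) (hq1 : q ≠ 1) (n : ℕ) (hn : 3 ≤ n) :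
    (((∀ i, i + 2 < n →
        LKmat n t q i * LKmat n t q (i + 1) * LKmat n t q i
          = LKmat n t q (i + 1) * LKmat n t q i * LKmat n t q (i + 1)) ∧
      (∀ i j, i + 1 < n → j + 1 < n → (i + 2 ≤ j ∨ j + 2 ≤ i) →
        LKmat n t q i * LKmat n t q j = LKmat n t q j * LKmat n t q i) ∧
      (∀ i, i + 1 < n → permLKmat (R := R) n i * permLKmat n i = 1) ∧
      (∀ i, i + 2 < n →
        permLKmat (R := R) n i * permLKmat n (i + 1) * permLKmat n i
          = permLKmat n (i + 1) * permLKmat n i * permLKmat n (i + 1)) ∧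
      (∀ i j, i + 1 < n → j + 1 < n → (i + 2 ≤ j ∨ j + 2 ≤ i) →
        permLKmat (R := R) n i * permLKmat n j = permLKmat n j * permLKmat n i) ∧
      (∀ i j, i + 1 < n → j + 1 < n → (i + 2 ≤ j ∨ j + 2 ≤ i) →
        permLKmat n i * LKmat n t q j = LKmat n t q j * permLKmat n i) ∧
      (∀ i, i + 2 < n →
        LKmat n t q i * permLKmat n (i + 1) * permLKmat n i
          = permLKmat n (i + 1) * permLKmat n i * LKmat n t q (i + 1)) ∧
      (∀ i, i + 2 < n →
        LKmat n t q (i + 1) * LKmat n t q i * permLKmat n (i + 1)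
          = permLKmat n i * LKmat n t q (i + 1) * LKmat n t q i)) ↔ t = 1) ∧
    (∀ i, ∀ h : i + 2 < n,
      ((∀ p' : LKIdx n,
        (LKmat n t q i * permLKmat n (i + 1) * permLKmat n i :
            Matrix (LKIdx n) (LKIdx n) R) (vIdx n i h) p'
          = (permLKmat n (i + 1) * permLKmat n i * LKmat n t q (i + 1) :
            Matrix (LKIdx n) (LKIdx n) R) (vIdx n i h) p')
        ↔ t = 1)) := by
  have mixed : t = 1 → ∀ i, i + 2 < n →
      LKmat n t q i * permLKmat n (i + 1) * permLKmat n i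
        = permLKmat n (i + 1) * permLKmat n i * LKmat n t q (i + 1) := by
    rintro rfl i hi
    refine matrix_ext_resLK fun f => ?_
    have hi' : i + 1 < n := by omega
    simp only [← Matrix.mulVec_mulVec, LKmat_mulVec_resLK, permLKmat_mulVec_resLK, hi, hi']
    exact resLK_congr fun _ _ h => LKop_one_permLKop_permLKop q i f h
  have eq_one : ∀ i, ∀ h : i + 2 < n, (∀ p' : LKIdx n,
      (LKmat n t q i * permLKmat n (i + 1) * permLKmat n i :
          Matrix (LKIdx n) (LKIdx n) R) (vIdx n i h) p'
        = (permLKmat n (i + 1) * permLKmat n i * LKmat n t q (i + 1) :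
          Matrix (LKIdx n) (LKIdx n) R) (vIdx n i h) p') → t = 1 := by
    intro i hi h
    have key := congrArg
      (· ⬝ᵥ resLK n fun k l => if k = i + 1 ∧ l = i + 2 then (1 : R) else 0) (funext h)
    change Matrix.mulVec _ _ _ = Matrix.mulVec _ _ _ at key
    have hi' : i + 1 < n := by omega
    simp only [← Matrix.mulVec_mulVec, LKmat_mulVec_resLK, permLKmat_mulVec_resLK, hi, hi'] at key
    change LKop t q i _ i (i + 1 + 1) = permLKop (i + 1) _ i (i + 1 + 1) at key
    rw [LKop_permLKop_permLKop_apply, permLKop_permLKop_LKop_apply] at key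
    simpa [hq0, hq1, sub_eq_zero] using key
  refine ⟨⟨fun h => ?_, fun ht => ⟨?_, ?_, ?_, ?_, ?_, ?_, mixed ht, ?_⟩⟩, fun i hi =>
    ⟨eq_one i hi, fun ht p' => by rw [mixed ht i hi]⟩⟩
  · obtain ⟨-, -, -, -, -, -, h, -⟩ := h
    exact eq_one 0 (by omega) fun p' => by rw [h 0 (by omega)]
  · intro i hi
    have hi' : i + 1 < n := by omega
    refine matrix_ext_resLK fun f => ?_
    simp only [← Matrix.mulVec_mulVec, LKmat_mulVec_resLK, hi, hi']
    exact resLK_congr fun _ _ h => LKop_braid t q i f h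
  · intro i j hi hj hij
    refine matrix_ext_resLK fun f => ?_
    simp only [← Matrix.mulVec_mulVec, LKmat_mulVec_resLK, hi, hj]
    exact resLK_congr fun _ _ h =>
      hij.elim (LKop_comm t q · f h) fun hji => (LKop_comm t q hji f h).symm
  · intro i hi
    refine matrix_ext_resLK fun f => ?_
    simp only [← Matrix.mulVec_mulVec, permLKmat_mulVec_resLK, hi, Matrix.one_mulVec]
    exact resLK_congr fun _ _ h => permLKop_sq i f h
  · intro i hi
    have hi' : i + 1 < n := by omega
    refine matrix_ext_resLK fun f => ?_
    simp only [← Matrix.mulVec_mulVec, permLKmat_mulVec_resLK, hi, hi']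
    exact resLK_congr fun k l _ => permLKop_braid i f k l
  · intro i j hi hj hij
    refine matrix_ext_resLK fun f => ?_
    simp only [← Matrix.mulVec_mulVec, permLKmat_mulVec_resLK, hi, hj]
    exact resLK_congr fun k l _ => permLKop_comm hij f k l
  · intro i j hi hj hij
    refine matrix_ext_resLK fun f => ?_
    simp only [← Matrix.mulVec_mulVec, LKmat_mulVec_resLK, permLKmat_mulVec_resLK, hi, hj]
    exact resLK_congr fun _ _ h => permLKop_LKop_comm t q hij f h
  · intro i hi
    have hi' : i + 1 < n := by omega
    refine matrix_ext_resLK fun f => ?_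
    simp only [← Matrix.mulVec_mulVec, LKmat_mulVec_resLK, permLKmat_mulVec_resLK, hi, hi']
    exact resLK_congr fun _ _ h => LKop_LKop_permLKop t q i f h
end

section
/- Let R = Z[t^{±1}, q^{±1}] be the ring of Laurent polynomials in two variables. The mapping class group M(0,n) of the n-punctured 2-sphere and the braid group B_n(S²) of the 2-sphere are linear for every n ≥ 2. Moreover, for each n ≥ 4 there exist injective group homomorphisms φ : M(0,n) → GL_m(R) and φ_1 : B_n(S²) → GL_{m_1}(R), where m = (n−1)(n−2)·n!/2 and m_1 = 2m. -/
/- We write `n = m + 2 ≥ 2`.  The braid group of the 2-sphere `B_n(S²)` has generators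
`δ_0, …, δ_{m}` (0-based) with the braid relations and the sphere relation
`δ_0 δ_1 ⋯ δ_{m-1} δ_m² δ_{m-1} ⋯ δ_1 δ_0 = 1`; the mapping class group `M(0,n)` is its
quotient by `Δ_n = (δ_0 δ_1 ⋯ δ_{m-1})^{n-1} = 1`. -/

/-- The list `[δ_0, δ_1, …, δ_{m-1}]` of all sphere-braid generators but the last one. -/
def deltaList (m : ℕ) : List (FreeGroup (Fin (m + 1))) :=
  ((List.finRange (m + 1)).dropLast).map FreeGroup.of

/-- Relators of the braid group `B_{m+2}(S²)` of the 2-sphere. -/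
def sphereRels (m : ℕ) : Set (FreeGroup (Fin (m + 1))) :=
  {r | ∃ i j : Fin (m + 1), (i : ℕ) + 1 = (j : ℕ) ∧
    r = FreeGroup.of i * FreeGroup.of j * FreeGroup.of i *
      (FreeGroup.of j * FreeGroup.of i * FreeGroup.of j)⁻¹} ∪
  {r | ∃ i j : Fin (m + 1), (i : ℕ) + 2 ≤ (j : ℕ) ∧
    r = FreeGroup.of i * FreeGroup.of j * (FreeGroup.of j * FreeGroup.of i)⁻¹} ∪
  {(deltaList m).prod * (FreeGroup.of (Fin.last m)) ^ 2 * ((deltaList m).reverse).prod}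

/-- Relators of the mapping class group `M(0, m+2)` of the punctured 2-sphere:
those of `B_{m+2}(S²)` together with `Δ_n = (δ_0 ⋯ δ_{m-1})^{n-1}`. -/
def mcgRels (m : ℕ) : Set (FreeGroup (Fin (m + 1))) :=
  sphereRels m ∪ {((deltaList m).prod) ^ (m + 1)}

/-- The sequence `s` satisfies the braid relations for the indices below `r`. -/
structure IsBraid {M : Type*} [Monoid M] (s : ℕ → M) (r : ℕ) : Prop where
  braid : ∀ i, i + 1 < r → s i * s (i + 1) * s i = s (i + 1) * s i * s (i + 1)
  comm : ∀ i j, i + 2 ≤ j → j < r → s i * s j = s j * s i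

/-- The ascending product `s a * s (a + 1) * ⋯ * s (a + l - 1)`. -/
def asc {M : Type*} [Monoid M] (s : ℕ → M) (a : ℕ) : ℕ → M
  | 0 => 1
  | l + 1 => asc s a l * s (a + l)

/-- The descending product `s (a + l - 1) * ⋯ * s (a + 1) * s a`. -/
def desc {M : Type*} [Monoid M] (s : ℕ → M) (a : ℕ) : ℕ → M
  | 0 => 1
  | l + 1 => s (a + l) * desc s a l

section BraidCalculus

variable {M : Type*} [Monoid M] {s : ℕ → M} {r : ℕ}

@[simp] lemma asc_zero (s : ℕ → M) (a : ℕ) : asc s a 0 = 1 := rfl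

@[simp] lemma desc_zero (s : ℕ → M) (a : ℕ) : desc s a 0 = 1 := rfl

lemma asc_succ (s : ℕ → M) (a l : ℕ) : asc s a (l + 1) = asc s a l * s (a + l) := rfl

lemma desc_succ (s : ℕ → M) (a l : ℕ) : desc s a (l + 1) = s (a + l) * desc s a l := rfl

lemma asc_add (s : ℕ → M) (a k l : ℕ) : asc s a (k + l) = asc s a k * asc s (a + k) l := by
  induction l with
  | zero => simp
  | succ l ih => rw [← add_assoc, asc_succ, ih, asc_succ, mul_assoc, add_assoc]

lemma desc_add (s : ℕ → M) (a k l : ℕ) : desc s a (k + l) = desc s (a + k) l * desc s a k := by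
  induction l with
  | zero => simp
  | succ l ih => rw [← add_assoc, desc_succ, ih, desc_succ, mul_assoc, add_assoc]

lemma asc_succ' (s : ℕ → M) (a l : ℕ) : asc s a (l + 1) = s a * asc s (a + 1) l := by
  rw [add_comm l 1, asc_add]; simp [asc]

lemma desc_succ' (s : ℕ → M) (a l : ℕ) : desc s a (l + 1) = desc s (a + 1) l * s a := by
  rw [add_comm l 1, desc_add]; simp [desc]

lemma map_asc {N : Type*} [Monoid N] (f : M →* N) (s : ℕ → M) (a l : ℕ) :
    f (asc s a l) = asc (fun i => f (s i)) a l := by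
  induction l with
  | zero => simp
  | succ l ih => simp [asc_succ, ih]

lemma map_desc {N : Type*} [Monoid N] (f : M →* N) (s : ℕ → M) (a l : ℕ) :
    f (desc s a l) = desc (fun i => f (s i)) a l := by
  induction l with
  | zero => simp
  | succ l ih => simp [desc_succ, ih]

lemma asc_op (s : ℕ → M) (a l : ℕ) :
    asc (fun i => MulOpposite.op (s i)) a l = MulOpposite.op (desc s a l) := by
  induction l with
  | zero => simp
  | succ l ih => simp [asc_succ, desc_succ, ih]

lemma desc_op (s : ℕ → M) (a l : ℕ) :
    desc (fun i => MulOpposite.op (s i)) a l = MulOpposite.op (asc s a l) := by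
  induction l with
  | zero => simp
  | succ l ih => simp [asc_succ, desc_succ, ih]

lemma asc_congr {s' : ℕ → M} {a l : ℕ} (h : ∀ i, a ≤ i → i < a + l → s i = s' i) :
    asc s a l = asc s' a l := by
  induction l with
  | zero => simp
  | succ l ih =>
    rw [asc_succ, asc_succ, ih fun i h1 h2 => h i h1 (by omega), h _ (by omega) (by omega)]

lemma desc_congr {s' : ℕ → M} {a l : ℕ} (h : ∀ i, a ≤ i → i < a + l → s i = s' i) :
    desc s a l = desc s' a l := by
  induction l with
  | zero => simp
  | succ l ih =>
    rw [desc_succ, desc_succ, ih fun i h1 h2 => h i h1 (by omega), h _ (by omega) (by omega)]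

namespace IsBraid

lemma mono (hs : IsBraid s r) {r' : ℕ} (h : r' ≤ r) : IsBraid s r' :=
  ⟨fun i hi => hs.braid i (by omega), fun i j hij hj => hs.comm i j hij (by omega)⟩

lemma map (hs : IsBraid s r) {N : Type*} [Monoid N] (f : M →* N) :
    IsBraid (fun i => f (s i)) r :=
  ⟨fun i hi => by simp only [← map_mul, hs.braid i hi],
    fun i j hij hj => by simp only [← map_mul, hs.comm i j hij hj]⟩

lemma op (hs : IsBraid s r) : IsBraid (fun i => MulOpposite.op (s i)) r :=
  ⟨fun i hi => by simp only [← MulOpposite.op_mul, ← mul_assoc, hs.braid i hi],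
    fun i j hij hj => by simp only [← MulOpposite.op_mul, hs.comm i j hij hj]⟩

lemma commute (hs : IsBraid s r) {i j : ℕ} (hi : i < r) (hj : j < r)
    (h : i + 2 ≤ j ∨ j + 2 ≤ i) : Commute (s i) (s j) := by
  rcases h with h | h
  · exact hs.comm i j h hj
  · exact (hs.comm j i h hi).symm

lemma commute_asc (hs : IsBraid s r) {j a l : ℕ} (hj : j < r) (hl : a + l ≤ r)
    (h : j + 2 ≤ a ∨ a + l < j) : Commute (s j) (asc s a l) := by
  induction l with
  | zero => simp
  | succ l ih =>
    exact (ih (by omega) (by omega)).mul_right (hs.commute hj (by omega) (by omega))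

lemma commute_desc (hs : IsBraid s r) {j a l : ℕ} (hj : j < r) (hl : a + l ≤ r)
    (h : j + 2 ≤ a ∨ a + l < j) : Commute (s j) (desc s a l) := by
  induction l with
  | zero => simp
  | succ l ih =>
    exact (hs.commute hj (by omega) (by omega)).mul_right (ih (by omega) (by omega))

lemma asc_mul (hs : IsBraid s r) {i a l : ℕ} (ha : a ≤ i) (hi : i + 1 < a + l) (hl : a + l ≤ r) :
    asc s a l * s i = s (i + 1) * asc s a l := by
  induction l with
  | zero => omega
  | succ l ih =>
    rcases Nat.lt_or_ge (i + 1) (a + l) with h | h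
    · rw [asc_succ, mul_assoc, (hs.commute (i := a + l) (j := i) (by omega) (by omega)
        (by omega)).eq, ← mul_assoc, ih h (by omega), mul_assoc]
    · obtain ⟨l, rfl⟩ : ∃ l', l = l' + 1 := ⟨l - 1, by omega⟩
      obtain rfl : i = a + l := by omega
      have hc := (hs.commute_asc (j := a + l + 1) (a := a) (l := l) (by omega) (by omega)
        (by omega)).eq
      rw [asc_succ, asc_succ, ← mul_assoc, ← mul_assoc, hc]
      simp only [mul_assoc]
      have := hs.braid (a + l) (by omega)
      simp only [mul_assoc] at this
      exact congrArg (asc s a l * ·) this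

lemma mul_desc (hs : IsBraid s r) {i a l : ℕ} (ha : a ≤ i) (hi : i + 1 < a + l)
    (hl : a + l ≤ r) : s i * desc s a l = desc s a l * s (i + 1) := by
  have := hs.op.asc_mul ha hi hl
  rw [asc_op] at this
  exact MulOpposite.op_injective this

/-- The first block of a word for the full twist on the generators `a, …, a + l`. -/
lemma asc_pow_eq (hs : IsBraid s r) {a l k : ℕ} (hl : a + l + 1 ≤ r) (hk : k ≤ l + 1) :
    asc s a (l + 1) ^ k = asc s a l ^ k * desc s (a + l + 1 - k) k := by
  induction k with
  | zero => simp
  | succ k ih =>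
    have key : ∀ k' ≤ k, desc s (a + l + 1 - k) k' * asc s a (l + 1) =
        asc s a (l + 1) * desc s (a + l - k) k' := by
      intro k' hk'
      induction k' with
      | zero => simp
      | succ k' ih' =>
        rw [desc_succ, mul_assoc, ih' (by omega), ← mul_assoc, desc_succ]
        have := hs.asc_mul (i := a + l - k + k') (a := a) (l := l + 1) (by omega) (by omega)
          (by omega)
        rw [show a + l + 1 - k + k' = a + l - k + k' + 1 by omega, ← this, mul_assoc]
    rw [pow_succ, ih (by omega), mul_assoc, key k le_rfl, ← mul_assoc, asc_succ, ← mul_assoc,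
      ← pow_succ, mul_assoc]
    rw [show a + l + 1 - (k + 1) = a + l - k by omega, desc_succ,
      show a + l - k + k = a + l by omega]

lemma asc_pow_succ (hs : IsBraid s r) {a l : ℕ} (hl : a + l + 1 ≤ r) :
    asc s a (l + 1) ^ (l + 2) =
      asc s a l ^ (l + 1) * (desc s a (l + 1) * asc s a (l + 1)) := by
  rw [pow_succ, hs.asc_pow_eq hl le_rfl, mul_assoc, show a + l + 1 - (l + 1) = a by omega]

lemma asc_pow_eq' (hs : IsBraid s r) {a l k : ℕ} (hl : a + l + 1 ≤ r) (hk : k ≤ l + 1) :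
    asc s a (l + 1) ^ k = desc s a k * asc s (a + 1) l ^ k := by
  induction k with
  | zero => simp
  | succ k ih =>
    have key : ∀ k' ≤ k, asc s a (l + 1) * desc s a k' =
        desc s (a + 1) k' * asc s a (l + 1) := by
      intro k' hk'
      induction k' with
      | zero => simp
      | succ k' ih' =>
        have := hs.asc_mul (i := a + k') (a := a) (l := l + 1) (by omega) (by omega) (by omega)
        rw [desc_succ, ← mul_assoc, this, mul_assoc, ih' (by omega), desc_succ, ← mul_assoc,
          show a + k' + 1 = a + 1 + k' by omega]
    rw [pow_succ', ih (by omega), ← mul_assoc, key k le_rfl, asc_succ', desc_succ', pow_succ']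
    simp only [mul_assoc]

lemma asc_pow_succ' (hs : IsBraid s r) {a l : ℕ} (hl : a + l + 1 ≤ r) :
    asc s a (l + 1) ^ (l + 2) =
      asc s a (l + 1) * desc s a (l + 1) * asc s (a + 1) l ^ (l + 1) := by
  rw [pow_succ', hs.asc_pow_eq' hl le_rfl, mul_assoc]

lemma commute_desc_mul_asc (hs : IsBraid s r) {a l j : ℕ} (hl : a + l ≤ r) (ha : a ≤ j)
    (hj : j + 1 < a + l) : Commute (s j) (desc s a l * asc s a l) := by
  rw [Commute, SemiconjBy, ← mul_assoc, hs.mul_desc ha hj hl, mul_assoc, ← hs.asc_mul ha hj hl,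
    mul_assoc]

lemma commute_asc_mul_desc (hs : IsBraid s r) {a l j : ℕ} (hl : a + l ≤ r) (ha : a < j)
    (hj : j < a + l) : Commute (s j) (asc s a l * desc s a l) := by
  obtain ⟨j, rfl⟩ : ∃ i, j = i + 1 := ⟨j - 1, by omega⟩
  rw [Commute, SemiconjBy, ← mul_assoc, ← hs.asc_mul (by omega) hj hl, mul_assoc,
    hs.mul_desc (by omega) hj hl, mul_assoc]

/-- The full twist commutes with the generators. -/
lemma commute_twist (hs : IsBraid s r) {a l j : ℕ} (hl : a + l ≤ r) (ha : a ≤ j)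
    (hj : j < a + l) : Commute (s j) (asc s a l ^ (l + 1)) := by
  induction l generalizing a with
  | zero => omega
  | succ l ih =>
    rcases Nat.lt_or_ge j (a + l) with h | h
    · rw [hs.asc_pow_succ (by omega)]
      exact (ih (by omega) ha h).mul_right (hs.commute_desc_mul_asc hl ha (by omega))
    · obtain rfl : j = a + l := by omega
      rcases Nat.eq_zero_or_pos l with rfl | h0
      · simp only [zero_add, asc_succ, asc_zero, one_mul]
        exact (Commute.refl _).pow_right _
      · rw [hs.asc_pow_succ' (by omega)]
        exact (hs.commute_asc_mul_desc hl (by omega) (by omega)).mul_right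
          (ih (by omega) (by omega) (by omega))

lemma commute_asc_asc {y : M} {a l : ℕ} (h : ∀ j, a ≤ j → j < a + l → Commute (s j) y) :
    Commute (asc s a l) y := by
  induction l with
  | zero => simp
  | succ l ih =>
    exact (ih fun j h1 h2 => h j h1 (by omega)).mul_left (h _ (by omega) (by omega))

lemma commute_desc_right {y : M} {a l : ℕ} (h : ∀ j, a ≤ j → j < a + l → Commute (s j) y) :
    Commute (desc s a l) y := by
  induction l with
  | zero => simp
  | succ l ih =>
    exact (h _ (by omega) (by omega)).mul_left (ih fun j h1 h2 => h j h1 (by omega))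

lemma asc_pow_eq_desc_pow (hs : IsBraid s r) {a l : ℕ} (hl : a + l ≤ r) :
    asc s a l ^ (l + 1) = desc s a l ^ (l + 1) := by
  induction l with
  | zero => simp
  | succ l ih =>
    have h := hs.op.asc_pow_succ hl
    rw [asc_op, desc_op, asc_op, ← MulOpposite.op_pow, ← MulOpposite.op_pow,
      ← MulOpposite.op_mul, ← MulOpposite.op_mul] at h
    rw [MulOpposite.op_injective h, hs.asc_pow_succ hl, ih (by omega)]
    refine Commute.pow_left ?_ _
    exact commute_desc_right fun j h1 h2 => hs.commute_desc_mul_asc hl h1 (by omega)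

end IsBraid

lemma asc_mem_closure {a l : ℕ} {t : Set ℕ} (h : ∀ i, a ≤ i → i < a + l → i ∈ t) :
    asc s a l ∈ Submonoid.closure (s '' t) := by
  induction l with
  | zero => exact one_mem _
  | succ l ih =>
    exact mul_mem (ih fun i h1 h2 => h i h1 (by omega))
      (Submonoid.subset_closure ⟨_, h _ (by omega) (by omega), rfl⟩)

lemma desc_mem_closure {a l : ℕ} {t : Set ℕ} (h : ∀ i, a ≤ i → i < a + l → i ∈ t) :
    desc s a l ∈ Submonoid.closure (s '' t) := by
  induction l with
  | zero => exact one_mem _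
  | succ l ih =>
    exact mul_mem (Submonoid.subset_closure ⟨_, h _ (by omega) (by omega), rfl⟩)
      (ih fun i h1 h2 => h i h1 (by omega))

/-- Every generator divides the full twist in the monoid of positive words. -/
lemma IsBraid.exists_mul_eq_twist (hs : IsBraid s r) {a l j : ℕ} (hl : a + l ≤ r) (ha : a ≤ j)
    (hj : j < a + l) :
    ∃ w ∈ Submonoid.closure (s '' Set.Iio r), s j * w = asc s a l ^ (l + 1) := by
  induction l generalizing a with
  | zero => omega
  | succ l ih =>
    have hasc : asc s a (l + 1) ∈ Submonoid.closure (s '' Set.Iio r) :=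
      asc_mem_closure fun i h1 h2 => by simp only [Set.mem_Iio]; omega
    have hdesc : desc s a (l + 1) ∈ Submonoid.closure (s '' Set.Iio r) :=
      desc_mem_closure fun i h1 h2 => by simp only [Set.mem_Iio]; omega
    rcases Nat.lt_or_ge j (a + l) with h | h
    · obtain ⟨w, hw, e⟩ := ih (by omega) ha h
      refine ⟨_, mul_mem hw (mul_mem hdesc hasc), ?_⟩
      rw [hs.asc_pow_succ (by omega), ← e, mul_assoc]
    · obtain rfl : j = a + l := by omega
      rcases Nat.eq_zero_or_pos l with rfl | h0
      · exact ⟨_, hasc, by simp [asc_succ, pow_two]⟩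
      · obtain ⟨w, hw, e⟩ := ih (a := a + 1) (by omega) (by omega) (by omega)
        refine ⟨_, mul_mem (mul_mem hasc hdesc) hw, ?_⟩
        rw [hs.asc_pow_succ' (by omega), ← e, ← mul_assoc,
          (hs.commute_asc_mul_desc hl (by omega) (by omega)).eq, mul_assoc]

end BraidCalculus

lemma Function.End.mul_apply {α : Type*} (f g : Function.End α) (x : α) :
    (f * g) x = f (g x) := rfl

lemma Function.End.one_apply {α : Type*} (x : α) : (1 : Function.End α) x = x := rfl

section SphereAction

variable {K : Type*} [Group K] {s : ℕ → K} {m : ℕ}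

/-- The pure braid moving strand `i` once around all the other ones, on `m + 1` strands. -/
def ringBraid (s : ℕ → K) (m i : ℕ) : K :=
  asc s i (m - i) * desc s i (m - i) * (desc s 0 i * asc s 0 i)

lemma ringBraid_eq (s : ℕ → K) {m i : ℕ} (hi : i ≤ m) :
    ringBraid s m i = asc s i (m - i) * desc s 0 m * asc s 0 i := by
  have := desc_add s 0 i (m - i)
  rw [Nat.add_sub_cancel' hi, zero_add] at this
  rw [ringBraid, this]
  simp only [mul_assoc]

lemma ringBraid_mul (s : ℕ → K) {m i : ℕ} (hi : i < m) :
    ringBraid s m i * s i = s i * ringBraid s m (i + 1) := by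
  rw [ringBraid_eq s hi.le, ringBraid_eq s hi, asc_succ s 0 i,
    show m - i = m - (i + 1) + 1 by omega, asc_succ', zero_add]
  simp only [mul_assoc]

lemma IsBraid.commute_ringBraid (hs : IsBraid s m) {i j : ℕ} (hi : i ≤ m) (hj : j < m)
    (h : i < j ∨ j + 2 ≤ i) : Commute (s j) (ringBraid s m i) := by
  rcases h with h | h
  · exact (hs.commute_asc_mul_desc (by omega) h (by omega)).mul_right
      ((hs.commute_desc hj (by omega) (by omega)).mul_right
        (hs.commute_asc hj (by omega) (by omega)))
  · exact ((hs.commute_asc hj (by omega) (by omega)).mul_right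
      (hs.commute_desc hj (by omega) (by omega))).mul_right
        (hs.commute_desc_mul_asc (by omega) (by omega) (by omega))

lemma IsBraid.commute_ringBraid_mul (hs : IsBraid s m) {i : ℕ} (hi : i < m) :
    Commute (s i) (ringBraid s m i * ringBraid s m (i + 1)) := by
  set F := asc s i (m - i) * desc s i (m - i) with hF
  set F' := asc s (i + 1) (m - (i + 1)) * desc s (i + 1) (m - (i + 1)) with hF'
  set E := desc s 0 i * asc s 0 i with hE
  set E' := desc s 0 (i + 1) * asc s 0 (i + 1) with hE'
  have h1 : F = s i * F' * s i := by
    rw [hF, hF', show m - i = m - (i + 1) + 1 by omega, asc_succ', desc_succ']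
    simp only [mul_assoc]
  have h2 : E' = s i * E * s i := by
    rw [hE', hE, asc_succ, desc_succ, zero_add]
    simp only [mul_assoc]
  have c1 : Commute F' F := by
    refine Commute.mul_left (IsBraid.commute_asc_asc fun j h1 h2 => ?_)
      (IsBraid.commute_desc_right fun j h1 h2 => ?_)
    all_goals exact hs.commute_asc_mul_desc (by omega) (by omega) (by omega)
  have c2 : Commute E E' := by
    refine Commute.mul_left (IsBraid.commute_desc_right fun j h1 h2 => ?_)
      (IsBraid.commute_asc_asc fun j h1 h2 => ?_)
    all_goals exact hs.commute_desc_mul_asc (by omega) (by omega) (by omega)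
  have c3 : Commute E F' := by
    refine Commute.mul_left (IsBraid.commute_desc_right fun j h1 h2 => ?_)
      (IsBraid.commute_asc_asc fun j h1 h2 => ?_)
    all_goals
      exact (hs.commute_asc (by omega) (by omega) (by omega)).mul_right
        (hs.commute_desc (by omega) (by omega) (by omega))
  have e : ringBraid s m i * ringBraid s m (i + 1) = F * F' * (E * E') := by
    change F * E * (F' * E') = _
    rw [mul_assoc, ← mul_assoc E, c3.eq]
    simp only [mul_assoc]
  rw [e]
  refine Commute.mul_right ?_ ?_
  · rw [Commute, SemiconjBy]
    nth_rw 1 [← c1.eq]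
    rw [h1]
    simp only [mul_assoc]
  · rw [Commute, SemiconjBy]
    nth_rw 2 [c2.eq]
    rw [h2]
    simp only [mul_assoc]

lemma IsBraid.asc_ringBraid (hs : IsBraid s m) :
    asc (ringBraid s m) 0 (m + 1) = (asc s 0 m ^ (m + 1)) ^ 2 := by
  set F := fun i => asc s i (m - i) * desc s i (m - i) with hF
  set E := fun i => desc s 0 i * asc s 0 i with hE
  have h1 : ∀ k ≤ m + 1, asc (ringBraid s m) 0 k = asc F 0 k * asc E 0 k := by
    intro k hk
    induction k with
    | zero => simp
    | succ k ih =>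
      have c : Commute (asc E 0 k) (F k) := by
        refine IsBraid.commute_asc_asc fun j h1 h2 => ?_
        refine Commute.mul_left (IsBraid.commute_desc_right fun j h1 h2 => ?_)
          (IsBraid.commute_asc_asc fun j h1 h2 => ?_)
        all_goals
          exact (hs.commute_asc (by omega) (by omega) (by omega)).mul_right
            (hs.commute_desc (by omega) (by omega) (by omega))
      rw [asc_succ, ih (by omega), asc_succ, asc_succ, zero_add]
      change asc F 0 k * asc E 0 k * (F k * E k) = _
      rw [mul_assoc, ← mul_assoc (asc E 0 k), c.eq]
      simp only [mul_assoc]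
  have h2 : ∀ k ≤ m, asc E 0 (k + 1) = asc s 0 k ^ (k + 1) := by
    intro k hk
    induction k with
    | zero => simp [asc_succ, hE]
    | succ k ih =>
      rw [asc_succ, ih (by omega), hs.asc_pow_succ (by omega), zero_add]
  have h3 : ∀ l a, a + l = m → asc F a (l + 1) = asc s a l ^ (l + 1) := by
    intro l
    induction l with
    | zero => rintro a rfl; simp [asc_succ, hF]
    | succ l ih =>
      intro a ha
      rw [asc_succ', ih (a + 1) (by omega), hs.asc_pow_succ' (by omega), hF]
      simp only [show m - a = l + 1 by omega]
  rw [h1 _ le_rfl, h2 m le_rfl, h3 m 0 (by omega), pow_two]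

/-- The transposition exchanging `i` and `i + 1`. -/
def stepSwap (i j : ℕ) : ℕ := if j = i then i + 1 else if j = i + 1 then i else j

/-- The cocycle describing the action of the generators of the sphere braid group on `m + 2`
strands on the cosets of the stabilizer of a puncture. -/
def sphereCocycle (s : ℕ → K) (m i j : ℕ) : K :=
  if j = i then (ringBraid s m i)⁻¹
  else if j = i + 1 then 1
  else if j < i then s (i - 1)
  else if j ≤ m + 1 then s i
  else 1

/-- The action of a generator of the sphere braid group on the induced set. -/
def sphereStep (s : ℕ → K) (m i : ℕ) : Function.End (ℕ × K) :=
  fun x => (stepSwap i x.1, sphereCocycle s m i x.1 * x.2)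

lemma sphereStep_self (s : ℕ → K) (m i : ℕ) (k : K) :
    sphereStep s m i (i, k) = (i + 1, (ringBraid s m i)⁻¹ * k) := by
  simp [sphereStep, stepSwap, sphereCocycle]

lemma sphereStep_succ (s : ℕ → K) (m i : ℕ) (k : K) :
    sphereStep s m i (i + 1, k) = (i, k) := by
  simp [sphereStep, stepSwap, sphereCocycle]

lemma sphereStep_lt (s : ℕ → K) (m : ℕ) {i j : ℕ} (k : K) (h : j < i) :
    sphereStep s m i (j, k) = (j, s (i - 1) * k) := by
  simp [sphereStep, stepSwap, sphereCocycle, h.ne, h, show j ≠ i + 1 by omega]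

lemma sphereStep_gt (s : ℕ → K) (m : ℕ) {i j : ℕ} (k : K) (h : i + 1 < j) (hj : j ≤ m + 1) :
    sphereStep s m i (j, k) = (j, s i * k) := by
  simp [sphereStep, stepSwap, sphereCocycle, show j ≠ i by omega, show ¬ j < i by omega, h.ne', hj]

lemma sphereStep_top (s : ℕ → K) (m : ℕ) {i j : ℕ} (k : K) (h : i < m + 1) (hj : m + 1 < j) :
    sphereStep s m i (j, k) = (j, k) := by
  simp [sphereStep, stepSwap, sphereCocycle, show j ≠ i by omega, show ¬ j < i by omega,
    show j ≠ i + 1 by omega, hj]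

lemma IsBraid.isBraid_sphereStep (hs : IsBraid s m) : IsBraid (sphereStep s m) (m + 1) where
  braid i hi := by
    funext ⟨j, k⟩
    simp only [Function.End.mul_apply]
    rcases Nat.lt_or_ge (m + 1) j with h | hj
    · simp only [sphereStep_top s m _ (show i < m + 1 by omega) h,
        sphereStep_top s m _ (show i + 1 < m + 1 by omega) h]
    rcases Nat.lt_or_ge j i with h | h
    · simp only [sphereStep_lt s m _ h, sphereStep_lt s m _ (show j < i + 1 by omega)]
      obtain ⟨i, rfl⟩ : ∃ i', i = i' + 1 := ⟨i - 1, by omega⟩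
      have := hs.braid i (by omega)
      simp only [← mul_assoc, Nat.add_sub_cancel, this]
    rcases Nat.lt_or_ge (i + 2) j with h' | h'
    · simp only [sphereStep_gt s m _ (show i + 1 < j by omega) hj,
        sphereStep_gt s m _ (show i + 1 + 1 < j by omega) hj]
      have := hs.braid i (by omega)
      simp only [← mul_assoc, this]
    obtain rfl | rfl | rfl : j = i ∨ j = i + 1 ∨ j = i + 2 := by omega
    · rw [sphereStep_self, sphereStep_self,
        sphereStep_gt s m _ (show j + 1 < j + 1 + 1 by omega) (by omega),
        sphereStep_lt s m _ (show j < j + 1 by omega), sphereStep_self, sphereStep_self]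
      have := (hs.commute_ringBraid_mul (i := j) (by omega)).inv_right.eq
      rw [mul_inv_rev] at this
      simp only [← mul_assoc] at this ⊢
      simp [this]
    · rw [sphereStep_succ, sphereStep_lt s m _ (show i < i + 1 by omega), sphereStep_self,
        sphereStep_self, sphereStep_gt s m _ (show i + 1 < i + 1 + 1 by omega) (by omega),
        sphereStep_succ]
      have := ringBraid_mul s (show i < m by omega)
      have : (ringBraid s m i)⁻¹ * s i = s i * (ringBraid s m (i + 1))⁻¹ := by
        rw [inv_mul_eq_iff_eq_mul, ← mul_assoc, this, mul_inv_cancel_right]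
      simp [← mul_assoc, this]
    · rw [sphereStep_gt s m _ (show i + 1 < i + 1 + 1 by omega) (by omega), sphereStep_succ,
        sphereStep_succ, sphereStep_succ, sphereStep_succ,
        sphereStep_lt s m _ (show i < i + 1 by omega)]
      simp
  comm i j hij hj := by
    funext ⟨l, k⟩
    simp only [Function.End.mul_apply]
    rcases Nat.lt_or_ge (m + 1) l with h | hl
    · simp only [sphereStep_top s m _ (show i < m + 1 by omega) h,
        sphereStep_top s m _ (show j < m + 1 by omega) h]
    rcases Nat.lt_or_ge l i with h | h
    · simp only [sphereStep_lt s m _ h, sphereStep_lt s m _ (show l < j by omega), ← mul_assoc]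
      rw [(hs.commute (i := i - 1) (j := j - 1) (by omega) (by omega) (by omega)).eq]
    rcases Nat.lt_or_ge (j + 1) l with h' | h'
    · simp only [sphereStep_gt s m _ (show i + 1 < l by omega) hl,
        sphereStep_gt s m _ (show j + 1 < l by omega) hl, ← mul_assoc]
      rw [(hs.commute (i := i) (j := j) (by omega) (by omega) (by omega)).eq]
    obtain rfl | rfl | rfl | rfl | h1 :
        l = i ∨ l = i + 1 ∨ l = j ∨ l = j + 1 ∨ (i + 1 < l ∧ l < j) := by omega
    · rw [sphereStep_self, sphereStep_lt s m _ (show l < j by omega),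
        sphereStep_lt s m _ (show l + 1 < j by omega), sphereStep_self, ← mul_assoc, ← mul_assoc,
        (hs.commute_ringBraid (i := l) (j := j - 1) (by omega) (by omega)
          (by omega)).inv_right.eq]
    · rw [sphereStep_succ, sphereStep_lt s m _ (show i < j by omega),
        sphereStep_lt s m _ (show i + 1 < j by omega), sphereStep_succ]
    · rw [sphereStep_self, sphereStep_gt s m _ (show i + 1 < l by omega) (by omega),
        sphereStep_gt s m _ (show i + 1 < l + 1 by omega) (by omega), sphereStep_self, ← mul_assoc, ← mul_assoc,
        (hs.commute_ringBraid (i := l) (j := i) (by omega) (by omega)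
          (by omega)).inv_right.eq]
    · rw [sphereStep_succ, sphereStep_gt s m _ (show i + 1 < j by omega) (by omega),
        sphereStep_gt s m _ (show i + 1 < j + 1 by omega) (by omega), sphereStep_succ]
    · simp only [sphereStep_gt s m _ h1.1 hl, sphereStep_lt s m _ h1.2, ← mul_assoc]
      rw [(hs.commute (i := i) (j := j - 1) (by omega) (by omega) (by omega)).eq]

lemma asc_sphereStep_lt (s : ℕ → K) (m : ℕ) {a l j : ℕ} (k : K) (h : j < a) :
    asc (sphereStep s m) a l (j, k) = (j, asc s (a - 1) l * k) := by
  induction l generalizing k with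
  | zero => simp [Function.End.one_apply]
  | succ l ih =>
    rw [asc_succ, asc_succ, Function.End.mul_apply,
      sphereStep_lt s m _ (show j < a + l by omega), ih, mul_assoc, show a + l - 1 = a - 1 + l by omega]

lemma desc_sphereStep_lt (s : ℕ → K) (m : ℕ) {a l j : ℕ} (k : K) (h : j < a) :
    desc (sphereStep s m) a l (j, k) = (j, desc s (a - 1) l * k) := by
  induction l generalizing k with
  | zero => simp [Function.End.one_apply]
  | succ l ih =>
    rw [desc_succ, desc_succ, Function.End.mul_apply, ih,
      sphereStep_lt s m _ (show j < a + l by omega), mul_assoc, show a + l - 1 = a - 1 + l by omega]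

lemma asc_sphereStep_gt (s : ℕ → K) (m : ℕ) {a l j : ℕ} (k : K) (h : a + l < j)
    (hj : j ≤ m + 1) : asc (sphereStep s m) a l (j, k) = (j, asc s a l * k) := by
  induction l generalizing k with
  | zero => simp [Function.End.one_apply]
  | succ l ih =>
    rw [asc_succ, asc_succ, Function.End.mul_apply,
      sphereStep_gt s m _ (show a + l + 1 < j by omega) hj, ih _ (by omega), mul_assoc]

lemma desc_sphereStep_gt (s : ℕ → K) (m : ℕ) {a l j : ℕ} (k : K) (h : a + l < j)
    (hj : j ≤ m + 1) : desc (sphereStep s m) a l (j, k) = (j, desc s a l * k) := by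
  induction l generalizing k with
  | zero => simp [Function.End.one_apply]
  | succ l ih =>
    rw [desc_succ, desc_succ, Function.End.mul_apply, ih _ (by omega),
      sphereStep_gt s m _ (show a + l + 1 < j by omega) hj, mul_assoc]

lemma asc_sphereStep_self (s : ℕ → K) (m : ℕ) {a l : ℕ} (k : K) :
    asc (sphereStep s m) a l (a + l, k) = (a, k) := by
  induction l generalizing k with
  | zero => simp [Function.End.one_apply]
  | succ l ih =>
    rw [asc_succ, Function.End.mul_apply, ← add_assoc, sphereStep_succ, ih]

lemma desc_sphereStep_self (s : ℕ → K) (m : ℕ) {a l : ℕ} (k : K) :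
    desc (sphereStep s m) a l (a, k) = (a + l, (asc (ringBraid s m) a l)⁻¹ * k) := by
  induction l generalizing k with
  | zero => simp [Function.End.one_apply]
  | succ l ih =>
    rw [desc_succ, Function.End.mul_apply, ih, sphereStep_self, asc_succ,
      mul_inv_rev, mul_assoc, add_assoc]

lemma IsBraid.sphereStep_relation (hs : IsBraid s m) (ht : (asc s 0 m ^ (m + 1)) ^ 2 = 1)
    {j : ℕ} (hj : j ≤ m + 1) (k : K) :
    (asc (sphereStep s m) 0 (m + 1) * desc (sphereStep s m) 0 (m + 1)) (j, k) = (j, k) := by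
  rw [Function.End.mul_apply]
  rcases j with _ | j
  · have := asc_sphereStep_self s m (a := 0) (l := m + 1) k
    rw [desc_sphereStep_self, hs.asc_ringBraid, ht, inv_one, one_mul, this]
  · obtain ⟨l, rfl⟩ : ∃ l, m = j + l := ⟨m - j, by omega⟩
    rw [show j + l + 1 = j + 1 + l by omega, desc_add, asc_add, desc_succ, asc_succ]
    simp only [Function.End.mul_apply, zero_add]
    rw [desc_sphereStep_gt s _ _ (show 0 + j < j + 1 by omega) (by omega), sphereStep_succ,
      desc_sphereStep_lt s _ _ (show j < j + 1 by omega),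
      asc_sphereStep_lt s _ _ (show j < j + 1 by omega), sphereStep_self,
      asc_sphereStep_gt s _ _ (show 0 + j < j + 1 by omega) (by omega), ringBraid_eq s (by omega), desc_add]
    simp [mul_assoc]

end SphereAction

section LawrenceKrammer

variable {A : Type*} [CommRing A]

/-- The Lawrence–Krammer operator of the `k`-th braid generator (in its dual form), acting on
functions of pairs `i < j`. -/
def lkOp (q t : A) (k : ℕ) (f : ℕ → ℕ → A) (i j : ℕ) : A :=
  if i = k ∧ j = k + 1 then t * q ^ 2 * f k (k + 1)
  else if j = k then (1 - q) * f i k + q * f i (k + 1)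
  else if j = k + 1 then f i k + t * q * (q - 1) * f k (k + 1)
  else if i = k then f (k + 1) j + t * q * (q - 1) * f k (k + 1)
  else if i = k + 1 then q * f k j + (1 - q) * f (k + 1) j
  else if i < k ∧ k + 1 < j then f i j + t * (q - 1) ^ 2 * f k (k + 1)
  else f i j

variable (q t : A) (k : ℕ) (f : ℕ → ℕ → A) {i j : ℕ}

lemma lkOp_root : lkOp q t k f k (k + 1) = t * q ^ 2 * f k (k + 1) := by simp [lkOp]

lemma lkOp_right (_ : i < k) : lkOp q t k f i k = (1 - q) * f i k + q * f i (k + 1) := by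
  simp [lkOp]

lemma lkOp_right_succ (h : i < k) :
    lkOp q t k f i (k + 1) = f i k + t * q * (q - 1) * f k (k + 1) := by
  simp [lkOp, h.ne]

lemma lkOp_left (h : k + 1 < j) :
    lkOp q t k f k j = f (k + 1) j + t * q * (q - 1) * f k (k + 1) := by
  simp [lkOp, h.ne', show j ≠ k by omega]

lemma lkOp_left_succ (h : k + 1 < j) :
    lkOp q t k f (k + 1) j = q * f k j + (1 - q) * f (k + 1) j := by
  simp [lkOp, h.ne', show j ≠ k by omega]

lemma lkOp_nested (h : i < k) (h' : k + 1 < j) :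
    lkOp q t k f i j = f i j + t * (q - 1) ^ 2 * f k (k + 1) := by
  simp [lkOp, h, h', h.ne, h'.ne', show j ≠ k by omega, show i ≠ k + 1 by omega]

lemma lkOp_other (hij : i < j) (h : j < k ∨ k + 1 < i) : lkOp q t k f i j = f i j := by
  simp [lkOp, show j ≠ k by omega, show i ≠ k by omega, show j ≠ k + 1 by omega,
    show i ≠ k + 1 by omega, show ¬ (i < k ∧ k + 1 < j) by omega]

lemma lkOp_braid (hij : i < j) :
    lkOp q t k (lkOp q t (k + 1) (lkOp q t k f)) i j =
      lkOp q t (k + 1) (lkOp q t k (lkOp q t (k + 1) f)) i j := by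
  obtain hi | rfl | rfl | rfl | hi :
      i < k ∨ k = i ∨ i = k + 1 ∨ i = k + 1 + 1 ∨ k + 1 + 1 < i := by omega
  all_goals
    obtain hj | rfl | rfl | rfl | hj :
      j < k ∨ k = j ∨ j = k + 1 ∨ j = k + 1 + 1 ∨ k + 1 + 1 < j := by omega
  all_goals first
    | omega
    | (simp (discharger := omega) only [lkOp_root, lkOp_right, lkOp_right_succ, lkOp_left,
        lkOp_left_succ, lkOp_nested, lkOp_other]; try ring)

lemma lkOp_comm {k l : ℕ} (hkl : k + 2 ≤ l) (hij : i < j) :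
    lkOp q t k (lkOp q t l f) i j = lkOp q t l (lkOp q t k f) i j := by
  obtain hi | rfl | rfl | hi | rfl | rfl | hi :
      i < k ∨ k = i ∨ i = k + 1 ∨ (k + 1 < i ∧ i < l) ∨ l = i ∨ i = l + 1 ∨ l + 1 < i := by omega
  all_goals
    obtain hj | rfl | rfl | hj | rfl | rfl | hj :
      j < k ∨ k = j ∨ j = k + 1 ∨ (k + 1 < j ∧ j < l) ∨ l = j ∨ j = l + 1 ∨ l + 1 < j := by omega
  all_goals first
    | omega
    | (simp (discharger := omega) only [lkOp_root, lkOp_right, lkOp_right_succ, lkOp_left,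
        lkOp_left_succ, lkOp_nested, lkOp_other]; try ring)

lemma lkOp_cubic (hij : i < j) :
    lkOp q t k (lkOp q t k (lkOp q t k f)) i j =
      (t * q ^ 2 + 1 - q) * lkOp q t k (lkOp q t k f) i j
      + (q + t * q ^ 2 * (q - 1)) * lkOp q t k f i j - t * q ^ 3 * f i j := by
  obtain hi | rfl | rfl | hi : i < k ∨ k = i ∨ i = k + 1 ∨ k + 1 < i := by omega
  all_goals obtain hj | rfl | rfl | hj : j < k ∨ k = j ∨ j = k + 1 ∨ k + 1 < j := by omega
  all_goals first
    | omega
    | (simp (discharger := omega) only [lkOp_root, lkOp_right, lkOp_right_succ, lkOp_left,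
        lkOp_left_succ, lkOp_nested, lkOp_other]; try ring)

lemma lkOp_quadratic (hij : i < j) (hf : f k (k + 1) = 0) :
    lkOp q t k (lkOp q t k f) i j = (1 - q) * lkOp q t k f i j + q * f i j := by
  obtain hi | rfl | rfl | hi : i < k ∨ k = i ∨ i = k + 1 ∨ k + 1 < i := by omega
  all_goals obtain hj | rfl | rfl | hj : j < k ∨ k = j ∨ j = k + 1 ∨ k + 1 < j := by omega
  all_goals first
    | omega
    | (simp (discharger := omega) only [lkOp_root, lkOp_right, lkOp_right_succ, lkOp_left,
        lkOp_left_succ, lkOp_nested, lkOp_other, hf]; try ring)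

lemma lkOp_add (g : ℕ → ℕ → A) :
    lkOp q t k (f + g) = lkOp q t k f + lkOp q t k g := by
  funext i j
  simp only [lkOp, Pi.add_apply]
  split_ifs <;> ring

lemma lkOp_smul (c : A) : lkOp q t k (c • f) = c • lkOp q t k f := by
  funext i j
  simp only [lkOp, Pi.smul_apply, smul_eq_mul]
  split_ifs <;> ring

variable {q t k f}

lemma lkOp_congr {p : ℕ} {g : ℕ → ℕ → A} (hk : k + 1 < p)
    (h : ∀ i j, i < j → j < p → f i j = g i j) (hij : i < j) (hj : j < p) :
    lkOp q t k f i j = lkOp q t k g i j := by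
  have h0 := h k (k + 1) (by omega) hk
  simp only [lkOp]
  split_ifs <;> (try simp only [h0])
  · rw [h i k (by omega) (by omega), h i (k + 1) (by omega) (by omega)]
  · rw [h i k (by omega) (by omega)]
  · rw [h _ j (by omega) (by omega)]
  · rw [h _ j (by omega) (by omega), h _ j (by omega) (by omega)]
  · rw [h _ j (by omega) (by omega)]
  · rw [h _ j (by omega) (by omega)]

lemma map_lkOp {A' : Type*} [CommRing A'] (φ : A →+* A') :
    φ (lkOp q t k f i j) = lkOp (φ q) (φ t) k (fun i j => φ (f i j)) i j := by
  simp only [lkOp]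
  split_ifs <;> simp

/-- Pairs `i < j < p`, with `j` first. -/
abbrev Pairs (p : ℕ) : Type := Σ j : Fin p, Fin j

/-- The value of `f` at the pair `i < j`, extended by zero. -/
def pairValue {p : ℕ} (f : Pairs p → A) (i j : ℕ) : A :=
  if h : j < p ∧ i < j then f ⟨⟨j, h.1⟩, ⟨i, h.2⟩⟩ else 0

lemma pairValue_eq {p : ℕ} (f : Pairs p → A) {i j : ℕ} (hij : i < j) (hj : j < p) :
    pairValue f i j = f ⟨⟨j, hj⟩, ⟨i, hij⟩⟩ := by
  simp [pairValue, hij, hj]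

lemma pairValue_add {p : ℕ} (f g : Pairs p → A) :
    pairValue (f + g) = pairValue f + pairValue g := by
  funext i j
  simp only [pairValue, Pi.add_apply]
  split_ifs <;> simp

lemma pairValue_smul {p : ℕ} (c : A) (f : Pairs p → A) :
    pairValue (c • f) = c • pairValue f := by
  funext i j
  simp only [pairValue, Pi.smul_apply]
  split_ifs <;> simp

lemma pairs_ext {p : ℕ} {f g : Pairs p → A}
    (h : ∀ i j, i < j → j < p → pairValue f i j = pairValue g i j) : f = g := by
  funext ⟨⟨j, hj⟩, ⟨i, hi⟩⟩
  have := h i j hi hj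
  rwa [pairValue_eq f hi hj, pairValue_eq g hi hj] at this

variable (q t) in
/-- The Lawrence–Krammer operator on the free module on pairs `i < j < p`. -/
def lkLin (p k : ℕ) : Module.End A (Pairs p → A) where
  toFun f x := lkOp q t k (pairValue f) x.2 x.1
  map_add' f g := by
    funext x
    rw [pairValue_add, lkOp_add]; rfl
  map_smul' c f := by
    funext x
    rw [pairValue_smul, lkOp_smul]; rfl

lemma pairValue_lkLin {p : ℕ} (f : Pairs p → A) (hij : i < j) (hj : j < p) :
    pairValue (lkLin q t p k f) i j = lkOp q t k (pairValue f) i j := by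
  rw [pairValue_eq _ hij hj]; rfl

lemma pairValue_lkLin_lkLin {p k l : ℕ} (f : Pairs p → A) (hk : k + 1 < p) (hij : i < j)
    (hj : j < p) :
    pairValue (lkLin q t p k (lkLin q t p l f)) i j =
      lkOp q t k (lkOp q t l (pairValue f)) i j := by
  rw [pairValue_lkLin _ hij hj, lkOp_congr hk (fun i j hij hj => pairValue_lkLin f hij hj) hij hj]

lemma pairValue_lkLin_lkLin_lkLin {p k l n : ℕ} (f : Pairs p → A) (hk : k + 1 < p)
    (hl : l + 1 < p) (hij : i < j) (hj : j < p) :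
    pairValue (lkLin q t p k (lkLin q t p l (lkLin q t p n f))) i j =
      lkOp q t k (lkOp q t l (lkOp q t n (pairValue f))) i j := by
  rw [pairValue_lkLin _ hij hj,
    lkOp_congr hk (fun i j hij hj => pairValue_lkLin_lkLin f hl hij hj) hij hj]

variable (q t) in
lemma isBraid_lkLin (m : ℕ) : IsBraid (lkLin q t (m + 1)) m where
  braid k hk := by
    refine LinearMap.ext fun f => pairs_ext fun i j hij hj => ?_
    simp only [Module.End.mul_apply]
    rw [pairValue_lkLin_lkLin_lkLin _ (by omega) (by omega) hij hj,
      pairValue_lkLin_lkLin_lkLin _ (by omega) (by omega) hij hj, lkOp_braid _ _ _ _ hij]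
  comm k l hkl hl := by
    refine LinearMap.ext fun f => pairs_ext fun i j hij hj => ?_
    simp only [Module.End.mul_apply]
    rw [pairValue_lkLin_lkLin _ (by omega) hij hj, pairValue_lkLin_lkLin _ (by omega) hij hj,
      lkOp_comm _ _ _ hkl hij]

lemma isUnit_lkLin {p : ℕ} (hq : IsUnit q) (ht : IsUnit t) (hk : k + 1 < p) :
    IsUnit (lkLin q t p k) := by
  set S := lkLin q t p k
  obtain ⟨c, hc⟩ := isUnit_iff_exists_inv'.1 (ht.mul (hq.pow 3))
  have h : S * (S * S) = (t * q ^ 2 + 1 - q) • (S * S) + (q + t * q ^ 2 * (q - 1)) • S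
      - (t * q ^ 3) • 1 := by
    refine LinearMap.ext fun f => pairs_ext fun i j hij hj => ?_
    have e1 := pairValue_lkLin_lkLin_lkLin (q := q) (t := t) (n := k) f hk hk hij hj
    have e2 := pairValue_lkLin_lkLin (q := q) (t := t) (l := k) f hk hij hj
    have e3 := pairValue_lkLin (q := q) (t := t) (k := k) f hij hj
    rw [lkOp_cubic _ _ _ _ hij, ← e2, ← e3] at e1
    change pairValue (S (S (S f))) i j = _ at e1
    simp only [Module.End.mul_apply, LinearMap.add_apply, LinearMap.sub_apply,
      LinearMap.smul_apply, Module.End.one_apply, sub_eq_add_neg _ ((t * q ^ 3) • f),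
      ← neg_smul, pairValue_add,
      pairValue_smul, Pi.add_apply, Pi.smul_apply, smul_eq_mul]
    rw [e1]
    change _ * pairValue (S (S f)) i j + _ * pairValue (S f) i j - _ = _
    ring
  have h1 : c • ((t * q ^ 2 + 1 - q) • (S * S) + (q + t * q ^ 2 * (q - 1)) • S
      - S * (S * S)) = 1 := by
    rw [h, sub_sub_cancel, smul_smul, hc, one_smul]
  refine ⟨⟨S, c • ((t * q ^ 2 + 1 - q) • S + (q + t * q ^ 2 * (q - 1)) • 1 - S * S), ?_, ?_⟩, rfl⟩
  · exact Eq.trans (by simp only [mul_smul_comm, mul_add, mul_sub, mul_one]) h1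
  · exact Eq.trans (by simp only [smul_mul_assoc, add_mul, sub_mul, one_mul, mul_assoc]) h1

end LawrenceKrammer

section BraidGroup

/-- Relators of the braid group with `r` generators; the generators of index at least `r` are
trivial. -/
def braidRels (r : ℕ) : Set (FreeGroup ℕ) :=
  {x | ∃ i, i + 1 < r ∧ x = FreeGroup.of i * FreeGroup.of (i + 1) * FreeGroup.of i *
    (FreeGroup.of (i + 1) * FreeGroup.of i * FreeGroup.of (i + 1))⁻¹} ∪
  {x | ∃ i j, i + 2 ≤ j ∧ j < r ∧
    x = FreeGroup.of i * FreeGroup.of j * (FreeGroup.of j * FreeGroup.of i)⁻¹} ∪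
  {x | ∃ i, r ≤ i ∧ x = FreeGroup.of i}

/-- The braid group with `r` generators, that is on `r + 1` strands. -/
abbrev BraidGroup (r : ℕ) : Type := PresentedGroup (braidRels r)

/-- The standard generators of the braid group. -/
def braidGen (r i : ℕ) : BraidGroup r := PresentedGroup.of i

lemma braidGen_of_le {r i : ℕ} (h : r ≤ i) : braidGen r i = 1 :=
  PresentedGroup.one_of_mem (rels := braidRels r) (Or.inr ⟨i, h, rfl⟩)

lemma isBraid_braidGen (r : ℕ) : IsBraid (braidGen r) r where
  braid i hi := by
    have := PresentedGroup.one_of_mem (rels := braidRels r) (Or.inl (Or.inl ⟨i, hi, rfl⟩))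
    rw [map_mul, map_inv, mul_inv_eq_one] at this
    simp only [map_mul] at this
    exact this
  comm i j hij hj := by
    have := PresentedGroup.one_of_mem (rels := braidRels r) (Or.inl (Or.inr ⟨i, j, hij, hj, rfl⟩))
    rw [map_mul, map_inv, mul_inv_eq_one] at this
    simp only [map_mul] at this
    exact this

variable {G : Type*} [Group G] {s : ℕ → G} {r : ℕ}

/-- The homomorphism out of the braid group defined by a family satisfying the braid relations. -/
def IsBraid.lift (hs : IsBraid s r) : BraidGroup r →* G :=
  PresentedGroup.toGroup (f := fun i => if i < r then s i else 1) (by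
    rintro _ ((⟨i, hi, rfl⟩ | ⟨i, j, hij, hj, rfl⟩) | ⟨i, hi, rfl⟩)
    · rw [map_mul, map_inv, mul_inv_eq_one]
      simpa [hi, show i < r by omega] using hs.braid i hi
    · rw [map_mul, map_inv, mul_inv_eq_one]
      simpa [hj, show i < r by omega] using hs.comm i j hij hj
    · simp [hi])

lemma IsBraid.lift_braidGen (hs : IsBraid s r) {i : ℕ} (hi : i < r) :
    hs.lift (braidGen r i) = s i := by
  simp [IsBraid.lift, braidGen, PresentedGroup.toGroup.of, hi]

/-- The full twist, a central element of the braid group. -/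
def fullTwist (r : ℕ) : BraidGroup r := asc (braidGen r) 0 r ^ (r + 1)

lemma BraidGroup.induction_on {P : BraidGroup r → Prop} (x : BraidGroup r) (one : P 1)
    (mul : ∀ x y, P x → P y → P (x * y)) (gen : ∀ i < r, P (braidGen r i))
    (inv : ∀ i < r, P (braidGen r i)⁻¹) : P x := by
  have hP : ∀ z : FreeGroup ℕ, P (PresentedGroup.mk (braidRels r) z) := by
    intro z
    refine FreeGroup.induction_on (C := fun z => P (PresentedGroup.mk (braidRels r) z)) z ?_ ?_ ?_ ?_
    · rw [map_one]; exact one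
    · intro i
      change P (braidGen r i)
      rcases Nat.lt_or_ge i r with hi | hi
      · exact gen i hi
      · rwa [braidGen_of_le hi]
    · intro i _
      rw [map_inv]
      change P (braidGen r i)⁻¹
      rcases Nat.lt_or_ge i r with hi | hi
      · exact inv i hi
      · rwa [braidGen_of_le hi, inv_one]
    · intro x y hx hy
      rw [map_mul]
      exact mul _ _ hx hy
  obtain ⟨z, rfl⟩ := PresentedGroup.mk_surjective (braidRels r) x
  exact hP z

lemma commute_fullTwist (x : BraidGroup r) : Commute x (fullTwist r) := by
  have h : ∀ i < r, Commute (braidGen r i) (fullTwist r) := fun i hi =>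
    (isBraid_braidGen r).commute_twist (by omega) (by omega) (by omega)
  induction x using BraidGroup.induction_on with
  | one => exact Commute.one_left _
  | mul x y hx hy => exact hx.mul_left hy
  | gen i hi => exact h i hi
  | inv i hi => exact (h i hi).inv_left

lemma exists_word_of_mem_closure {M : Type*} [Monoid M] {s : ℕ → M} {r : ℕ} {x : M}
    (hx : x ∈ Submonoid.closure (s '' Set.Iio r)) :
    ∃ w : List ℕ, (∀ i ∈ w, i < r) ∧ (w.map s).prod = x := by
  induction hx using Submonoid.closure_induction with
  | mem x hx =>
    obtain ⟨i, hi, rfl⟩ := hx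
    exact ⟨[i], by simpa using hi, by simp⟩
  | one => exact ⟨[], by simp, by simp⟩
  | mul x y _ _ hx hy =>
    obtain ⟨v, hv, rfl⟩ := hx
    obtain ⟨w, hw, rfl⟩ := hy
    refine ⟨v ++ w, fun i hi => ?_, by simp⟩
    rcases List.mem_append.1 hi with h | h
    · exact hv i h
    · exact hw i h

lemma exists_fullTwist_pow_mul_mem (x : BraidGroup r) :
    ∃ k : ℕ, fullTwist r ^ k * x ∈ Submonoid.closure (braidGen r '' Set.Iio r) := by
  induction x using BraidGroup.induction_on with
  | one => exact ⟨0, by simp [one_mem]⟩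
  | mul x y hx hy =>
    obtain ⟨k, hk⟩ := hx
    obtain ⟨l, hl⟩ := hy
    refine ⟨k + l, ?_⟩
    have := mul_mem hk hl
    rwa [mul_assoc, ← mul_assoc x, ((commute_fullTwist x).pow_right l).eq, mul_assoc, ← mul_assoc,
      ← pow_add] at this
  | gen i hi =>
    refine ⟨0, ?_⟩
    rw [pow_zero, one_mul]
    exact Submonoid.subset_closure ⟨i, hi, rfl⟩
  | inv i hi =>
    obtain ⟨w, hw, h⟩ := (isBraid_braidGen r).exists_mul_eq_twist (a := 0) (l := r) (j := i)
      (by omega) (by omega) (by omega)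
    refine ⟨1, ?_⟩
    rw [pow_one, ((commute_fullTwist _).symm).eq, fullTwist, ← h, inv_mul_cancel_left]
    exact hw

lemma fullTwist_pow_mem (k : ℕ) :
    fullTwist r ^ k ∈ Submonoid.closure (braidGen r '' Set.Iio r) :=
  pow_mem (pow_mem (asc_mem_closure fun _ _ h => by simpa using h) _) _

end BraidGroup

section Faithful

/-- Two words are equivalent if they take the same value on all families satisfying the braid
relations. -/
def BraidEquiv (r : ℕ) (w w' : List ℕ) : Prop :=
  ∀ (M : Type) [Monoid M] (s : ℕ → M), IsBraid s r → (w.map s).prod = (w'.map s).prod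

lemma BraidEquiv.cons {r : ℕ} {w w' : List ℕ} (h : BraidEquiv r w w') (k : ℕ) :
    BraidEquiv r (k :: w) (k :: w') := fun M _ s hs => by
  simp only [List.map_cons, List.prod_cons, h M s hs]

lemma BraidEquiv.trans {r : ℕ} {w w' w'' : List ℕ} (h : BraidEquiv r w w')
    (h' : BraidEquiv r w' w'') : BraidEquiv r w w'' := fun M _ s hs =>
  (h M s hs).trans (h' M s hs)

lemma pairValue_word {A : Type*} [CommRing A] (q t : A) {r : ℕ} {w : List ℕ}
    (hw : ∀ k ∈ w, k < r) {i j : ℕ} (hij : i < j) (hj : j < r + 1) :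
    pairValue ((w.map (lkLin q t (r + 1))).prod (fun _ => 1)) i j =
      w.foldr (lkOp q t) (fun _ _ => 1) i j := by
  induction w generalizing i j with
  | nil => simp [pairValue_eq _ hij hj]
  | cons k w ih =>
    simp only [List.mem_cons, forall_eq_or_imp] at hw
    simp only [List.map_cons, List.prod_cons, Module.End.mul_apply, List.foldr_cons]
    rw [pairValue_lkLin _ hij hj]
    exact lkOp_congr (by omega) (fun i j hij hj => ih hw.2 hij hj) hij hj

lemma map_foldr_lkOp {A A' : Type*} [CommRing A] [CommRing A'] (φ : A →+* A') (q t : A)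
    (w : List ℕ) (i j : ℕ) :
    φ (w.foldr (lkOp q t) (fun _ _ => 1) i j) =
      w.foldr (lkOp (φ q) (φ t)) (fun _ _ => 1) i j := by
  induction w generalizing i j with
  | nil => simp
  | cons k w ih => simp only [List.foldr_cons, map_lkOp, ih]

/-- The vector obtained by applying a word to the constant vector, specialized at `q = 1 / 2` and
`t = 0`. -/
def lkWord (w : List ℕ) : ℕ → ℕ → ℚ := w.foldr (lkOp (1 / 2) 0) (fun _ _ => 1)

lemma lkWord_cons (k : ℕ) (w : List ℕ) : lkWord (k :: w) = lkOp (1 / 2) 0 k (lkWord w) := rfl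

lemma lkWord_nonneg (w : List ℕ) (i j : ℕ) : 0 ≤ lkWord w i j := by
  induction w generalizing i j with
  | nil => simp [lkWord]
  | cons k w ih =>
    rw [lkWord_cons, lkOp]
    have h := ih
    split_ifs <;> norm_num
    all_goals first
      | exact h _ _
      | (have h1 := h i k; have h2 := h i (k + 1); linarith)
      | (have h1 := h k j; have h2 := h (k + 1) j; linarith)

lemma BraidEquiv.lkWord_eq {r : ℕ} {w w' : List ℕ} (h : BraidEquiv r w w')
    (hw : ∀ k ∈ w, k < r) (hw' : ∀ k ∈ w', k < r) {i j : ℕ} (hij : i < j) (hj : j < r + 1) :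
    lkWord w i j = lkWord w' i j := by
  rw [lkWord, lkWord, ← pairValue_word _ _ hw hij hj, ← pairValue_word _ _ hw' hij hj,
    h _ _ (isBraid_lkLin _ _ r)]

lemma exists_braidEquiv_cons {r : ℕ} (n : ℕ) :
    ∀ (w : List ℕ) (k : ℕ), w.length = n → (∀ i ∈ w, i < r) → k < r → lkWord w k (k + 1) = 0 →
      ∃ w' : List ℕ, w'.length + 1 = n ∧ (∀ i ∈ w', i < r) ∧ BraidEquiv r w (k :: w') := by
  induction n using Nat.strong_induction_on with
  | _ n ih =>
  intro w k hn hw hk h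
  rcases w with _ | ⟨j, v⟩
  · simp [lkWord] at h
  simp only [List.mem_cons, forall_eq_or_imp] at hw
  obtain ⟨hjr, hv⟩ := hw
  rw [List.length_cons] at hn
  rw [lkWord_cons] at h
  have h0 := lkWord_nonneg v
  obtain rfl | hfar | rfl | rfl :
      j = k ∨ (k + 1 < j ∨ j + 1 < k) ∨ j = k + 1 ∨ k = j + 1 := by omega
  · exact ⟨v, hn, hv, fun M _ s _ => rfl⟩
  · rw [lkOp_other _ _ _ _ (by omega) hfar] at h
    obtain ⟨v', hl, hv', e⟩ := ih v.length (by omega) v k rfl hv hk h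
    refine ⟨j :: v', by simp; omega, by simpa [hjr] using hv', (e.cons j).trans ?_⟩
    intro M _ s hs
    simp only [List.map_cons, List.prod_cons, ← mul_assoc]
    rw [(hs.commute hjr hk (by omega)).eq]
  · rw [lkOp_right _ _ _ _ (by omega)] at h
    have h1 := h0 k (k + 1)
    have h2 := h0 k (k + 1 + 1)
    obtain ⟨v', hl, hv', e⟩ := ih v.length (by omega) v k rfl hv hk (by linarith)
    have h3 : lkWord v k (k + 1 + 1) = 0 := by linarith
    rw [e.lkWord_eq hv (by simpa [hk] using hv') (by omega) (by omega), lkWord_cons,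
      lkOp_left _ _ _ _ (by omega)] at h3
    obtain ⟨v'', hl', hv'', e'⟩ := ih v'.length (by omega) v' (k + 1) rfl hv' hjr
      (by linarith)
    refine ⟨(k + 1) :: k :: v'', by simp; omega, by simpa [hk, hjr] using hv'',
      ((e.trans (e'.cons k)).cons (k + 1)).trans ?_⟩
    intro M _ s hs
    simp only [List.map_cons, List.prod_cons, ← mul_assoc]
    rw [hs.braid k hjr]
  · rw [lkOp_left_succ _ _ _ _ (by omega)] at h
    have h1 := h0 j (j + 1 + 1)
    have h2 := h0 (j + 1) (j + 1 + 1)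
    obtain ⟨v', hl, hv', e⟩ := ih v.length (by omega) v (j + 1) rfl hv hk (by linarith)
    have h3 : lkWord v j (j + 1 + 1) = 0 := by linarith
    rw [e.lkWord_eq hv (by simpa [hk] using hv') (by omega) (by omega), lkWord_cons,
      lkOp_right_succ _ _ _ _ (by omega)] at h3
    obtain ⟨v'', hl', hv'', e'⟩ := ih v'.length (by omega) v' j rfl hv' hjr
      (by linarith)
    refine ⟨j :: (j + 1) :: v'', by simp; omega, by simpa [hk, hjr] using hv'',
      ((e.trans (e'.cons (j + 1))).cons j).trans ?_⟩
    intro M _ s hs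
    simp only [List.map_cons, List.prod_cons, ← mul_assoc]
    rw [hs.braid j hk]

/-- Parameters of the Lawrence–Krammer representation that specialize to `q = 1 / 2`, `t = 0`
on a subring. -/
structure IsLKParam {R : Type} [CommRing R] (q t : R) : Prop where
  isUnit_q : IsUnit q
  isUnit_t : IsUnit t
  spec : ∃ (O : Type) (_ : CommRing O) (φ : O →+* R) (ψ : O →+* ℚ) (q₀ t₀ : O),
    Function.Injective φ ∧ φ q₀ = q ∧ φ t₀ = t ∧ ψ q₀ = 1 / 2 ∧ ψ t₀ = 0

variable {R : Type} [CommRing R] {q t : R}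

lemma lkWord_eq_zero_of_lkLin_eq (hqt : IsLKParam q t) {r : ℕ} {w w' : List ℕ} (hw : ∀ k ∈ w, k < r)
    (hw' : ∀ k ∈ w', k < r) {c : R} (hc : c = 1 ∨ c = -1)
    (h : (w.map (lkLin q t (r + 1))).prod = c • (w'.map (lkLin q t (r + 1))).prod)
    {i j : ℕ} (hij : i < j) (hj : j < r + 1) (h0 : lkWord w i j = 0) : lkWord w' i j = 0 := by
  obtain ⟨O, _, φ, ψ, q₀, t₀, hinj, hφq, hφt, hq, ht⟩ := hqt.spec
  have e := congrArg (fun S => pairValue (S (fun _ => 1)) i j) h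
  simp only [LinearMap.smul_apply, pairValue_smul, Pi.smul_apply, smul_eq_mul] at e
  rw [pairValue_word _ _ hw hij hj, pairValue_word _ _ hw' hij hj, ← hφq, ← hφt,
    ← map_foldr_lkOp, ← map_foldr_lkOp] at e
  have h' : ∀ w : List ℕ, lkWord w i j = ψ (w.foldr (lkOp q₀ t₀) (fun _ _ => 1) i j) := by
    intro w
    rw [map_foldr_lkOp, hq, ht, lkWord]
  rw [h'] at h0 ⊢
  rcases hc with rfl | rfl
  · rw [one_mul] at e
    rwa [← hinj e]
  · rw [neg_one_mul, ← map_neg] at e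
    rwa [hinj e, map_neg, neg_eq_zero] at h0

lemma braidEquiv_of_lkLin_eq (hqt : IsLKParam q t) {r : ℕ} (w : List ℕ) :
    ∀ (w' : List ℕ) (c : R), (∀ k ∈ w, k < r) → (∀ k ∈ w', k < r) → (c = 1 ∨ c = -1) →
    (w.map (lkLin q t (r + 1))).prod = c • (w'.map (lkLin q t (r + 1))).prod →
    BraidEquiv r w w' := by
  induction w with
  | nil =>
    intro w' c hw hw' hc h
    rcases w' with _ | ⟨k, v⟩
    · exact fun M _ s _ => rfl
    · have hk := hw' k (by simp)
      have h' : ((k :: v).map (lkLin q t (r + 1))).prod =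
          c • (([] : List ℕ).map (lkLin q t (r + 1))).prod := by
        rw [h, smul_smul]
        rcases hc with rfl | rfl <;> simp
      have := lkWord_eq_zero_of_lkLin_eq hqt hw' hw hc h' (show k < k + 1 by omega) (by omega)
        (by rw [lkWord_cons, lkOp_root]; simp)
      simp [lkWord] at this
  | cons k v ih =>
    intro w' c hw hw' hc h
    have hk := hw k (by simp)
    have hv : ∀ i ∈ v, i < r := fun i hi => hw i (by simp [hi])
    have := lkWord_eq_zero_of_lkLin_eq hqt hw hw' hc h (show k < k + 1 by omega) (by omega)
        (by rw [lkWord_cons, lkOp_root]; simp)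
    obtain ⟨v', -, hv', e⟩ := exists_braidEquiv_cons _ w' k rfl hw' hk this
    have hS := isUnit_lkLin hqt.isUnit_q hqt.isUnit_t (show k + 1 < r + 1 by omega)
    rw [e _ _ (isBraid_lkLin _ _ r), List.map_cons, List.prod_cons, List.map_cons, List.prod_cons,
      ← mul_smul_comm, hS.mul_right_inj] at h
    have e' := (ih v' c hv hv' hc h).cons k
    exact fun M _ s hs => (e' M s hs).trans (e M s hs).symm

open Classical in
/-- The Lawrence–Krammer representation. -/
noncomputable def lkRep (hqt : IsLKParam q t) (r : ℕ) :
    BraidGroup r →* (Module.End R (Pairs (r + 1) → R))ˣ :=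
  IsBraid.lift (s := fun k => if h : IsUnit (lkLin q t (r + 1) k) then h.unit else 1) (r := r) (by
    have hu : ∀ k < r, IsUnit (lkLin q t (r + 1) k) := fun k hk =>
      isUnit_lkLin hqt.isUnit_q hqt.isUnit_t (by omega)
    have hb := isBraid_lkLin q t r
    refine ⟨fun i hi => Units.ext ?_, fun i j hij hj => Units.ext ?_⟩
    · simpa [hu i (by omega), hu _ hi] using hb.braid i hi
    · simpa [hu i (by omega), hu _ hj] using hb.comm i j hij hj)

lemma lkRep_braidGen (hqt : IsLKParam q t) {r k : ℕ} (hk : k < r) :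
    (lkRep hqt r (braidGen r k) : Module.End R (Pairs (r + 1) → R)) =
      lkLin q t (r + 1) k := by
  have hu : IsUnit (lkLin q t (r + 1) k) := isUnit_lkLin hqt.isUnit_q hqt.isUnit_t (by omega)
  rw [lkRep, IsBraid.lift_braidGen _ hk]
  simp [hu]

lemma lkRep_word (hqt : IsLKParam q t) {r : ℕ} {w : List ℕ} (hw : ∀ k ∈ w, k < r) :
    (lkRep hqt r (w.map (braidGen r)).prod : Module.End R (Pairs (r + 1) → R)) =
      (w.map (lkLin q t (r + 1))).prod := by
  induction w with
  | nil => simp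
  | cons k w ih =>
    simp only [List.mem_cons, forall_eq_or_imp] at hw
    simp [lkRep_braidGen hqt hw.1, ih hw.2]

lemma eq_one_of_lkRep (hqt : IsLKParam q t) {r : ℕ} {x : BraidGroup r} {c : R} (hc : c = 1 ∨ c = -1)
    (h : (lkRep hqt r x : Module.End R (Pairs (r + 1) → R)) = c • 1) : x = 1 := by
  obtain ⟨k, hk⟩ := exists_fullTwist_pow_mul_mem x
  obtain ⟨w, hw, e⟩ := exists_word_of_mem_closure hk
  obtain ⟨w', hw', e'⟩ := exists_word_of_mem_closure (fullTwist_pow_mem (r := r) k)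
  have : BraidEquiv r w w' := by
    refine braidEquiv_of_lkLin_eq hqt w w' c hw hw' hc ?_
    rw [← lkRep_word hqt hw, ← lkRep_word hqt hw', e, e', map_mul, Units.val_mul, h, mul_smul_comm, mul_one]
  have := this _ _ (isBraid_braidGen r)
  rwa [e, e', mul_eq_left] at this

end Faithful

section Scalar

variable {R : Type} [CommRing R] {q t : R}

lemma IsLKParam.sub_one_ne_zero (hqt : IsLKParam q t) : t * q ^ 2 - 1 ≠ 0 := by
  obtain ⟨O, _, φ, ψ, q₀, t₀, hinj, rfl, rfl, hq, ht⟩ := hqt.spec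
  intro h
  have h' : φ (t₀ * q₀ ^ 2 - 1) = φ 0 := by simpa using h
  have := congrArg ψ (hinj h')
  simp [ht] at this

lemma IsLKParam.add_ne_zero (hqt : IsLKParam q t) : t * q ^ 2 + q ≠ 0 := by
  obtain ⟨O, _, φ, ψ, q₀, t₀, hinj, rfl, rfl, hq, ht⟩ := hqt.spec
  intro h
  have h' : φ (t₀ * q₀ ^ 2 + q₀) = φ 0 := by simpa using h
  have := congrArg ψ (hinj h')
  simp [ht, hq] at this

/-- The Lawrence–Krammer operators have only scalar intertwiners. -/
lemma exists_scalar_of_commute [IsDomain R] (hqt : IsLKParam q t) {r : ℕ}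
    {S : Module.End R (Pairs (r + 1) → R)} (hS : ∀ k < r, Commute S (lkLin q t (r + 1) k)) :
    ∃ c : R, S = c • 1 := by
  have hcomm : ∀ k < r, ∀ f, S (lkLin q t (r + 1) k f) = lkLin q t (r + 1) k (S f) :=
    fun k hk f => LinearMap.congr_fun (hS k hk).eq f
  have hvanish : ∀ k < r, ∀ f, pairValue f k (k + 1) = 0 → pairValue (S f) k (k + 1) = 0 := by
    intro k hk f hf
    have h1 : lkLin q t (r + 1) k (lkLin q t (r + 1) k f) =
        (1 - q) • lkLin q t (r + 1) k f + q • f := by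
      refine pairs_ext fun i j hij hj => ?_
      rw [pairValue_lkLin_lkLin _ (by omega) hij hj, lkOp_quadratic _ _ _ _ hij hf, pairValue_add,
        pairValue_smul, pairValue_smul]
      simp [pairValue_lkLin _ hij hj]
    have h2 := congrArg (fun f => pairValue (S f) k (k + 1)) h1
    simp only [map_add, map_smul, hcomm k hk, pairValue_add, pairValue_smul, Pi.add_apply,
      Pi.smul_apply, smul_eq_mul] at h2
    rw [pairValue_lkLin_lkLin _ (by omega) (by omega) (by omega),
      pairValue_lkLin _ (by omega) (by omega), lkOp_root, lkOp_root] at h2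
    have h3 : (t * q ^ 2 - 1) * (t * q ^ 2 + q) * pairValue (S f) k (k + 1) = 0 := by
      linear_combination h2
    exact (mul_eq_zero.1 h3).resolve_left (mul_ne_zero hqt.sub_one_ne_zero hqt.add_ne_zero)
  set e : Pairs (r + 1) → R := fun _ => 1 with he
  have hone : ∀ k < r, pairValue e k (k + 1) = 1 := fun k hk => by
    rw [pairValue_eq _ (by omega) (by omega)]
  have hroot : ∀ k < r, ∀ f, pairValue (S f) k (k + 1) =
      pairValue (S e) k (k + 1) * pairValue f k (k + 1) := by
    intro k hk f
    have := hvanish k hk (f + (-pairValue f k (k + 1)) • e) (by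
      rw [pairValue_add, pairValue_smul]; simp [hone k hk])
    rw [map_add, map_smul, pairValue_add, pairValue_smul] at this
    simp only [Pi.add_apply, Pi.smul_apply, smul_eq_mul] at this
    linear_combination this
  have hstep : ∀ k, k + 1 < r → pairValue (S e) (k + 1) (k + 1 + 1) = pairValue (S e) k (k + 1) := by
    intro k hk
    have h1 : ∀ f, pairValue (lkLin q t (r + 1) (k + 1) (lkLin q t (r + 1) k f)) k (k + 1) =
        q * pairValue f (k + 1) (k + 1 + 1) := by
      intro f
      rw [pairValue_lkLin_lkLin _ (by omega) (by omega) (by omega), lkOp_right _ _ _ _ (by omega),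
        lkOp_root, lkOp_left _ _ _ _ (by omega)]
      ring
    have h2 := hroot k (by omega) (lkLin q t (r + 1) (k + 1) (lkLin q t (r + 1) k e))
    rw [hcomm _ hk, hcomm k (by omega), h1, h1, hone _ hk] at h2
    refine hqt.isUnit_q.mul_left_cancel ?_
    linear_combination h2
  have hconst : ∀ k < r, pairValue (S e) k (k + 1) = pairValue (S e) 0 1 := by
    intro k hk
    induction k with
    | zero => rfl
    | succ k ih => rw [hstep k hk, ih (by omega)]
  refine ⟨pairValue (S e) 0 1, LinearMap.ext fun f => pairs_ext fun i j hij hj => ?_⟩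
  obtain ⟨d, rfl⟩ : ∃ d, j = i + 1 + d := ⟨j - (i + 1), by omega⟩
  have hmain : ∀ d, i + 1 + d < r + 1 → ∀ f, pairValue (S f) i (i + 1 + d) =
      pairValue (S e) 0 1 * pairValue f i (i + 1 + d) := by
    intro d
    induction d with
    | zero => intro hd f; rw [add_zero, hroot i (by omega), hconst i (by omega)]
    | succ d ih =>
      intro hd f
      have h1 : ∀ f, pairValue (lkLin q t (r + 1) (i + 1 + d) f) i (i + 1 + d) =
          (1 - q) * pairValue f i (i + 1 + d) + q * pairValue f i (i + 1 + (d + 1)) := by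
        intro f
        rw [pairValue_lkLin _ (by omega) (by omega), lkOp_right _ _ _ _ (by omega), add_assoc _ d]
      have h2 := h1 (S f)
      rw [← hcomm _ (by omega), ih (by omega), ih (by omega), h1] at h2
      refine hqt.isUnit_q.mul_left_cancel ?_
      linear_combination -h2
  rw [hmain d hj, LinearMap.smul_apply, pairValue_smul]
  rfl

end Scalar

section CyclicTwist

open Fin.NatCast Fin.CommRing

variable {R V : Type*} [CommRing R] [AddCommGroup V] [Module R V] {n : ℕ}

/-- Scalars as invertible endomorphisms. -/
def scalarUnit (R V : Type*) [CommRing R] [AddCommGroup V] [Module R V] :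
    Rˣ →* (Module.End R V)ˣ :=
  Units.map (algebraMap R (Module.End R V) : R →* Module.End R V)

lemma scalarUnit_apply (u : Rˣ) (v : V) : (scalarUnit R V u : Module.End R V) v = (u : R) • v :=
  Module.algebraMap_end_apply ..

/-- The diagonal action of endomorphisms on families. -/
def diagEnd (R V : Type*) [CommRing R] [AddCommGroup V] [Module R V] (ι : Type*) :
    Module.End R V →* Module.End R (ι → V) where
  toFun S := S.compLeft ι
  map_one' := rfl
  map_mul' _ _ := rfl

lemma diagEnd_apply {ι : Type*} (S : Module.End R V) (w : ι → V) (i : ι) :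
    diagEnd R V ι S w i = S (w i) := rfl

lemma diagEnd_single {ι : Type*} [DecidableEq ι] (S : Module.End R V) (i : ι) (v : V) :
    diagEnd R V ι S (Pi.single i v) = Pi.single i (S v) := by
  funext j
  rw [diagEnd_apply]
  exact (Pi.apply_single (fun _ => S) (fun _ => map_zero S) i v j)

/-- The cyclic shift of families, twisted by a scalar. -/
def cyclicShift (V : Type*) [AddCommGroup V] [Module R V] (n : ℕ) (u : R) :
    Module.End R (Fin (n + 1) → V) where
  toFun w i := (if i = 0 then u else 1) • w (i - 1)
  map_add' w w' := by funext i; simp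
  map_smul' c w := by funext i; simp [smul_smul, mul_comm]

lemma cyclicShift_single (u : R) (a : Fin (n + 1)) (v : V) :
    cyclicShift V n u (Pi.single a v) =
      Pi.single (a + 1) ((if a + 1 = 0 then u else 1) • v) := by
  funext i
  change (if i = 0 then u else 1) • (Pi.single a v : Fin (n + 1) → V) (i - 1) = _
  by_cases h : i = a + 1
  · subst h
    simp
  · rw [Pi.single_eq_of_ne h, Pi.single_eq_of_ne, smul_zero]
    exact fun h' => h (by rw [← h', sub_add_cancel])

lemma cyclicShift_pow_single (u : R) {k : ℕ} (hk : k ≤ n) (v : V) :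
    (cyclicShift V n u ^ k) (Pi.single 0 v) = Pi.single (k : Fin (n + 1)) v := by
  induction k with
  | zero => simp
  | succ k ih =>
    have h : ((k : Fin (n + 1)) + 1) ≠ 0 := by
      rw [← Nat.cast_succ, Ne, Fin.natCast_eq_zero]
      exact Nat.not_dvd_of_pos_of_lt (by omega) (by omega)
    rw [pow_succ', Module.End.mul_apply, ih (by omega), cyclicShift_single, if_neg h, one_smul,
      Nat.cast_succ]

lemma cyclicShift_pow (u : R) :
    cyclicShift V n u ^ (n + 1) = algebraMap R (Module.End R (Fin (n + 1) → V)) u := by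
  refine LinearMap.pi_ext fun i v => ?_
  have h0 : ∀ v : V, (cyclicShift V n u ^ (n + 1)) (Pi.single 0 v) = u • Pi.single 0 v := by
    intro v
    have h : ((n : Fin (n + 1)) + 1) = 0 := by
      rw [← Nat.cast_succ, Fin.natCast_eq_zero]
    rw [pow_succ', Module.End.mul_apply, cyclicShift_pow_single u le_rfl, cyclicShift_single, h,
      if_pos rfl, Pi.single_smul]
  have hi := cyclicShift_pow_single (V := V) u (Nat.lt_succ_iff.1 i.2) v
  rw [Fin.cast_val_eq_self] at hi
  rw [← hi, ← Module.End.mul_apply, (Commute.pow_pow_self _ _ _).eq, Module.End.mul_apply, h0,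
    map_smul, Module.algebraMap_end_apply]

lemma cyclicShift_commute (u : R) (S : Module.End R V) :
    Commute (cyclicShift V n u) (diagEnd R V (Fin (n + 1)) S) := by
  refine LinearMap.ext fun w => funext fun i => ?_
  exact (map_smul S _ _).symm

/-- The cyclic shift as an invertible endomorphism. -/
noncomputable def cyclicShiftUnit (V : Type*) [AddCommGroup V] [Module R V] (n : ℕ) (u : Rˣ) :
    (Module.End R (Fin (n + 1) → V))ˣ :=
  ((isUnit_pow_iff n.succ_ne_zero).1
    (by rw [cyclicShift_pow]; exact u.isUnit.map (algebraMap R _)) :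
      IsUnit (cyclicShift V n (u : R))).unit

lemma cyclicShiftUnit_val (u : Rˣ) :
    (cyclicShiftUnit V n u : Module.End R (Fin (n + 1) → V)) = cyclicShift V n (u : R) := rfl

lemma cyclicShiftUnit_pow (u : Rˣ) :
    cyclicShiftUnit V n u ^ (n + 1) = scalarUnit R (Fin (n + 1) → V) u :=
  Units.ext (by rw [Units.val_pow_eq_pow_val, cyclicShiftUnit_val, cyclicShift_pow]; rfl)

variable {G : Type*} [Group G]

/-- A representation twisted by powers of the cyclic shift. -/
noncomputable def twistRep (n : ℕ) (ρ : G →* (Module.End R V)ˣ) (ℓ : G →* Multiplicative ℤ)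
    (u : Rˣ) : G →* (Module.End R (Fin (n + 1) → V))ˣ where
  toFun x := cyclicShiftUnit V n u ^ (ℓ x).toAdd * Units.map (diagEnd R V _) (ρ x)
  map_one' := by simp
  map_mul' x y := by
    have h : Commute (cyclicShiftUnit V n u ^ (ℓ y).toAdd) (Units.map (diagEnd R V _) (ρ x)) :=
      Commute.zpow_left (show Commute _ _ from Units.ext (cyclicShift_commute _ _).eq) _
    rw [map_mul ℓ, map_mul ρ, map_mul (Units.map _), toAdd_mul, zpow_add, mul_assoc, ← mul_assoc _ _ (Units.map _ _),
      h.eq]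
    simp only [mul_assoc]

lemma twistRep_apply (ρ : G →* (Module.End R V)ˣ) (ℓ : G →* Multiplicative ℤ)
    (u : Rˣ) {x : G} {k : ℤ} {a : ℕ} (hx : (ℓ x).toAdd = (n + 1 : ℕ) * k + a) (ha : a ≤ n)
    (v : V) :
    (twistRep n ρ ℓ u x : Module.End R (Fin (n + 1) → V)) (Pi.single 0 v) =
      Pi.single (a : Fin (n + 1)) ((scalarUnit R V (u ^ k) * ρ x : (Module.End R V)ˣ).1 v) := by
  have h : twistRep n ρ ℓ u x = scalarUnit R _ (u ^ k) * cyclicShiftUnit V n u ^ a *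
      Units.map (diagEnd R V _) (ρ x) := by
    change cyclicShiftUnit V n u ^ (ℓ x).toAdd * _ = _
    rw [hx, zpow_add, zpow_mul, zpow_natCast, cyclicShiftUnit_pow, ← map_zpow, zpow_natCast]
  rw [h]
  simp only [Units.val_mul, Module.End.mul_apply, Units.coe_map]
  rw [diagEnd_single, Units.val_pow_eq_pow_val, cyclicShiftUnit_val, cyclicShift_pow_single _ ha,
    scalarUnit_apply, scalarUnit_apply, Pi.single_smul]

lemma twistRep_eq_scalarUnit (ρ : G →* (Module.End R V)ˣ) (ℓ : G →* Multiplicative ℤ)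
    (u : Rˣ) {x : G} {k : ℤ} (hx : (ℓ x).toAdd = (n + 1 : ℕ) * k) {c : Rˣ}
    (hc : ρ x = scalarUnit R V c) :
    twistRep n ρ ℓ u x = scalarUnit R _ (u ^ k * c) := by
  change cyclicShiftUnit V n u ^ (ℓ x).toAdd * _ = _
  rw [hx, zpow_mul, zpow_natCast, cyclicShiftUnit_pow, ← map_zpow, map_mul, hc]
  congr 1

lemma exists_of_twistRep_eq_one [Nontrivial V] (ρ : G →* (Module.End R V)ˣ)
    (ℓ : G →* Multiplicative ℤ) (u : Rˣ) {x : G} (hx : twistRep n ρ ℓ u x = 1) :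
    ∃ k : ℤ, (ℓ x).toAdd = (n + 1 : ℕ) * k ∧ scalarUnit R V (u ^ k) * ρ x = 1 := by
  set N : ℤ := ((n + 1 : ℕ) : ℤ) with hN
  have hN0 : 0 < N := by omega
  obtain ⟨a, ha⟩ := Int.eq_ofNat_of_zero_le (Int.emod_nonneg (ℓ x).toAdd hN0.ne')
  have ha' : a < n + 1 := by
    have := Int.emod_lt_of_pos (ℓ x).toAdd hN0
    omega
  have e : (ℓ x).toAdd = N * ((ℓ x).toAdd / N) + a := by
    rw [← ha, Int.mul_ediv_add_emod]
  have key := fun v => twistRep_apply ρ ℓ u e (by omega) v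
  simp only [hx, Units.val_one, Module.End.one_apply] at key
  have h0 : a = 0 := by
    by_contra h0
    obtain ⟨v, hv⟩ := exists_ne (0 : V)
    have := congrFun (key v) 0
    rw [Pi.single_eq_same, Pi.single_eq_of_ne] at this
    · exact hv this
    · rw [Ne, eq_comm, Fin.natCast_eq_zero]
      exact Nat.not_dvd_of_pos_of_lt (by omega) ha'
  subst h0
  refine ⟨(ℓ x).toAdd / N, by simpa using e, Units.ext (LinearMap.ext fun v => ?_)⟩
  have := congrFun (key v) 0
  simp only [Nat.cast_zero, Pi.single_eq_same] at this
  exact this.symm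

end CyclicTwist

section TwistedLK

variable {R : Type} [CommRing R] [IsDomain R] {q t : R}

/-- The exponent sum. -/
def braidLength (r : ℕ) : BraidGroup r →* Multiplicative ℤ :=
  IsBraid.lift (s := fun _ => Multiplicative.ofAdd 1) ⟨fun _ _ => rfl, fun _ _ _ _ => rfl⟩

lemma braidLength_fullTwist (r : ℕ) : (braidLength r (fullTwist r)).toAdd = r * (r + 1) := by
  have h : ∀ l ≤ r, (braidLength r (asc (braidGen r) 0 l)).toAdd = l := by
    intro l hl
    induction l with
    | zero => simp
    | succ l ih =>
      rw [asc_succ, map_mul, toAdd_mul, ih (by omega), braidLength,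
        IsBraid.lift_braidGen _ (by omega)]
      simp
  rw [fullTwist, map_pow, toAdd_pow, h r le_rfl]
  simp [mul_comm]

lemma exists_lkRep_fullTwist (hqt : IsLKParam q t) {r : ℕ} (hr : 0 < r) :
    ∃ c : Rˣ, lkRep hqt r (fullTwist r) = scalarUnit R _ c := by
  have key : ∀ x : BraidGroup r, (∀ y, Commute y x) → ∃ c : R,
      (lkRep hqt r x : Module.End R (Pairs (r + 1) → R)) = c • 1 := by
    intro x hx
    refine exists_scalar_of_commute hqt fun k hk => ?_
    rw [← lkRep_braidGen hqt hk]
    exact congrArg Units.val (((hx (braidGen r k)).symm.map (lkRep hqt r)).eq)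
  obtain ⟨c, hc⟩ := key (fullTwist r) commute_fullTwist
  obtain ⟨d, hd⟩ := key (fullTwist r)⁻¹ fun y => (commute_fullTwist y).inv_right
  have h1 : c * d = 1 := by
    have h : (lkRep hqt r (fullTwist r * (fullTwist r)⁻¹) : Module.End R (Pairs (r + 1) → R)) =
        (c * d) • 1 := by
      rw [map_mul, Units.val_mul, hc, hd, smul_mul_smul_comm, one_mul]
    rw [mul_inv_cancel, map_one, Units.val_one] at h
    have := congrFun (LinearMap.congr_fun h (fun _ => 1)) ⟨⟨1, by omega⟩, ⟨0, by simp⟩⟩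
    simpa using this.symm
  refine ⟨⟨c, d, h1, by rw [mul_comm, h1]⟩, Units.ext (LinearMap.ext fun v => ?_)⟩
  rw [hc, scalarUnit_apply]
  rfl

/-- A modification of the Lawrence–Krammer representation for which the full twist acts
as a prescribed sign. -/
lemma exists_twisted_lkRep (hqt : IsLKParam q t) {r n : ℕ} (hr : 0 < r) (hn : n + 1 = r * (r + 1))
    {ε : Rˣ} (hε : ε = 1 ∨ ε = -1) :
    ∃ ρ : BraidGroup r →* (Module.End R (Fin (n + 1) → Pairs (r + 1) → R))ˣ,
      ρ (fullTwist r) = scalarUnit R _ ε ∧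
      ∀ x, ρ x = 1 → ∃ k : ℤ, x = fullTwist r ^ k ∧ ε ^ k = 1 := by
  obtain ⟨c, hc⟩ := exists_lkRep_fullTwist hqt hr
  have : Nontrivial (Pairs (r + 1) → R) :=
    have : Nonempty (Pairs (r + 1)) := ⟨⟨⟨1, by omega⟩, ⟨0, by simp⟩⟩⟩
    inferInstance
  have hl : (braidLength r (fullTwist r)).toAdd = ((n + 1 : ℕ) : ℤ) := by
    rw [braidLength_fullTwist, hn]
    push_cast
    ring
  refine ⟨twistRep n (lkRep hqt r) (braidLength r) (ε * c⁻¹), ?_, fun x hx => ?_⟩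
  · rw [twistRep_eq_scalarUnit (k := 1) _ _ _ (by rw [hl, mul_one]) hc]
    simp
  · obtain ⟨k, hk, h⟩ := exists_of_twistRep_eq_one _ _ _ hx
    have hsign : (ε ^ (-k) = 1 ∨ ε ^ (-k) = -1) := by
      rcases hε with rfl | rfl
      · simp
      · rcases Int.even_or_odd (-k) with h | h
        · exact Or.inl h.neg_one_zpow
        · exact Or.inr h.neg_one_zpow
    have h1 : lkRep hqt r x = scalarUnit R _ (ε ^ (-k)) * scalarUnit R _ c ^ k := by
      rw [← map_zpow, ← map_mul, eq_comm, ← inv_mul_eq_one, ← map_inv, ← h]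
      congr 2
      simp [mul_zpow, mul_comm]
    have h2 : lkRep hqt r (x * (fullTwist r ^ k)⁻¹) = scalarUnit R _ (ε ^ (-k)) := by
      rw [map_mul, h1, map_inv, map_zpow (lkRep hqt r), hc, mul_inv_cancel_right]
    have h3 : x = fullTwist r ^ k := by
      rw [← mul_inv_eq_one]
      refine eq_one_of_lkRep hqt (c := ((ε ^ (-k) : Rˣ) : R)) ?_ ?_
      · rcases hsign with h | h <;> simp [h]
      · rw [h2]
        exact LinearMap.ext fun v => scalarUnit_apply _ v
    refine ⟨k, h3, ?_⟩
    rw [h3, mul_inv_cancel, map_one] at h2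
    have h4 : (ε ^ (-k) : Rˣ) = 1 := by
      refine Units.ext ?_
      have := congrFun (LinearMap.congr_fun (congrArg Units.val h2) (fun _ => 1))
        ⟨⟨1, by omega⟩, ⟨0, by simp⟩⟩
      rw [scalarUnit_apply] at this
      simpa using this.symm
    rw [zpow_neg, inv_eq_one] at h4
    exact h4

end TwistedLK

section MonomialAction

variable {R W : Type*} [CommRing R] [AddCommGroup W] [Module R W]

/-- The monomial endomorphism attached to a permutation and a family of invertible
endomorphisms. -/
def monomialUnit {ι : Type*} (σ : Equiv.Perm ι) (c : ι → (Module.End R W)ˣ) :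
    (Module.End R (ι → W))ˣ where
  val :=
    { toFun := fun z j => (c (σ.symm j) : Module.End R W) (z (σ.symm j))
      map_add' := fun z z' => by funext j; simp
      map_smul' := fun a z => by funext j; simp }
  inv :=
    { toFun := fun z j => ((c j)⁻¹ : (Module.End R W)ˣ).1 (z (σ j))
      map_add' := fun z z' => by funext j; simp
      map_smul' := fun a z => by funext j; simp }
  val_inv := by
    refine LinearMap.ext fun z => funext fun j => ?_
    change (c (σ.symm j)).1 (((c (σ.symm j))⁻¹ : (Module.End R W)ˣ).1 (z (σ (σ.symm j)))) = z j
    rw [← Module.End.mul_apply, ← Units.val_mul]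
    simp
  inv_val := by
    refine LinearMap.ext fun z => funext fun j => ?_
    change ((c j)⁻¹ : (Module.End R W)ˣ).1 ((c (σ.symm (σ j))).1 (z (σ.symm (σ j)))) = z j
    rw [σ.symm_apply_apply, ← Module.End.mul_apply, ← Units.val_mul]
    simp

lemma monomialUnit_apply {ι : Type*} (σ : Equiv.Perm ι) (c : ι → (Module.End R W)ˣ)
    (z : ι → W) (j : ι) :
    (monomialUnit σ c : Module.End R (ι → W)) z j =
      (c (σ.symm j) : Module.End R W) (z (σ.symm j)) := rfl

/-- The family supported at the natural number `j`. -/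
def natSingle (n j : ℕ) (w : W) : Fin n → W := fun i => if (i : ℕ) = j then w else 0

lemma natSingle_val {n : ℕ} (i : Fin n) (w : W) : natSingle n i w = Pi.single i w := by
  funext j
  simp [natSingle, Pi.single_apply, Fin.ext_iff]

variable {n : ℕ}

/-- The endomorphism `S` acts on families supported at one point through the map `e`. -/
def Implements (S : Module.End R (Fin n → W)) (e : Function.End (ℕ × (Module.End R W)ˣ)) : Prop :=
  ∀ j < n, ∀ (k : (Module.End R W)ˣ) (w : W),
    (e (j, k)).1 < n ∧ S (natSingle n j (k.1 w)) = natSingle n (e (j, k)).1 ((e (j, k)).2.1 w)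

lemma Implements.one : Implements (1 : Module.End R (Fin n → W)) 1 :=
  fun _ hj _ _ => ⟨hj, rfl⟩

lemma Implements.mul {S S' : Module.End R (Fin n → W)}
    {e e' : Function.End (ℕ × (Module.End R W)ˣ)} (h : Implements S e) (h' : Implements S' e') :
    Implements (S * S') (e * e') := by
  intro j hj k w
  obtain ⟨h1, h2⟩ := h' j hj k w
  obtain ⟨h3, h4⟩ := h _ h1 (e' (j, k)).2 w
  exact ⟨h3, by rw [Module.End.mul_apply, h2, h4]; rfl⟩

lemma Implements.eq {S S' : Module.End R (Fin n → W)}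
    {e e' : Function.End (ℕ × (Module.End R W)ˣ)} (h : Implements S e) (h' : Implements S' e')
    (he : ∀ j < n, e (j, 1) = e' (j, 1)) : S = S' := by
  refine LinearMap.pi_ext fun i w => ?_
  obtain ⟨-, h1⟩ := h i i.2 1 w
  obtain ⟨-, h2⟩ := h' i i.2 1 w
  rw [Units.val_one, Module.End.one_apply, natSingle_val] at h1 h2
  rw [h1, h2, he i i.2]

lemma Implements.apply {S : Module.End R (Fin n → W)}
    {e : Function.End (ℕ × (Module.End R W)ˣ)} (h : Implements S e) {j j' : ℕ}
    {k : (Module.End R W)ˣ} (hj : j < n) (he : e (j, 1) = (j', k)) (w : W) :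
    S (natSingle n j w) = natSingle n j' (k.1 w) := by
  obtain ⟨-, h1⟩ := h j hj 1 w
  rwa [he] at h1

lemma Implements.asc {S : ℕ → (Module.End R (Fin n → W))ˣ}
    {e : ℕ → Function.End (ℕ × (Module.End R W)ˣ)} {a l : ℕ}
    (h : ∀ i, a ≤ i → i < a + l → Implements (S i).1 (e i)) :
    Implements (asc S a l).1 (asc e a l) := by
  induction l with
  | zero => exact Implements.one
  | succ l ih =>
    exact (ih fun i h1 h2 => h i h1 (by omega)).mul (h (a + l) (by omega) (by omega))

lemma Implements.desc {S : ℕ → (Module.End R (Fin n → W))ˣ}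
    {e : ℕ → Function.End (ℕ × (Module.End R W)ˣ)} {a l : ℕ}
    (h : ∀ i, a ≤ i → i < a + l → Implements (S i).1 (e i)) :
    Implements (desc S a l).1 (desc e a l) := by
  induction l with
  | zero => exact Implements.one
  | succ l ih =>
    exact (h (a + l) (by omega) (by omega)).mul (ih fun i h1 h2 => h i h1 (by omega))

variable {m : ℕ}

/-- The operators of the representation of the sphere braid group induced from the family `s`. -/
def sphereOp (s : ℕ → (Module.End R W)ˣ) (m i : ℕ) : (Module.End R (Fin (m + 2) → W))ˣ :=
  if h : i < m + 1 then
    monomialUnit (Equiv.swap (⟨i, by omega⟩ : Fin (m + 2)) ⟨i + 1, by omega⟩)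
      (fun j => sphereCocycle s m i j)
  else 1

lemma implements_sphereOp (s : ℕ → (Module.End R W)ˣ) {i : ℕ} (hi : i < m + 1) :
    Implements (sphereOp s m i).1 (sphereStep s m i) := by
  intro j hj k w
  have hlt : stepSwap i j < m + 2 := by
    rw [stepSwap]
    split_ifs <;> omega
  refine ⟨hlt, ?_⟩
  have hswap : Equiv.swap (⟨i, by omega⟩ : Fin (m + 2)) ⟨i + 1, by omega⟩ ⟨stepSwap i j, hlt⟩ =
      ⟨j, hj⟩ := by
    rw [Equiv.swap_apply_def]
    simp only [Fin.ext_iff, stepSwap]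
    split_ifs <;> simp <;> omega
  rw [sphereOp, dif_pos hi]
  funext l
  rw [monomialUnit_apply, Equiv.symm_swap]
  by_cases hl : l = ⟨stepSwap i j, hlt⟩
  · subst hl
    rw [hswap]
    simp [natSingle, sphereStep]
  · have h1 : (l : ℕ) ≠ stepSwap i j := fun h => hl (Fin.ext h)
    have h2 : ((Equiv.swap (⟨i, by omega⟩ : Fin (m + 2)) ⟨i + 1, by omega⟩ l : Fin (m + 2)) : ℕ) ≠
        j := by
      intro h
      refine hl ((Equiv.swap (⟨i, by omega⟩ : Fin (m + 2)) ⟨i + 1, by omega⟩).injective ?_)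
      rw [hswap]
      exact Fin.ext h
    simp [natSingle, sphereStep, h1, h2]

variable {s : ℕ → (Module.End R W)ˣ}

lemma isBraid_sphereOp (hs : IsBraid s m) : IsBraid (sphereOp s m) (m + 1) where
  braid i hi := by
    have h1 := implements_sphereOp s (show i < m + 1 by omega)
    have h2 := implements_sphereOp s hi
    refine Units.ext (((h1.mul h2).mul h1).eq ((h2.mul h1).mul h2) fun j _ => ?_)
    rw [hs.isBraid_sphereStep.braid i hi]
  comm i j hij hj := by
    have h1 := implements_sphereOp s (show i < m + 1 by omega)
    have h2 := implements_sphereOp s hj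
    refine Units.ext ((h1.mul h2).eq (h2.mul h1) fun j' _ => ?_)
    rw [hs.isBraid_sphereStep.comm i j hij hj]

lemma sphereOp_relation (hs : IsBraid s m) (ht : (asc s 0 m ^ (m + 1)) ^ 2 = 1) :
    asc (sphereOp s m) 0 (m + 1) * desc (sphereOp s m) 0 (m + 1) = 1 := by
  have h1 : Implements (asc (sphereOp s m) 0 (m + 1)).1 _ :=
    Implements.asc fun i _ h2 => implements_sphereOp s (by omega)
  have h2 : Implements (desc (sphereOp s m) 0 (m + 1)).1 _ :=
    Implements.desc fun i _ h2 => implements_sphereOp s (by omega)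
  refine Units.ext ((h1.mul h2).eq Implements.one fun j hj => ?_)
  rw [hs.sphereStep_relation ht (by omega)]
  rfl

lemma sphereOp_base (s : ℕ → (Module.End R W)ˣ) {i : ℕ} (hi : i < m) (w : W) :
    (sphereOp s m i).1 (natSingle (m + 2) (m + 1) w) = natSingle (m + 2) (m + 1) ((s i).1 w) :=
  (implements_sphereOp s (by omega)).apply (by omega)
    (by rw [sphereStep_gt s m _ (by omega) le_rfl, mul_one]) w

lemma asc_sphereOp_base (s : ℕ → (Module.End R W)ˣ) {j : ℕ} (hj : j ≤ m + 1) (w : W) :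
    (asc (sphereOp s m) j (m + 1 - j)).1 (natSingle (m + 2) (m + 1) w) =
      natSingle (m + 2) j w := by
  have h : Implements (asc (sphereOp s m) j (m + 1 - j)).1 _ :=
    Implements.asc fun i _ h2 => implements_sphereOp s (by omega)
  have e := asc_sphereStep_self s m (a := j) (l := m + 1 - j) 1
  rw [Nat.add_sub_cancel' hj] at e
  exact h.apply (by omega) e w

end MonomialAction

section SphereGroup

variable {G : Type*} [Group G] {d : ℕ → G} {m : ℕ}

lemma IsBraid.sphere_desc_mul_asc (hrel : asc d 0 (m + 1) * desc d 0 (m + 1) = 1) :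
    desc d 0 (m + 1) * asc d 0 (m + 1) = 1 := by
  rw [mul_eq_one_iff_eq_inv] at hrel ⊢
  rw [hrel, inv_inv]

lemma IsBraid.sphere_twist (hd : IsBraid d (m + 1))
    (hrel : asc d 0 (m + 1) * desc d 0 (m + 1) = 1) :
    asc d 0 m ^ (m + 1) = asc d 0 (m + 1) ^ (m + 2) := by
  rw [hd.asc_pow_succ (by omega), IsBraid.sphere_desc_mul_asc hrel, mul_one]

lemma IsBraid.sphere_twist_sq (hd : IsBraid d (m + 1))
    (hrel : asc d 0 (m + 1) * desc d 0 (m + 1) = 1) : (asc d 0 m ^ (m + 1)) ^ 2 = 1 := by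
  rw [pow_two, hd.sphere_twist hrel]
  nth_rw 2 [hd.asc_pow_eq_desc_pow (by omega)]
  rw [eq_inv_of_mul_eq_one_left hrel, inv_pow, inv_mul_cancel]

lemma IsBraid.sphere_twist_commute (hd : IsBraid d (m + 1))
    (hrel : asc d 0 (m + 1) * desc d 0 (m + 1) = 1) {j : ℕ} (hj : j < m + 1) :
    Commute (d j) (asc d 0 m ^ (m + 1)) := by
  rw [hd.sphere_twist hrel]
  exact hd.commute_twist (by omega) (by omega) (by omega)

/-- The homomorphism from the braid group of the disc to a quotient of the sphere braid group. -/
def IsBraid.discMap (hd : IsBraid d (m + 1)) : BraidGroup m →* G := (hd.mono m.le_succ).lift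

lemma IsBraid.discMap_braidGen (hd : IsBraid d (m + 1)) {i : ℕ} (hi : i < m) :
    hd.discMap (braidGen m i) = d i := IsBraid.lift_braidGen _ hi

lemma IsBraid.discMap_fullTwist (hd : IsBraid d (m + 1)) :
    hd.discMap (fullTwist m) = asc d 0 m ^ (m + 1) := by
  rw [fullTwist, map_pow, map_asc]
  congr 1
  exact asc_congr fun i _ h => hd.discMap_braidGen (by omega)

lemma IsBraid.discMap_ringBraid (hd : IsBraid d (m + 1))
    (hrel : asc d 0 (m + 1) * desc d 0 (m + 1) = 1) {l i : ℕ} (hi : i + l = m) :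
    d i * d i * asc d (i + 1) l * hd.discMap (ringBraid (braidGen m) m i) = asc d (i + 1) l := by
  induction l generalizing i with
  | zero =>
    obtain rfl : i = m := by omega
    have h1 : hd.discMap (ringBraid (braidGen i) i i) = desc d 0 i * asc d 0 i := by
      rw [ringBraid, Nat.sub_self, asc_zero, desc_zero, one_mul, one_mul, map_mul, map_asc, map_desc]
      congr 1
      · exact desc_congr fun j _ h => hd.discMap_braidGen (by omega)
      · exact asc_congr fun j _ h => hd.discMap_braidGen (by omega)
    have h2 := IsBraid.sphere_desc_mul_asc hrel
    rw [asc_succ, desc_succ, zero_add] at h2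
    have h3 : d i * (desc d 0 i * asc d 0 i) * d i = 1 := by
      simpa only [mul_assoc] using h2
    rw [h1, asc_zero, mul_one, mul_assoc, mul_eq_one_iff_eq_inv.1 h3, mul_inv_cancel]
  | succ l ih =>
    have h1 : hd.discMap (ringBraid (braidGen m) m i) =
        d i * hd.discMap (ringBraid (braidGen m) m (i + 1)) * (d i)⁻¹ := by
      rw [eq_mul_inv_iff_mul_eq, ← hd.discMap_braidGen (show i < m by omega), ← map_mul,
        ringBraid_mul _ (by omega), map_mul]
    have h2 := ih (i := i + 1) (by omega)
    have hc : Commute (d i) (asc d (i + 1 + 1) l) := hd.commute_asc (by omega) (by omega) (by omega)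
    have hb := hd.braid i (by omega)
    set y := asc d (i + 1 + 1) l
    set D := hd.discMap (ringBraid (braidGen m) m (i + 1))
    rw [asc_succ', h1]
    have h3 : d i * d i * d (i + 1) * d i = d (i + 1) * d i * (d (i + 1) * d (i + 1)) := by
      rw [mul_assoc (d i) (d i), mul_assoc (d i), hb]
      simp only [← mul_assoc, hb]
    calc d i * d i * (d (i + 1) * y) * (d i * D * (d i)⁻¹)
        = d i * d i * d (i + 1) * (y * d i) * D * (d i)⁻¹ := by simp only [mul_assoc]
      _ = d i * d i * d (i + 1) * d i * y * D * (d i)⁻¹ := by rw [← hc.eq]; simp only [mul_assoc]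
      _ = d (i + 1) * d i * (d (i + 1) * d (i + 1) * y * D) * (d i)⁻¹ := by
        rw [h3]; simp only [mul_assoc]
      _ = d (i + 1) * y := by
        rw [h2, mul_assoc (d (i + 1)), hc.eq]
        simp only [mul_assoc, mul_inv_cancel, mul_one]

/-- The element of the sphere braid group represented by a coset and an element of the braid
group. -/
def IsBraid.cosetValue (hd : IsBraid d (m + 1)) (x : ℕ × BraidGroup m) : G :=
  asc d x.1 (m + 1 - x.1) * hd.discMap x.2

lemma IsBraid.mul_cosetValue (hd : IsBraid d (m + 1))
    (hrel : asc d 0 (m + 1) * desc d 0 (m + 1) = 1) {i j : ℕ} (hi : i < m + 1) (hj : j < m + 2)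
    (k : BraidGroup m) :
    d i * hd.cosetValue (j, k) = hd.cosetValue (sphereStep (braidGen m) m i (j, k)) := by
  obtain rfl | rfl | h | h : j = i ∨ j = i + 1 ∨ j < i ∨ i + 1 < j := by omega
  · have h := hd.discMap_ringBraid hrel (l := m - j) (i := j) (by omega)
    rw [← eq_mul_inv_iff_mul_eq] at h
    rw [sphereStep_self, cosetValue, cosetValue, map_mul, map_inv,
      show m + 1 - (j + 1) = m - j by omega, show m + 1 - j = m - j + 1 by omega, asc_succ',
      ← mul_assoc, ← mul_assoc, ← mul_assoc, h]
  · rw [sphereStep_succ, cosetValue, cosetValue, show m + 1 - i = m + 1 - (i + 1) + 1 by omega,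
      asc_succ', mul_assoc]
  · rw [sphereStep_lt _ _ _ h, cosetValue, cosetValue, map_mul,
      hd.discMap_braidGen (by omega), ← mul_assoc, ← mul_assoc, hd.asc_mul (by omega) (by omega)
      (by omega), Nat.sub_add_cancel (by omega)]
  · rw [sphereStep_gt _ _ _ h (by omega), cosetValue, cosetValue, map_mul,
      hd.discMap_braidGen (by omega), ← mul_assoc, ← mul_assoc,
      (hd.commute_asc (by omega) (by omega) (by omega)).eq]

lemma stepSwap_stepSwap (i j : ℕ) : stepSwap i (stepSwap i j) = j := by
  simp only [stepSwap]
  split_ifs <;> omega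

lemma stepSwap_lt {i j : ℕ} (hi : i < m + 1) (hj : j < m + 2) : stepSwap i j < m + 2 := by
  rw [stepSwap]
  split_ifs <;> omega

lemma IsBraid.exists_cosetValue (hd : IsBraid d (m + 1))
    (hrel : asc d 0 (m + 1) * desc d 0 (m + 1) = 1) {g : G}
    (hg : g ∈ Subgroup.closure (d '' Set.Iio (m + 1))) :
    ∃ j < m + 2, ∃ k, g = hd.cosetValue (j, k) := by
  induction hg using Subgroup.closure_induction_left with
  | one => exact ⟨m + 1, by omega, 1, by simp [cosetValue]⟩
  | mul_left x hx y hy ih =>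
    obtain ⟨i, hi, rfl⟩ := hx
    obtain ⟨j, hj, k, rfl⟩ := ih
    exact ⟨_, stepSwap_lt hi hj, _, hd.mul_cosetValue hrel hi hj k⟩
  | inv_mul_cancel x hx y hy ih =>
    obtain ⟨i, hi, rfl⟩ := hx
    obtain ⟨j, hj, k, rfl⟩ := ih
    refine ⟨stepSwap i j, stepSwap_lt hi hj,
      (sphereCocycle (braidGen m) m i (stepSwap i j))⁻¹ * k, ?_⟩
    rw [inv_mul_eq_iff_eq_mul, hd.mul_cosetValue hrel hi (stepSwap_lt hi hj)]
    simp [sphereStep, stepSwap_stepSwap]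

variable {R W : Type*} [CommRing R] [AddCommGroup W] [Module R W]

lemma discMap_base (hd : IsBraid d (m + 1)) (ρ : BraidGroup m →* (Module.End R W)ˣ)
    {Φ : G →* (Module.End R (Fin (m + 2) → W))ˣ}
    (hΦ : ∀ i < m + 1, Φ (d i) = sphereOp (fun i => ρ (braidGen m i)) m i) (k : BraidGroup m)
    (w : W) : (Φ (hd.discMap k)).1 (natSingle (m + 2) (m + 1) w) =
      natSingle (m + 2) (m + 1) ((ρ k).1 w) := by
  have hgen : ∀ i < m, ∀ w, (Φ (hd.discMap (braidGen m i))).1 (natSingle (m + 2) (m + 1) w) =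
      natSingle (m + 2) (m + 1) ((ρ (braidGen m i)).1 w) := by
    intro i hi w
    rw [hd.discMap_braidGen hi, hΦ i (by omega), sphereOp_base _ hi]
  induction k using BraidGroup.induction_on generalizing w with
  | one => simp
  | mul x y hx hy => simp [hx, hy]
  | gen i hi => exact hgen i hi w
  | inv i hi =>
    have h := hgen i hi ((ρ (braidGen m i)⁻¹).1 w)
    rw [← Module.End.mul_apply, ← Units.val_mul, ← map_mul, mul_inv_cancel, map_one,
      Units.val_one, Module.End.one_apply] at h
    rw [← h, ← Module.End.mul_apply, ← Units.val_mul, ← map_mul, ← map_mul, inv_mul_cancel,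
      map_one, map_one, Units.val_one, Module.End.one_apply]

lemma injective_of_sphereOp [Nontrivial W] (hd : IsBraid d (m + 1))
    (hrel : asc d 0 (m + 1) * desc d 0 (m + 1) = 1)
    (hgen : Subgroup.closure (d '' Set.Iio (m + 1)) = ⊤) (ρ : BraidGroup m →* (Module.End R W)ˣ)
    {Φ : G →* (Module.End R (Fin (m + 2) → W))ˣ}
    (hΦ : ∀ i < m + 1, Φ (d i) = sphereOp (fun i => ρ (braidGen m i)) m i)
    (hker : ∀ k, ρ k = 1 → hd.discMap k = 1) : Function.Injective Φ := by
  rw [injective_iff_map_eq_one]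
  intro g hg
  obtain ⟨j, hj, k, rfl⟩ := hd.exists_cosetValue hrel (g := g) (by rw [hgen]; trivial)
  have key : ∀ w : W, natSingle (m + 2) (m + 1) w = natSingle (m + 2) j ((ρ k).1 w) := by
    intro w
    have h : (Φ (hd.cosetValue (j, k))).1 (natSingle (m + 2) (m + 1) w) =
        natSingle (m + 2) j ((ρ k).1 w) := by
      rw [IsBraid.cosetValue, map_mul, Units.val_mul, Module.End.mul_apply,
        discMap_base hd ρ hΦ, map_asc, asc_congr fun i _ h => hΦ i (by omega),
        asc_sphereOp_base _ (by omega)]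
    rwa [hg] at h
  have hjm : j = m + 1 := by
    by_contra hne
    obtain ⟨w, hw⟩ := exists_ne (0 : W)
    have := congrFun (key w) ⟨m + 1, by omega⟩
    simp only [natSingle, if_true, if_neg (Ne.symm hne)] at this
    exact hw this
  subst hjm
  have hk : ρ k = 1 := by
    refine Units.ext (LinearMap.ext fun w => ?_)
    have := congrFun (key w) ⟨m + 1, by omega⟩
    simp only [natSingle, if_true] at this
    exact this.symm
  simp [IsBraid.cosetValue, hker k hk]

lemma sphereOp_twist_eq_one {s : ℕ → (Module.End R W)ˣ} (hs : IsBraid s m)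
    (ht : asc s 0 m ^ (m + 1) = 1) : asc (sphereOp s m) 0 m ^ (m + 1) = 1 := by
  have hX := isBraid_sphereOp hs
  have hrel := sphereOp_relation hs (by rw [ht, one_pow])
  have hbase : ∀ w, (asc (sphereOp s m) 0 m).1 (natSingle (m + 2) (m + 1) w) =
      natSingle (m + 2) (m + 1) ((asc s 0 m).1 w) := by
    have h : Implements (asc (sphereOp s m) 0 m).1 _ :=
      Implements.asc fun i _ h2 => implements_sphereOp s (by omega)
    exact h.apply (by omega) (by rw [asc_sphereStep_gt s m _ (by omega) le_rfl, mul_one])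
  have hpow : ∀ l w, (asc (sphereOp s m) 0 m ^ l).1 (natSingle (m + 2) (m + 1) w) =
      natSingle (m + 2) (m + 1) ((asc s 0 m ^ l).1 w) := by
    intro l
    induction l with
    | zero => intro w; simp
    | succ l ih =>
      intro w
      rw [pow_succ, Units.val_mul, Module.End.mul_apply, hbase, ih, pow_succ, Units.val_mul,
        Module.End.mul_apply]
  refine Units.ext (LinearMap.pi_ext fun j w => ?_)
  have hc : Commute (asc (sphereOp s m) j (m + 1 - j)) (asc (sphereOp s m) 0 m ^ (m + 1)) :=
    IsBraid.commute_asc_asc fun i _ h => hX.sphere_twist_commute hrel (by omega)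
  have hj := asc_sphereOp_base s (m := m) (j := j) (by omega) w
  rw [natSingle_val] at hj
  rw [← hj, ← Module.End.mul_apply, ← Units.val_mul, ← hc.eq, Units.val_mul, Module.End.mul_apply,
    hpow, ht]
  simp

end SphereGroup

section Relators

variable {G : Type*} [Group G] {m : ℕ} {f : FreeGroup (Fin (m + 1)) →* G} {X : ℕ → G}

lemma prod_map_finRange (X : ℕ → G) (l : ℕ) :
    ((List.finRange l).map fun i : Fin l => X i).prod = asc X 0 l := by
  induction l with
  | zero => simp
  | succ l ih =>
    rw [List.finRange_succ_last, asc_succ, ← ih]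
    simp [Function.comp_def]

lemma prod_reverse_map_finRange (X : ℕ → G) (l : ℕ) :
    ((List.finRange l).map fun i : Fin l => X i).reverse.prod = desc X 0 l := by
  induction l with
  | zero => simp
  | succ l ih =>
    rw [List.finRange_succ_last, desc_succ, ← ih]
    simp [Function.comp_def]

lemma map_deltaList (hf : ∀ i, f (FreeGroup.of i) = X i) :
    (deltaList m).map f = (List.finRange m).map fun i : Fin m => X i := by
  simp [deltaList, List.finRange_succ_last, Function.comp_def, hf]

lemma map_deltaList_prod (hf : ∀ i, f (FreeGroup.of i) = X i) :
    f (deltaList m).prod = asc X 0 m := by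
  rw [map_list_prod, map_deltaList hf, prod_map_finRange]

lemma map_deltaList_reverse_prod (hf : ∀ i, f (FreeGroup.of i) = X i) :
    f (deltaList m).reverse.prod = desc X 0 m := by
  rw [map_list_prod, List.map_reverse, map_deltaList hf, prod_reverse_map_finRange]

lemma map_sphereRels_eq_one_iff (hf : ∀ i, f (FreeGroup.of i) = X i) :
    (∀ r ∈ sphereRels m, f r = 1) ↔
      IsBraid X (m + 1) ∧ asc X 0 (m + 1) * desc X 0 (m + 1) = 1 := by
  have hlast : f ((deltaList m).prod * (FreeGroup.of (Fin.last m)) ^ 2 *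
      ((deltaList m).reverse).prod) = asc X 0 (m + 1) * desc X 0 (m + 1) := by
    rw [map_mul, map_mul, map_pow, map_deltaList_prod hf, map_deltaList_reverse_prod hf, hf,
      asc_succ, desc_succ, zero_add, Fin.val_last, sq]
    simp only [mul_assoc]
  constructor
  · intro h
    refine ⟨⟨fun i hi => ?_, fun i j hij hj => ?_⟩, ?_⟩
    · have := h _ (Or.inl (Or.inl ⟨⟨i, by omega⟩, ⟨i + 1, hi⟩, rfl, rfl⟩))
      simpa only [map_mul, map_inv, hf, mul_inv_eq_one] using this
    · have := h _ (Or.inl (Or.inr ⟨⟨i, by omega⟩, ⟨j, hj⟩, hij, rfl⟩))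
      simpa only [map_mul, map_inv, hf, mul_inv_eq_one] using this
    · rw [← hlast]
      exact h _ (Or.inr rfl)
  · rintro ⟨hX, hrel⟩ r ((⟨i, j, hij, rfl⟩ | ⟨i, j, hij, rfl⟩) | rfl)
    · simp only [map_mul, map_inv, hf, mul_inv_eq_one, ← hij]
      exact hX.braid i (by omega)
    · simp only [map_mul, map_inv, hf, mul_inv_eq_one]
      exact hX.comm i j hij j.2
    · rw [hlast, hrel]

lemma map_mcgRels_eq_one_iff (hf : ∀ i, f (FreeGroup.of i) = X i) :
    (∀ r ∈ mcgRels m, f r = 1) ↔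
      (IsBraid X (m + 1) ∧ asc X 0 (m + 1) * desc X 0 (m + 1) = 1) ∧ asc X 0 m ^ (m + 1) = 1 := by
  rw [← map_sphereRels_eq_one_iff hf, mcgRels, ← map_deltaList_prod hf, ← map_pow]
  simp only [Set.union_singleton, Set.mem_insert_iff, forall_eq_or_imp, and_comm]

end Relators

section Induced

variable {m : ℕ} {rels : Set (FreeGroup (Fin (m + 1)))}

/-- The generators of a group presented on `m + 1` generators, extended by `1`. -/
def presentedGen (rels : Set (FreeGroup (Fin (m + 1)))) (i : ℕ) : PresentedGroup rels :=
  if h : i < m + 1 then PresentedGroup.of ⟨i, h⟩ else 1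

lemma mk_of_eq_presentedGen (i : Fin (m + 1)) :
    PresentedGroup.mk rels (FreeGroup.of i) = presentedGen rels i := by
  rw [presentedGen, dif_pos i.2]
  rfl

lemma closure_presentedGen :
    Subgroup.closure (presentedGen rels '' Set.Iio (m + 1)) = ⊤ := by
  rw [eq_top_iff, ← PresentedGroup.closure_range_of rels, Subgroup.closure_le]
  rintro _ ⟨i, rfl⟩
  exact Subgroup.subset_closure ⟨i, i.2, (mk_of_eq_presentedGen i).symm⟩

lemma presentedGen_relations (h : sphereRels m ⊆ rels) : IsBraid (presentedGen rels) (m + 1) ∧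
    asc (presentedGen rels) 0 (m + 1) * desc (presentedGen rels) 0 (m + 1) = 1 :=
  (map_sphereRels_eq_one_iff mk_of_eq_presentedGen).1 fun _ hr =>
    PresentedGroup.one_of_mem (h hr)

variable {R W : Type*} [CommRing R] [AddCommGroup W] [Module R W]

lemma exists_injective_of_relations [Nontrivial W] (h : sphereRels m ⊆ rels)
    (ρ : BraidGroup m →* (Module.End R W)ˣ)
    (hX : ∀ r ∈ rels, FreeGroup.lift
      (fun i : Fin (m + 1) => sphereOp (fun i => ρ (braidGen m i)) m i) r = 1)
    (hker : ∀ k, ρ k = 1 → (presentedGen_relations h).1.discMap k = 1) :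
    ∃ Φ : PresentedGroup rels →* (Module.End R (Fin (m + 2) → W))ˣ, Function.Injective Φ := by
  refine ⟨PresentedGroup.toGroup hX, injective_of_sphereOp (presentedGen_relations h).1
    (presentedGen_relations h).2 closure_presentedGen ρ (fun i hi => ?_) hker⟩
  rw [presentedGen, dif_pos hi, PresentedGroup.toGroup.of]

lemma isBraid_rep (ρ : BraidGroup m →* (Module.End R W)ˣ) :
    IsBraid (fun i => ρ (braidGen m i)) m := (isBraid_braidGen m).map ρ

lemma asc_rep_pow (ρ : BraidGroup m →* (Module.End R W)ˣ) :
    asc (fun i => ρ (braidGen m i)) 0 m ^ (m + 1) = ρ (fullTwist m) := by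
  rw [fullTwist, map_pow, map_asc]

lemma exists_injective_mcg [Nontrivial W] (ρ : BraidGroup m →* (Module.End R W)ˣ)
    (hρ : ρ (fullTwist m) = 1) (hker : ∀ x, ρ x = 1 → ∃ k : ℤ, x = fullTwist m ^ k) :
    ∃ Φ : PresentedGroup (mcgRels m) →* (Module.End R (Fin (m + 2) → W))ˣ,
      Function.Injective Φ := by
  have hs := isBraid_rep ρ
  have ht := (asc_rep_pow ρ).trans hρ
  refine exists_injective_of_relations Set.subset_union_left ρ
    ((map_mcgRels_eq_one_iff (X := sphereOp (fun i => ρ (braidGen m i)) m)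
      fun i => FreeGroup.lift_apply_of).2
      ⟨⟨isBraid_sphereOp hs, sphereOp_relation hs (by rw [ht, one_pow])⟩,
        sphereOp_twist_eq_one hs ht⟩) fun x hx => ?_
  obtain ⟨k, rfl⟩ := hker x hx
  rw [map_zpow, IsBraid.discMap_fullTwist,
    ((map_mcgRels_eq_one_iff mk_of_eq_presentedGen).1 fun _ => PresentedGroup.one_of_mem).2,
    one_zpow]

lemma exists_injective_sphere [Nontrivial W] (ρ : BraidGroup m →* (Module.End R W)ˣ)
    (hρ : ρ (fullTwist m) ^ 2 = 1)
    (hker : ∀ x, ρ x = 1 → ∃ k : ℤ, x = fullTwist m ^ k ∧ Even k) :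
    ∃ Φ : PresentedGroup (sphereRels m) →* (Module.End R (Fin (m + 2) → W))ˣ,
      Function.Injective Φ := by
  have hs := isBraid_rep ρ
  refine exists_injective_of_relations subset_rfl ρ
    ((map_sphereRels_eq_one_iff (X := sphereOp (fun i => ρ (braidGen m i)) m)
      fun i => FreeGroup.lift_apply_of).2
      ⟨isBraid_sphereOp hs, sphereOp_relation hs (by rw [asc_rep_pow, hρ])⟩) fun x hx => ?_
  obtain ⟨k, rfl, l, rfl⟩ := hker x hx
  have hd := presentedGen_relations (subset_refl (sphereRels m))
  have h := hd.1.sphere_twist_sq hd.2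
  rw [← hd.1.discMap_fullTwist] at h
  rw [map_zpow, ← two_mul, zpow_mul, zpow_ofNat, h, one_zpow]

end Induced

section GeneralLinear

variable {R : Type*} [CommRing R] [Nontrivial R]

lemma exists_injective_GL {G M : Type*} [Group G] [AddCommGroup M] [Module R M] [Module.Free R M]
    [Module.Finite R M] {k : ℕ} (hk : Module.finrank R M ≤ k) {Φ : G →* (Module.End R M)ˣ}
    (hΦ : Function.Injective Φ) : ∃ φ : G →* GL (Fin k) R, Function.Injective φ := by
  let c := k - Module.finrank R M
  let pad : Module.End R M →* Module.End R (M × (Fin c → R)) :=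
    { toFun := fun S => S.prodMap 1
      map_one' := by ext <;> simp
      map_mul' := fun S S' => by ext <;> simp }
  have hpad : Function.Injective pad := fun S S' h => LinearMap.ext fun x =>
    congrArg Prod.fst (LinearMap.congr_fun h (x, 0))
  let b : Module.Basis (Fin k) R (M × (Fin c → R)) :=
    Module.finBasisOfFinrankEq R _ (by simp [c, hk])
  let e := LinearMap.toMatrixAlgEquiv b
  refine ⟨((Units.map (e : _ →* Matrix (Fin k) (Fin k) R)).comp (Units.map pad)).comp Φ, ?_⟩
  exact ((Units.map_injective e.injective).comp (Units.map_injective hpad)).comp hΦ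

lemma card_pairs (p : ℕ) : Fintype.card (Pairs p) = p * (p - 1) / 2 := by
  refine (Fintype.card_sigma (α := fun j : Fin p => Fin j)).trans ?_
  simp only [Fintype.card_fin]
  rw [Fin.sum_univ_eq_sum_range (fun i => i), Finset.sum_range_id]

lemma finrank_induced_le {m n : ℕ} (hm : 0 < m) (hn : n + 1 = m * (m + 1)) :
    Module.finrank R (Fin (m + 2) → Fin (n + 1) → Pairs (m + 1) → R) ≤
      (m + 1) * m * Nat.factorial (m + 2) / 2 := by
  have h2 : 2 ∣ (m + 1) * m := by rw [mul_comm]; exact (Nat.even_mul_succ_self m).two_dvd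
  rw [Module.finrank_pi_fintype, Finset.sum_const, Module.finrank_pi_fintype, Finset.sum_const]
  simp only [Module.finrank_fintype_fun_eq_card, Finset.card_univ, Fintype.card_fin, card_pairs,
    smul_eq_mul, hn, Nat.add_sub_cancel]
  rw [← Nat.div_mul_right_comm h2, ← mul_assoc, mul_comm]
  refine Nat.mul_le_mul_left _ ?_
  obtain ⟨l, rfl⟩ := Nat.exists_eq_succ_of_ne_zero hm.ne'
  have := Nat.factorial_pos l
  simp only [Nat.factorial_succ, Nat.succ_eq_add_one]
  nlinarith [Nat.mul_le_mul_left ((l + 1 + 2) * ((l + 1) * (l + 1 + 1))) this]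

end GeneralLinear

section Linear

variable {R : Type} [CommRing R] {q t : R}

lemma IsLKParam.even_of_neg_one_zpow (hqt : IsLKParam q t) {k : ℤ} (hk : (-1 : Rˣ) ^ k = 1) :
    Even k := by
  by_contra h
  rw [Int.not_even_iff_odd] at h
  rw [h.neg_one_zpow] at hk
  obtain ⟨O, _, φ, ψ, -, -, hφ, -⟩ := hqt.spec
  have h1 : (-1 : O) = 1 := hφ (by simpa using congrArg Units.val hk)
  have h2 : (-1 : ℚ) = 1 := by simpa using congrArg ψ h1
  norm_num at h2

lemma exists_injective_GL_mcg [IsDomain R] (hqt : IsLKParam q t) {m k : ℕ} (hm : 0 < m)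
    (hk : (m + 1) * m * Nat.factorial (m + 2) / 2 ≤ k) :
    ∃ φ : PresentedGroup (mcgRels m) →* GL (Fin k) R, Function.Injective φ := by
  obtain ⟨n, hn⟩ : ∃ n, n + 1 = m * (m + 1) :=
    ⟨m * (m + 1) - 1, Nat.sub_add_cancel (Nat.mul_pos hm m.succ_pos)⟩
  obtain ⟨ρ, hρ, hker⟩ := exists_twisted_lkRep hqt hm hn (ε := 1) (Or.inl rfl)
  have : Nonempty (Pairs (m + 1)) := ⟨⟨⟨m, by omega⟩, ⟨0, hm⟩⟩⟩
  obtain ⟨Φ, hΦ⟩ := exists_injective_mcg ρ (by rw [hρ, map_one]) fun x hx =>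
    (hker x hx).imp fun _ h => h.1
  exact exists_injective_GL ((finrank_induced_le hm hn).trans hk) hΦ

lemma exists_injective_GL_sphere [IsDomain R] (hqt : IsLKParam q t) {m k : ℕ} (hm : 0 < m)
    (hk : (m + 1) * m * Nat.factorial (m + 2) / 2 ≤ k) :
    ∃ φ : PresentedGroup (sphereRels m) →* GL (Fin k) R, Function.Injective φ := by
  obtain ⟨n, hn⟩ : ∃ n, n + 1 = m * (m + 1) :=
    ⟨m * (m + 1) - 1, Nat.sub_add_cancel (Nat.mul_pos hm m.succ_pos)⟩
  obtain ⟨ρ, hρ, hker⟩ := exists_twisted_lkRep hqt hm hn (ε := -1) (Or.inr rfl)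
  have : Nonempty (Pairs (m + 1)) := ⟨⟨⟨m, by omega⟩, ⟨0, hm⟩⟩⟩
  obtain ⟨Φ, hΦ⟩ := exists_injective_sphere ρ (by rw [hρ, ← map_pow, neg_one_sq, map_one])
    fun x hx => (hker x hx).imp fun _ h => ⟨h.1, hqt.even_of_neg_one_zpow h.2⟩
  exact exists_injective_GL ((finrank_induced_le hm hn).trans hk) hΦ

lemma isLKParam_laurent : IsLKParam (R := LaurentPolynomial (LaurentPolynomial ℤ))
    (LaurentPolynomial.C (LaurentPolynomial.T 1)) (LaurentPolynomial.T 1) where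
  isUnit_q := (LaurentPolynomial.isUnit_T 1).map LaurentPolynomial.C
  isUnit_t := LaurentPolynomial.isUnit_T 1
  spec := by
    refine ⟨Polynomial (LaurentPolynomial ℤ), inferInstance, Polynomial.toLaurent,
      Polynomial.eval₂RingHom (LaurentPolynomial.eval₂ (Int.castRingHom ℚ)
        (Units.mk0 (1 / 2) (by norm_num))) 0, Polynomial.C (LaurentPolynomial.T 1), Polynomial.X,
      Polynomial.toLaurent_injective, ?_, ?_, ?_, ?_⟩
    · rw [Polynomial.toLaurent_C]
    · rw [Polynomial.toLaurent_X]
    · simp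
    · simp

lemma exists_injective_GL_field {G R : Type} [Group G] [CommRing R] [IsDomain R] {k : ℕ}
    {φ : G →* GL (Fin k) R} (hφ : Function.Injective φ) :
    ∃ (k : ℕ) (F : Type) (_ : Field F) (f : G →* GL (Fin k) F), Function.Injective f := by
  refine ⟨k, FractionRing R, inferInstance,
    (Matrix.GeneralLinearGroup.map (algebraMap R (FractionRing R))).comp φ, ?_⟩
  have h : Function.Injective (algebraMap R (FractionRing R)).mapMatrix :=
    Matrix.map_injective (m := Fin k) (n := Fin k) (IsFractionRing.injective R (FractionRing R))
  exact fun x y hxy => hφ (Units.ext (h (congrArg Units.val hxy)))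

lemma exists_injective_GL_of_single {rels : Set (FreeGroup (Fin 1))} (h : sphereRels 0 ⊆ rels)
    (h' : ∀ r ∈ rels, FreeGroup.lift (fun _ => (-1 : GL (Fin 1) ℚ)) r = 1) :
    ∃ (k : ℕ) (F : Type) (_ : Field F) (f : PresentedGroup rels →* GL (Fin k) F),
      Function.Injective f := by
  refine ⟨1, ℚ, inferInstance, PresentedGroup.toGroup h', ?_⟩
  have hsq : presentedGen rels 0 * presentedGen rels 0 = 1 := by
    simpa [asc, desc] using (presentedGen_relations h).2
  have hcases : ∀ x : PresentedGroup rels, x = 1 ∨ x = presentedGen rels 0 := by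
    intro x
    have hx : x ∈ Subgroup.closure (presentedGen rels '' Set.Iio (0 + 1)) := by
      rw [closure_presentedGen]; trivial
    induction hx using Subgroup.closure_induction_left with
    | one => exact Or.inl rfl
    | mul_left x hx y hy ih =>
      obtain ⟨i, hi, rfl⟩ := hx
      obtain rfl : i = 0 := by simpa using hi
      rcases ih with rfl | rfl
      · exact Or.inr (mul_one _)
      · exact Or.inl hsq
    | inv_mul_cancel x hx y hy ih =>
      obtain ⟨i, hi, rfl⟩ := hx
      obtain rfl : i = 0 := by simpa using hi
      rw [inv_eq_of_mul_eq_one_left hsq]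
      rcases ih with rfl | rfl
      · exact Or.inr (mul_one _)
      · exact Or.inl hsq
  rw [injective_iff_map_eq_one]
  intro x hx
  refine (hcases x).resolve_right ?_
  rintro rfl
  rw [show presentedGen rels 0 = PresentedGroup.of 0 from (mk_of_eq_presentedGen 0).symm] at hx
  have hx' : (-1 : GL (Fin 1) ℚ) = 1 := (PresentedGroup.toGroup.of h').symm.trans hx
  have := congrArg (fun g : GL (Fin 1) ℚ => g.1 0 0) hx'
  norm_num at this

lemma neg_one_relations {G : Type*} [Group G] [HasDistribNeg G] :
    (IsBraid (fun _ : ℕ => (-1 : G)) (0 + 1) ∧ asc (fun _ : ℕ => (-1 : G)) 0 (0 + 1) *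
      desc (fun _ : ℕ => (-1 : G)) 0 (0 + 1) = 1) ∧
      asc (fun _ : ℕ => (-1 : G)) 0 0 ^ (0 + 1) = 1 :=
  ⟨⟨⟨fun _ _ => rfl, fun _ _ _ _ => rfl⟩, by simp [asc, desc]⟩, by simp⟩

end Linear

/-- Theorem 6.1: the mapping class group `M(0,n)` of the `n`-punctured 2-sphere and the
braid group `B_n(S²)` of the 2-sphere are linear for every `n ≥ 2`; moreover for every
`n ≥ 4` there are injective homomorphisms `M(0,n) → GL_m(R)` and `B_n(S²) → GL_{2m}(R)`
over the ring `R = ℤ[t^{±1}, q^{±1}]` of Laurent polynomials in two variables, with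
`m = (n-1)(n-2)·n!/2`.  (Here `n = m' + 2`.) -/
theorem sphere_braid_and_mcg_linear :
    (∀ m : ℕ,
      (∃ (k : ℕ) (F : Type) (_ : Field F)
        (f : PresentedGroup (mcgRels m) →* GL (Fin k) F), Function.Injective f) ∧
      (∃ (k : ℕ) (F : Type) (_ : Field F)
        (f : PresentedGroup (sphereRels m) →* GL (Fin k) F), Function.Injective f)) ∧
    (∀ m : ℕ, 2 ≤ m →
      (∃ φ : PresentedGroup (mcgRels m) →*
          GL (Fin ((m + 1) * m * Nat.factorial (m + 2) / 2))
            (LaurentPolynomial (LaurentPolynomial ℤ)),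
        Function.Injective φ) ∧
      (∃ φ₁ : PresentedGroup (sphereRels m) →*
          GL (Fin (2 * ((m + 1) * m * Nat.factorial (m + 2) / 2)))
            (LaurentPolynomial (LaurentPolynomial ℤ)),
        Function.Injective φ₁)) := by
  refine ⟨fun m => ?_, fun m hm => ⟨exists_injective_GL_mcg isLKParam_laurent (by omega) le_rfl,
    exists_injective_GL_sphere isLKParam_laurent (by omega) (by omega)⟩⟩
  rcases Nat.eq_zero_or_pos m with rfl | hm
  · exact ⟨exists_injective_GL_of_single Set.subset_union_left
      ((map_mcgRels_eq_one_iff (X := fun _ => -1) fun _ => FreeGroup.lift_apply_of).2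
        neg_one_relations),
      exists_injective_GL_of_single subset_rfl
      ((map_sphereRels_eq_one_iff (X := fun _ => -1) fun _ => FreeGroup.lift_apply_of).2
        neg_one_relations.1)⟩
  · obtain ⟨φ, hφ⟩ := exists_injective_GL_mcg isLKParam_laurent hm le_rfl
    obtain ⟨φ₁, hφ₁⟩ := exists_injective_GL_sphere isLKParam_laurent hm le_rfl
    exact ⟨exists_injective_GL_field hφ, exists_injective_GL_field hφ₁⟩
end
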